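/- Let f ∈ ℤ[x] be irreducible over ℚ of even degree ≥ 4. Then there is a set of primes p of positive density such that for every such p, the quadratic twist C_p: p·y² = f(x) of the hyperelliptic curve y² = f(x) satisfies C_p(ℚ_p) = ∅, hence C_p(ℚ) = ∅. -/

import Mathlib

section
open MeasureTheory Filter Topology Set

namespace PIT

/-- Fejer kernel. -/
noncomputable def fej (v : ℝ) : ℝ := 2 * (1 - Real.cos v) / v ^ 2

lemma fej_nonneg (v : ℝ) : 0 ≤ fej v := by
  unfold fej
  have := Real.cos_le_one v
  have h2 := sq_nonneg v
  apply div_nonneg _ h2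
  linarith

lemma fej_measurable : Measurable fej := by
  unfold fej
  fun_prop

lemma fej_le (v : ℝ) : fej v ≤ 5 * (1 + v ^ 2)⁻¹ := by
  unfold fej
  by_cases hv : v = 0
  · subst hv; simp
  have hv2 : 0 < v ^ 2 := by positivity
  rw [div_le_iff₀ hv2, mul_assoc, ← div_eq_inv_mul, ← mul_div_assoc, le_div_iff₀ (by positivity)]
  have h1 := Real.one_sub_sq_div_two_le_cos (x := v)
  have h2 := Real.neg_one_le_cos v
  nlinarith

lemma fej_integrable : Integrable fej := by
  refine Integrable.mono' (integrable_inv_one_add_sq.const_mul 5) fej_measurable.aestronglyMeasurable ?_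
  refine ae_of_all _ fun v => ?_
  rw [Real.norm_of_nonneg (fej_nonneg v)]
  exact fej_le v

lemma fej_integral_pos : 0 < ∫ v, fej v := by
  rw [integral_pos_iff_support_of_nonneg fej_nonneg fej_integrable]
  refine lt_of_lt_of_le ?_ (measure_mono (s := Ioo 1 2) ?_)
  · simp
  · intro v hv
    simp only [Function.mem_support, fej]
    have h1 : Real.cos v < 1 := by
      have := Real.cos_lt_cos_of_nonneg_of_le_pi (x := 0) (y := v) le_rfl
        (by linarith [hv.2, Real.pi_gt_three]) (by linarith [hv.1])
      simpa using this
    have h0 : v ≠ 0 := by linarith [hv.1]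
    have : 0 < 1 - Real.cos v := by linarith
    positivity

lemma fej_real (v : ℝ) (hv : v ≠ 0) :
    ∫ t in (0:ℝ)..1, 2 * (1 - t) * Real.cos (t * v) = fej v := by
  have : ∀ t ∈ uIcc (0:ℝ) 1, HasDerivAt
      (fun t : ℝ => 2 * ((1 - t) * Real.sin (t * v) / v - Real.cos (t * v) / v ^ 2))
      (2 * (1 - t) * Real.cos (t * v)) t := by
    intro t _
    have h1 : HasDerivAt (fun t : ℝ => t * v) v t := by
      simpa using (hasDerivAt_id t).mul_const v
    have h2 : HasDerivAt (fun t : ℝ => 1 - t) (-1) t := by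
      simpa using (hasDerivAt_id t).const_sub 1
    refine ((((h2.mul h1.sin).div_const v).sub (h1.cos.div_const (v ^ 2))).const_mul 2).congr_deriv ?_
    field_simp
    ring
  rw [intervalIntegral.integral_eq_sub_of_hasDerivAt this
    (Continuous.intervalIntegrable (by fun_prop) _ _)]
  simp [fej]
  field_simp
  ring

lemma fej_fourier (v : ℝ) (hv : v ≠ 0) :
    ∫ t in (-1:ℝ)..1, ((1 - |t| : ℝ) : ℂ) * Complex.exp (Complex.I * t * v) = fej v := by
  have hc : Continuous fun t : ℝ => ((1 - |t| : ℝ) : ℂ) * Complex.exp (Complex.I * t * v) := by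
    fun_prop
  rw [← intervalIntegral.integral_add_adjacent_intervals (b := 0)
    (hc.intervalIntegrable _ _) (hc.intervalIntegrable _ _)]
  have h1 : ∫ t in (-1:ℝ)..0, ((1 - |t| : ℝ) : ℂ) * Complex.exp (Complex.I * t * v)
      = ∫ t in (0:ℝ)..1, ((1 - |t| : ℝ) : ℂ) * Complex.exp (-(Complex.I * t * v)) := by
    have := intervalIntegral.integral_comp_neg (a := 0) (b := 1)
      (fun t : ℝ => ((1 - |t| : ℝ) : ℂ) * Complex.exp (Complex.I * t * v))
    simp only [neg_zero] at this
    rw [← this]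
    congr 1
    ext t
    simp
  rw [h1, ← intervalIntegral.integral_add (Continuous.intervalIntegrable (by fun_prop) _ _)
    (hc.intervalIntegrable _ _), ← fej_real v hv, ← intervalIntegral.integral_ofReal]
  apply intervalIntegral.integral_congr
  intro t ht
  rw [uIcc_of_le (by norm_num)] at ht
  simp only [abs_of_nonneg ht.1]
  push_cast
  rw [Complex.cos]
  have e1 : Complex.I * t * v = (t * v : ℂ) * Complex.I := by ring
  have e2 : -(t * v : ℂ) * Complex.I = -((t * v : ℂ) * Complex.I) := by ring
  rw [e1, e2]
  ring

end PIT

end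

section
open MeasureTheory Filter Topology Set

namespace PIT

lemma fej_comp_integrable {T : ℝ} (hT : 0 < T) (y : ℝ) :
    Integrable (fun u : ℝ => fej (T * (y - u))) := by
  have h1 : Integrable (fun u => fej (T * u)) := fej_integrable.comp_mul_left' hT.ne'
  exact h1.comp_sub_left y

lemma riemannLebesgue {T : ℝ} (hT : 0 < T) (G : ℝ → ℂ) :
    Tendsto (fun y : ℝ => ∫ t in (-1:ℝ)..1, Complex.exp (Complex.I * t * (T * y)) * G t) atTop (𝓝 0) := by
  have h := Real.tendsto_integral_exp_smul_cocompact ((Ioc (-1:ℝ) 1).indicator G)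
  have h2 : Tendsto (fun y : ℝ => -(T * y / (2 * Real.pi))) atTop (cocompact ℝ) := by
    have : Tendsto (fun y : ℝ => -(T * y / (2 * Real.pi))) atTop atBot := by
      apply tendsto_neg_atTop_atBot.comp
      exact (Tendsto.const_mul_atTop hT tendsto_id).atTop_div_const (by positivity)
    exact this.mono_right atBot_le_cocompact
  refine (h.comp h2).congr fun y => ?_
  simp only [Function.comp]
  rw [intervalIntegral.integral_of_le (by norm_num), ← integral_indicator measurableSet_Ioc]
  congr 1
  ext t
  by_cases ht : t ∈ Ioc (-1:ℝ) 1
  · simp only [indicator_of_mem ht, Circle.smul_def, smul_eq_mul]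
    rw [Real.fourierChar_apply]
    congr 2
    push_cast
    have : (Real.pi : ℂ) ≠ 0 := by exact_mod_cast Real.pi_ne_zero
    field_simp
  · simp [indicator_of_notMem ht]

lemma fubini_step (f : ℝ → ℝ) (hf : Measurable f) (M : ℝ) (hM : ∀ u, |f u| ≤ M)
    (H : ℂ → ℂ)
    (hL : ∀ s : ℂ, 0 < s.re → ∫ u in Ioi (0:ℝ), (f u : ℂ) * Complex.exp (-s * u) = H s)
    {T : ℝ} (hT : 0 < T) (y : ℝ) {ε : ℝ} (hε : 0 < ε) :
    ∫ u in Ioi (0:ℝ), (f u : ℂ) * Complex.exp (-ε * u) * (fej (T * (y - u)) : ℂ)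
     = ∫ t in (-1:ℝ)..1, Complex.exp (Complex.I * t * (T * y)) *
        (((1 - |t| : ℝ) : ℂ) * H (ε + Complex.I * t * T)) := by
  set Φ : ℝ → ℝ → ℂ := fun u t => (f u : ℂ) * Complex.exp (-ε * u) *
    (((1 - |t| : ℝ) : ℂ) * Complex.exp (Complex.I * t * (T * (y - u) : ℝ))) with hΦ
  have h1 : ∫ u in Ioi (0:ℝ), (f u : ℂ) * Complex.exp (-ε * u) * (fej (T * (y - u)) : ℂ)
     = ∫ u in Ioi (0:ℝ), ∫ t in Ioc (-1:ℝ) 1, Φ u t := by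
    apply integral_congr_ae
    have : ∀ᵐ u ∂(volume.restrict (Ioi (0:ℝ))), u ≠ y := by
      apply ae_restrict_of_ae
      exact Measure.ae_ne volume y
    filter_upwards [this] with u hu
    rw [← fej_fourier _ (mul_ne_zero hT.ne' (sub_ne_zero.mpr hu.symm)),
      intervalIntegral.integral_of_le (by norm_num), ← integral_const_mul]
  rw [h1, integral_integral_swap]
  · rw [intervalIntegral.integral_of_le (by norm_num)]
    apply integral_congr_ae
    refine ae_of_all _ fun t => ?_
    simp only [hΦ]
    rw [← hL _ (by simp [hε]), ← integral_const_mul, ← integral_const_mul]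
    congr 1
    ext u
    have : Complex.exp (-ε * u) * Complex.exp (Complex.I * t * (T * (y - u) : ℝ)) =
      Complex.exp (Complex.I * t * (T * y)) * Complex.exp (-(ε + Complex.I * t * T) * u) := by
      rw [← Complex.exp_add, ← Complex.exp_add]
      congr 1
      push_cast
      ring
    linear_combination (f u : ℂ) * ((1 - |t| : ℝ) : ℂ) * this
  · have hi : Integrable (fun p : ℝ × ℝ => (M * Real.exp (-ε * p.1)) * (1:ℝ))
        ((volume.restrict (Ioi (0:ℝ))).prod (volume.restrict (Ioc (-1:ℝ) 1))) := by
      refine Integrable.mul_prod (f := fun u : ℝ => M * Real.exp (-ε * u)) (g := fun _ : ℝ => (1:ℝ)) ?_ ?_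
      · exact (integrableOn_exp_mul_Ioi (by linarith) 0).const_mul M
      · exact integrable_const _
    refine Integrable.mono' hi ?_ ?_
    · apply Measurable.aestronglyMeasurable
      simp only [hΦ, Function.uncurry_def]
      fun_prop
    · have : ∀ᵐ p ∂((volume.restrict (Ioi (0:ℝ))).prod (volume.restrict (Ioc (-1:ℝ) 1))),
          p ∈ Ioi (0:ℝ) ×ˢ Ioc (-1:ℝ) 1 := by
        rw [Measure.prod_restrict]
        exact ae_restrict_mem (measurableSet_Ioi.prod measurableSet_Ioc)
      filter_upwards [this] with p hp
      simp only [hΦ, Function.uncurry_def, norm_mul, Complex.norm_real, Complex.norm_exp]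
      have h2 : abs (1 - |p.2|) ≤ 1 := by
        have := abs_le.mpr ⟨hp.2.1.le, hp.2.2⟩
        rw [abs_le]; constructor <;> linarith [abs_nonneg p.2]
      have e1 : (-(ε:ℂ) * (p.1:ℂ)).re = -ε * p.1 := by simp
      have e2 : (Complex.I * p.2 * ((T * (y - p.1) : ℝ) : ℂ)).re = 0 := by simp
      rw [e1, e2, Real.exp_zero, mul_one]
      apply mul_le_mul
      · apply mul_le_mul_of_nonneg_right (hM _) (Real.exp_pos _).le
      · exact h2
      · exact norm_nonneg _
      · exact mul_nonneg ((abs_nonneg _).trans (hM 0)) (Real.exp_pos _).le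

lemma tauber_step (f : ℝ → ℝ) (hf : Measurable f) (M : ℝ) (hM : ∀ u, |f u| ≤ M)
    (H : ℂ → ℂ) (hH : ContinuousOn H {s | 0 ≤ s.re})
    (hL : ∀ s : ℂ, 0 < s.re → ∫ u in Ioi (0:ℝ), (f u : ℂ) * Complex.exp (-s * u) = H s)
    {T : ℝ} (hT : 0 < T) :
    Tendsto (fun y : ℝ => ∫ u in Ioi (0:ℝ), f u * fej (T * (y - u))) atTop (𝓝 0) := by
  have hMp : 0 ≤ M := (abs_nonneg _).trans (hM 0)
  have key : ∀ y : ℝ, ((∫ u in Ioi (0:ℝ), f u * fej (T * (y - u)) : ℝ) : ℂ) =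
      ∫ t in (-1:ℝ)..1, Complex.exp (Complex.I * t * (T * y)) *
        (((1 - |t| : ℝ) : ℂ) * H (Complex.I * t * T)) := by
    intro y
    have hε : Tendsto (fun n : ℕ => 1 / ((n : ℝ) + 1)) atTop (𝓝 0) :=
      tendsto_one_div_add_atTop_nhds_zero_nat
    have hεp : ∀ n : ℕ, 0 < 1 / ((n : ℝ) + 1) := fun n => by positivity
    have hε1 : ∀ n : ℕ, 1 / ((n : ℝ) + 1) ≤ 1 := fun n => by
      rw [div_le_one (by positivity)]; linarith [(Nat.cast_nonneg n : (0:ℝ) ≤ n)]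
    have hA : Tendsto (fun n : ℕ => ∫ u in Ioi (0:ℝ), (f u : ℂ) *
        Complex.exp (-((1 / ((n : ℝ) + 1) : ℝ) : ℂ) * u) * (fej (T * (y - u)) : ℂ)) atTop
        (𝓝 (∫ u in Ioi (0:ℝ), (f u : ℂ) * Complex.exp (-((0 : ℝ) : ℂ) * u) * (fej (T * (y - u)) : ℂ))) := by
      apply tendsto_integral_of_dominated_convergence (fun u => M * fej (T * (y - u)))
      · intro n
        apply Measurable.aestronglyMeasurable
        have := fej_measurable
        fun_prop
      · exact ((fej_comp_integrable hT y).const_mul M).integrableOn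
      · intro n
        filter_upwards [ae_restrict_mem measurableSet_Ioi] with u hu
        simp only [norm_mul, Complex.norm_real, Complex.norm_exp]
        rw [Real.norm_of_nonneg (fej_nonneg _)]
        apply mul_le_mul_of_nonneg_right _ (fej_nonneg _)
        have e1 : (-((1 / ((n : ℝ) + 1) : ℝ) : ℂ) * (u:ℂ)).re = -(1 / ((n : ℝ) + 1)) * u := by
          rw [← Complex.ofReal_neg, ← Complex.ofReal_mul, Complex.ofReal_re]
        rw [e1]
        have : Real.exp (-(1 / ((n : ℝ) + 1)) * u) ≤ 1 := by
          rw [Real.exp_le_one_iff]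
          have := mul_pos (hεp n) hu
          linarith
        calc ‖f u‖ * _ ≤ M * 1 := mul_le_mul (hM u) this (Real.exp_pos _).le hMp
          _ = M := mul_one _
      · refine ae_of_all _ fun u => ?_
        apply Tendsto.mul_const
        apply Tendsto.const_mul
        have : Continuous fun e : ℝ => Complex.exp (-(e : ℂ) * u) := by fun_prop
        exact (this.tendsto 0).comp hε
    have hB : Tendsto (fun n : ℕ => ∫ t in (-1:ℝ)..1, Complex.exp (Complex.I * t * (T * y)) *
        (((1 - |t| : ℝ) : ℂ) * H (((1 / ((n : ℝ) + 1) : ℝ) : ℂ) + Complex.I * t * T))) atTop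
        (𝓝 (∫ t in (-1:ℝ)..1, Complex.exp (Complex.I * t * (T * y)) *
        (((1 - |t| : ℝ) : ℂ) * H (Complex.I * t * T)))) := by
      have hco : ContinuousOn (fun p : ℝ × ℝ => H ((p.1 : ℂ) + Complex.I * p.2 * T))
          (Icc 0 1 ×ˢ Icc (-1) 1) := by
        refine hH.comp (by fun_prop) ?_
        intro p hp
        simpa using hp.1.1
      obtain ⟨B, hB⟩ := (isCompact_Icc.prod isCompact_Icc).exists_bound_of_continuousOn hco
      apply intervalIntegral.tendsto_integral_filter_of_dominated_convergence (fun _ => 1 * B)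
      · refine Eventually.of_forall fun n => ?_
        apply ContinuousOn.aestronglyMeasurable _ measurableSet_uIoc
        refine ContinuousOn.mul (by fun_prop) (ContinuousOn.mul (by fun_prop) ?_)
        refine hH.comp (by fun_prop) ?_
        intro t _
        simp only [mem_ofPred_eq, Complex.add_re, Complex.ofReal_re]
        have : (Complex.I * t * T).re = 0 := by simp
        rw [this]
        linarith [hεp n]
      · refine Eventually.of_forall fun n => ?_
        refine ae_of_all _ fun t ht => ?_
        rw [uIoc_of_le (by norm_num)] at ht
        have hb := hB (1 / ((n : ℝ) + 1), t) ⟨⟨(hεp n).le, hε1 n⟩, ⟨ht.1.le, ht.2⟩⟩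
        have h2 : abs (1 - |t|) ≤ 1 := by
          have := abs_le.mpr ⟨ht.1.le, ht.2⟩
          rw [abs_le]; constructor <;> linarith [abs_nonneg t]
        have e2 : (Complex.I * t * (T * y)).re = 0 := by simp
        rw [norm_mul, norm_mul, Complex.norm_exp, e2, Real.exp_zero, one_mul, Complex.norm_real]
        exact mul_le_mul h2 hb (norm_nonneg _) zero_le_one
      · simp
      · refine ae_of_all _ fun t ht => ?_
        apply Tendsto.const_mul
        apply Tendsto.const_mul
        have h0 : Complex.I * t * T ∈ {s : ℂ | 0 ≤ s.re} := by simp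
        refine (hH _ h0).tendsto.comp ?_
        rw [tendsto_nhdsWithin_iff]
        constructor
        · have : Continuous fun e : ℝ => (e : ℂ) + Complex.I * t * T := by fun_prop
          have := (this.tendsto 0).comp hε
          simp only [Complex.ofReal_zero, zero_add] at this
          exact this
        · refine Eventually.of_forall fun n => ?_
          simp only [mem_ofPred_eq, Complex.add_re, Complex.ofReal_re]
          have : (Complex.I * t * T).re = 0 := by simp
          rw [this]
          linarith [hεp n]
    have hAB := hA.congr fun n => fubini_step f hf M hM H hL hT y (hεp n)
    rw [← tendsto_nhds_unique hAB hB, ← integral_complex_ofReal]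
    congr 1
    ext u
    simp
  have := (riemannLebesgue hT (fun t => ((1 - |t| : ℝ) : ℂ) * H (Complex.I * t * T))).congr
    fun y => (key y).symm
  have h2 := (Complex.continuous_re.tendsto 0).comp this
  simpa [Function.comp_def] using h2

end PIT

end

section
open MeasureTheory Filter Topology Set

namespace PIT

lemma fej_even (v : ℝ) : fej (-v) = fej v := by simp [fej]

/-- full mass -/
noncomputable def fA (T : ℝ) : ℝ := ∫ u, fej (T * u)
/-- central mass -/
noncomputable def fa (δ T : ℝ) : ℝ := ∫ u in Icc (-δ) δ, fej (T * u)

lemma fejT_integrable {T : ℝ} (hT : 0 < T) : Integrable (fun u : ℝ => fej (T * u)) :=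
  fej_integrable.comp_mul_left' hT.ne'

lemma fA_eq {T : ℝ} (hT : 0 < T) : fA T = T⁻¹ * ∫ v, fej v := by
  unfold fA
  rw [Measure.integral_comp_mul_left (fun v => fej v) T, abs_of_pos (inv_pos.mpr hT), smul_eq_mul]

lemma fA_pos {T : ℝ} (hT : 0 < T) : 0 < fA T := by
  rw [fA_eq hT]; exact mul_pos (inv_pos.mpr hT) fej_integral_pos

lemma fa_le {T : ℝ} (hT : 0 < T) (δ : ℝ) : fa δ T ≤ fA T :=
  setIntegral_le_integral (fejT_integrable hT) (ae_of_all _ fun u => fej_nonneg _)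

lemma fa_ratio {δ : ℝ} (hδ : 0 < δ) : Tendsto (fun T => fa δ T / fA T) atTop (𝓝 1) := by
  have h1 : Tendsto (fun T : ℝ => ∫ v in (-(T * δ))..(T * δ), fej v) atTop (𝓝 (∫ v, fej v)) := by
    have hT : Tendsto (fun T : ℝ => T * δ) atTop atTop := tendsto_id.atTop_mul_const hδ
    exact intervalIntegral_tendsto_integral fej_integrable (tendsto_neg_atTop_atBot.comp hT) hT
  have h2 := h1.div_const (∫ v, fej v)
  rw [div_self fej_integral_pos.ne'] at h2
  refine h2.congr' ?_
  filter_upwards [eventually_gt_atTop 0] with T hT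
  have : fa δ T = T⁻¹ * ∫ v in (-(T * δ))..(T * δ), fej v := by
    unfold fa
    rw [integral_Icc_eq_integral_Ioc, ← intervalIntegral.integral_of_le (by linarith),
      intervalIntegral.integral_comp_mul_left (fun v => fej v) hT.ne', smul_eq_mul, mul_neg]
  rw [this, fA_eq hT, mul_div_mul_left _ _ (inv_ne_zero hT.ne')]

lemma fej_total {T : ℝ} (y : ℝ) : ∫ u, fej (T * (y - u)) = fA T := by
  unfold fA
  rw [integral_sub_left_eq_self (fun u => fej (T * u)) volume y]

lemma fej_window {T δ : ℝ} (y : ℝ) :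
    ∫ u in Icc (y - δ) (y + δ), fej (T * (y - u)) = fa δ T := by
  unfold fa
  rw [← integral_indicator measurableSet_Icc, ← integral_indicator measurableSet_Icc,
    ← integral_sub_left_eq_self _ volume y]
  congr 1
  ext u
  by_cases h : u ∈ Icc (-δ) δ
  · rw [indicator_of_mem h, indicator_of_mem, sub_sub_cancel]
    constructor <;> linarith [h.1, h.2]
  · rw [indicator_of_notMem h, indicator_of_notMem]
    intro h'
    exact h ⟨by linarith [h'.2], by linarith [h'.1]⟩

lemma fej_half {T : ℝ} (hT : 0 < T) :
    Tendsto (fun y : ℝ => ∫ u in Ioi (0:ℝ), fej (T * (y - u))) atTop (𝓝 (fA T)) := by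
  have h := (fejT_integrable hT)
  have h1 : Tendsto (fun y : ℝ => ∫ u in Iic y, fej (T * u)) atTop (𝓝 (fA T)) := by
    have := (aecover_Iic (μ := (volume : Measure ℝ)) (l := atTop) (b := fun y : ℝ => y) tendsto_id).integral_tendsto_of_countably_generated h
    exact this
  refine h1.congr fun y => ?_
  rw [integral_Iic_eq_integral_Iio]
  rw [← integral_indicator measurableSet_Iio, ← integral_indicator measurableSet_Ioi,
    ← integral_sub_left_eq_self _ volume y]
  congr 1
  ext u
  by_cases h : 0 < u
  · rw [indicator_of_mem (by simpa using h), indicator_of_mem (by simpa using h)]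
  · rw [indicator_of_notMem (by simpa using h), indicator_of_notMem (by simpa using h)]

theorem tauber (ψ : ℝ → ℝ) (hmono : Monotone ψ) (hψ0 : ∀ u, 0 ≤ ψ u) (M : ℝ)
    (hM : ∀ u, ψ u ≤ M * Real.exp u)
    (H : ℂ → ℂ) (hH : ContinuousOn H {s | 0 ≤ s.re})
    (hL : ∀ s : ℂ, 0 < s.re →
      ∫ u in Ioi (0:ℝ), ((ψ u * Real.exp (-u) - 1 : ℝ) : ℂ) * Complex.exp (-s * u) = H s) :
    Tendsto (fun u => ψ u * Real.exp (-u)) atTop (𝓝 1) := by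
  set f : ℝ → ℝ := fun u => ψ u * Real.exp (-u) with hf
  have hf0 : ∀ u, 0 ≤ f u := fun u => mul_nonneg (hψ0 u) (Real.exp_pos _).le
  have hfM : ∀ u, f u ≤ M := fun u => by
    have := mul_le_mul_of_nonneg_right (hM u) (Real.exp_pos (-u)).le
    rwa [mul_assoc, ← Real.exp_add, add_neg_cancel, Real.exp_zero, mul_one] at this
  have hM0 : 0 ≤ M := (hf0 0).trans (hfM 0)
  have hfm : Measurable f := hmono.measurable.mul (by fun_prop)
  have hslow : ∀ u v, u ≤ v → f u ≤ Real.exp (v - u) * f v := fun u v huv => by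
    have e : Real.exp (v - u) * f v = ψ v * Real.exp (-u) := by
      simp only [hf]
      rw [mul_left_comm, ← Real.exp_add]; congr 2; ring
    rw [e]
    exact mul_le_mul_of_nonneg_right (hmono huv) (Real.exp_pos _).le
  have hJ : ∀ T : ℝ, 0 < T → Tendsto (fun y : ℝ => ∫ u in Ioi (0:ℝ), f u * fej (T * (y - u)))
      atTop (𝓝 (fA T)) := by
    intro T hT
    have h1 := tauber_step (fun u => f u - 1) (hfm.sub_const 1) (M + 1) (fun u => by
      rw [abs_le]; constructor <;> linarith [hf0 u, hfM u]) H hH hL hT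
    have h2 := h1.add (fej_half hT)
    rw [zero_add] at h2
    refine h2.congr fun y => ?_
    rw [← integral_add]
    · congr 1; ext u; ring
    · refine Integrable.integrableOn ?_
      refine Integrable.bdd_mul (c := M + 1) (fej_comp_integrable hT y) (hfm.sub_const 1).aestronglyMeasurable ?_
      refine ae_of_all _ fun u => ?_
      rw [Real.norm_eq_abs, abs_le]; constructor <;> linarith [hf0 u, hfM u]
    · exact (fej_comp_integrable hT y).integrableOn
  have hIntegr : ∀ T : ℝ, 0 < T → ∀ y, Integrable (fun u => f u * fej (T * (y - u))) := by
    intro T hT y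
    refine Integrable.bdd_mul (c := M) (fej_comp_integrable hT y) hfm.aestronglyMeasurable ?_
    refine ae_of_all _ fun u => ?_
    rw [Real.norm_of_nonneg (hf0 u)]; exact hfM u
  have hnn : ∀ T y u : ℝ, 0 ≤ f u * fej (T * (y - u)) := fun T y u => mul_nonneg (hf0 u) (fej_nonneg _)
  -- upper
  have hup : ∀ δ T : ℝ, 0 < δ → 0 < T → ∀ y, 0 < y →
      f y * fa δ T ≤ Real.exp (2 * δ) * ∫ u in Ioi (0:ℝ), f u * fej (T * ((y + δ) - u)) := by
    intro δ T hδ hT y hy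
    rw [← fej_window (y + δ), ← integral_const_mul, ← integral_const_mul]
    calc _ ≤ ∫ u in Icc (y + δ - δ) (y + δ + δ), Real.exp (2 * δ) * (f u * fej (T * ((y + δ) - u))) := by
          apply setIntegral_mono_on ((fej_comp_integrable hT _).integrableOn.const_mul _)
            ((hIntegr T hT _).integrableOn.const_mul _) measurableSet_Icc
          intro u hu
          rw [← mul_assoc]
          apply mul_le_mul_of_nonneg_right _ (fej_nonneg _)
          refine (hslow y u (by linarith [hu.1])).trans ?_
          apply mul_le_mul_of_nonneg_right _ (hf0 u)
          apply Real.exp_le_exp.mpr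
          linarith [hu.2]
      _ ≤ _ := by
          apply setIntegral_mono_set ((hIntegr T hT _).integrableOn.const_mul _)
          · exact ae_of_all _ fun u => mul_nonneg (Real.exp_pos _).le (hnn _ _ _)
          · apply LE.le.eventuallyLE
            intro u hu
            have := hu.1
            simp only [mem_Ioi]
            linarith
  have hlo : ∀ δ T : ℝ, 0 < δ → 0 < T → ∀ y,
      ∫ u in Ioi (0:ℝ), f u * fej (T * ((y - δ) - u)) ≤
        Real.exp (2 * δ) * f y * fa δ T + M * (fA T - fa δ T) := by
    intro δ T hδ hT y
    have hS : MeasurableSet (Icc (y - δ - δ) (y - δ + δ)) := measurableSet_Icc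
    calc _ ≤ ∫ u, f u * fej (T * ((y - δ) - u)) :=
          setIntegral_le_integral (hIntegr T hT _) (ae_of_all _ fun u => hnn _ _ _)
      _ = (∫ u in Icc (y - δ - δ) (y - δ + δ), f u * fej (T * ((y - δ) - u))) +
          ∫ u in (Icc (y - δ - δ) (y - δ + δ))ᶜ, f u * fej (T * ((y - δ) - u)) :=
          (integral_add_compl hS (hIntegr T hT _)).symm
      _ ≤ (∫ u in Icc (y - δ - δ) (y - δ + δ), Real.exp (2 * δ) * f y * fej (T * ((y - δ) - u))) +
          ∫ u in (Icc (y - δ - δ) (y - δ + δ))ᶜ, M * fej (T * ((y - δ) - u)) := by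
          apply add_le_add
          · apply setIntegral_mono_on (hIntegr T hT _).integrableOn
              ((fej_comp_integrable hT _).integrableOn.const_mul _) hS
            intro u hu
            apply mul_le_mul_of_nonneg_right _ (fej_nonneg _)
            refine (hslow u y (by linarith [hu.2])).trans ?_
            apply mul_le_mul_of_nonneg_right _ (hf0 y)
            apply Real.exp_le_exp.mpr
            linarith [hu.1]
          · apply setIntegral_mono_on (hIntegr T hT _).integrableOn
              ((fej_comp_integrable hT _).integrableOn.const_mul _) hS.compl
            intro u hu
            exact mul_le_mul_of_nonneg_right (hfM u) (fej_nonneg _)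
      _ = _ := by
          rw [integral_const_mul, integral_const_mul, fej_window]
          have := integral_add_compl hS (fej_comp_integrable hT (y - δ))
          rw [fej_window, fej_total] at this
          rw [← this]; ring
  rw [tendsto_order]
  constructor
  · intro b hb
    -- choose δ
    have h1 : ∃ δ : ℝ, 0 < δ ∧ Real.exp (2 * δ) * b < 1 := by
      have hc : Continuous fun δ : ℝ => Real.exp (2 * δ) * b := by fun_prop
      have := (hc.tendsto 0).eventually_lt_const (u := 1) (by simpa using hb)
      obtain ⟨ε, hε, h⟩ := Metric.eventually_nhds_iff.mp this
      exact ⟨ε / 2, by positivity, h (by simp [abs_of_pos hε, hε])⟩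
    obtain ⟨δ, hδ, hδb⟩ := h1
    have h2 : ∃ T : ℝ, 0 < T ∧ Real.exp (2 * δ) * b * (fa δ T / fA T) + M * (1 - fa δ T / fA T) < 1 := by
      have : Tendsto (fun T => Real.exp (2 * δ) * b * (fa δ T / fA T) + M * (1 - fa δ T / fA T)) atTop
        (𝓝 (Real.exp (2 * δ) * b * 1 + M * (1 - 1))) :=
        ((fa_ratio hδ).const_mul _).add (((fa_ratio hδ).const_sub 1).const_mul M)
      have := this.eventually_lt_const (u := 1) (by simpa using hδb)
      exact ((eventually_gt_atTop 0).and this).exists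
    obtain ⟨T, hT, hTb⟩ := h2
    have hA := fA_pos hT
    have h3 : Real.exp (2 * δ) * b * fa δ T + M * (fA T - fa δ T) < fA T := by
      have := mul_lt_mul_of_pos_right hTb hA
      field_simp at this
      linarith
    have h4 := ((hJ T hT).comp (tendsto_atTop_add_const_right atTop (-δ) tendsto_id)).eventually_const_lt h3
    filter_upwards [h4] with y hy
    have h5 := hlo δ T hδ hT y
    by_contra hcon
    push Not at hcon
    have ha0 : 0 ≤ fa δ T := integral_nonneg fun u => fej_nonneg _
    have : Real.exp (2 * δ) * f y * fa δ T ≤ Real.exp (2 * δ) * b * fa δ T := by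
      apply mul_le_mul_of_nonneg_right _ ha0
      exact mul_le_mul_of_nonneg_left hcon (Real.exp_pos _).le
    simp only [Function.comp, id, ← sub_eq_add_neg] at hy
    linarith
  · intro b hb
    have h1 : ∃ δ : ℝ, 0 < δ ∧ Real.exp (2 * δ) < b := by
      have hc : Continuous fun δ : ℝ => Real.exp (2 * δ) := by fun_prop
      have := (hc.tendsto 0).eventually_lt_const (u := b) (by simpa using hb)
      obtain ⟨ε, hε, h⟩ := Metric.eventually_nhds_iff.mp this
      exact ⟨ε / 2, by positivity, h (by simp [abs_of_pos hε, hε])⟩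
    obtain ⟨δ, hδ, hδb⟩ := h1
    have h2 : ∃ T : ℝ, 0 < T ∧ Real.exp (2 * δ) < b * (fa δ T / fA T) := by
      have : Tendsto (fun T => b * (fa δ T / fA T)) atTop (𝓝 (b * 1)) := (fa_ratio hδ).const_mul _
      have := this.eventually_const_lt (u := Real.exp (2 * δ)) (by simpa using hδb)
      exact ((eventually_gt_atTop 0).and this).exists
    obtain ⟨T, hT, hTb⟩ := h2
    have hA := fA_pos hT
    have h3 : fA T < Real.exp (-(2 * δ)) * (b * fa δ T) := by
      have := mul_lt_mul_of_pos_right hTb hA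
      rw [mul_assoc, div_mul_cancel₀ _ hA.ne'] at this
      have := mul_lt_mul_of_pos_left this (Real.exp_pos (-(2 * δ)))
      rwa [← mul_assoc, ← Real.exp_add, neg_add_cancel, Real.exp_zero, one_mul] at this
    have h4 := ((hJ T hT).comp (tendsto_atTop_add_const_right atTop δ tendsto_id)).eventually_lt_const h3
    filter_upwards [h4, eventually_gt_atTop 0] with y hy hy0
    have h5 := hup δ T hδ hT y hy0
    simp only [Function.comp, id] at hy
    by_contra hcon
    push Not at hcon
    have ha0 : 0 ≤ fa δ T := integral_nonneg fun u => fej_nonneg _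
    have h6 := mul_le_mul_of_nonneg_right hcon ha0
    have h7 := mul_lt_mul_of_pos_left hy (Real.exp_pos (2 * δ))
    rw [← mul_assoc, ← Real.exp_add, add_neg_cancel, Real.exp_zero, one_mul] at h7
    linarith

end PIT

end

section
open MeasureTheory Filter Topology Set Module

namespace PIT

section lattice
variable {E ι : Type*} [NormedAddCommGroup E] [NormedSpace ℝ E] [Finite ι] [MeasurableSpace E]
  [BorelSpace E] [FiniteDimensional ℝ E] (b : Basis ι ℝ E) (μ : Measure E) [μ.IsAddHaarMeasure]

lemma latt_sub_floor (x : E) [Fintype ι] (v : Submodule.span ℤ (Set.range b)) :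
    x - (v : E) ∈ ZSpan.fundamentalDomain b ↔ v = ZSpan.floor b x := by
  rw [← ZSpan.fract_eq_self, sub_eq_add_neg, add_comm, ZSpan.fract_zSpan_add _ _ (neg_mem v.2), ZSpan.fract_apply]
  constructor
  · intro h
    apply Subtype.ext
    have : x - (ZSpan.floor b x : E) = x - v := by rw [h]; abel
    exact (sub_right_injective this).symm
  · rintro rfl; abel

lemma latt_count_eq [Fintype ι] (B : Set E) :
    (∑' v : Submodule.span ℤ (Set.range b), B.indicator (1 : E → ENNReal) (v : E)) *
      μ (ZSpan.fundamentalDomain b) =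
    ∫⁻ x, B.indicator (1 : E → ENNReal) (ZSpan.floor b x : E) ∂μ := by
  have hc : Countable (Submodule.span ℤ (Set.range b)) := inferInstance
  have hD : MeasurableSet (ZSpan.fundamentalDomain b) := ZSpan.fundamentalDomain_measurableSet b
  rw [← ENNReal.tsum_mul_right]
  have h1 : ∀ v : Submodule.span ℤ (Set.range b),
      B.indicator (1 : E → ENNReal) (v : E) * μ (ZSpan.fundamentalDomain b) =
      ∫⁻ x, B.indicator (1 : E → ENNReal) (v : E) *
        (ZSpan.fundamentalDomain b).indicator 1 (x - v) ∂μ := by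
    intro v
    rw [lintegral_const_mul _ (by
      apply (measurable_one.indicator hD).comp (measurable_id.sub_const _)),
      lintegral_sub_right_eq_self (fun x => (ZSpan.fundamentalDomain b).indicator 1 x), lintegral_indicator_one hD]
  rw [tsum_congr h1, ← lintegral_tsum]
  · congr 1
    ext x
    rw [tsum_eq_single (ZSpan.floor b x)]
    · rw [indicator_of_mem ((latt_sub_floor b x _).mpr rfl)]; simp
    · intro v hv
      rw [indicator_of_notMem (fun h => hv ((latt_sub_floor b x _).mp h))]; simp
  · intro v
    exact ((measurable_one.indicator hD).comp (measurable_id.sub_const _)).const_mul _ |>.aemeasurable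

lemma latt_count_le [Fintype ι] {B B' : Set E} (hB' : MeasurableSet B')
    (h : ∀ x, (ZSpan.floor b x : E) ∈ B → x ∈ B') :
    (∑' v : Submodule.span ℤ (Set.range b), B.indicator (1 : E → ENNReal) (v : E)) *
      μ (ZSpan.fundamentalDomain b) ≤ μ B' := by
  rw [latt_count_eq, ← lintegral_indicator_one hB']
  refine lintegral_mono fun x => ?_
  by_cases hx : (ZSpan.floor b x : E) ∈ B
  · rw [indicator_of_mem hx, indicator_of_mem (h x hx)]; simp
  · rw [indicator_of_notMem hx]; exact zero_le

lemma latt_le_count [Fintype ι] {B B' : Set E} (hB' : MeasurableSet B')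
    (h : ∀ x, x ∈ B' → (ZSpan.floor b x : E) ∈ B) :
    μ B' ≤ (∑' v : Submodule.span ℤ (Set.range b), B.indicator (1 : E → ENNReal) (v : E)) *
      μ (ZSpan.fundamentalDomain b) := by
  rw [latt_count_eq, ← lintegral_indicator_one hB']
  refine lintegral_mono fun x => ?_
  by_cases hx : x ∈ B'
  · rw [indicator_of_mem hx, indicator_of_mem (h x hx)]; simp
  · rw [indicator_of_notMem hx]; exact zero_le

end lattice

end PIT

end

section
open MeasureTheory Filter Topology Set Module NumberField NumberField.InfinitePlace
  NumberField.mixedEmbedding NumberField.mixedEmbedding.fundamentalCone NumberField.Units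
  NumberField.Units.dirichletUnitTheorem
open scoped nonZeroDivisors NNReal

namespace PIT

variable {K : Type*} [Field K] [NumberField K]

open scoped Classical in
/-- number of nonzero elements of `J` in the box -/
noncomputable def boxCount (J : (Ideal (𝓞 K))⁰) (x : realSpace K) : ENNReal :=
  ∑' α : {α : 𝓞 K // α ∈ (J : Ideal (𝓞 K)) ∧ α ≠ 0},
    if ∀ w : InfinitePlace K, w ((α : 𝓞 K) : K) < expMapBasis x w then 1 else 0

open scoped Classical in
noncomputable def fCount (J : (Ideal (𝓞 K))⁰) (f : InfinitePlace K → ℝ≥0) : ENNReal :=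
  ∑' α : {α : 𝓞 K // α ∈ (J : Ideal (𝓞 K))},
    if ∀ w : InfinitePlace K, w ((α : 𝓞 K) : K) < f w then 1 else 0

open scoped Classical in
lemma box_perturb {f g : InfinitePlace K → ℝ≥0} {ρ : ℝ} (h : ∀ w, f w + ρ ≤ g w)
    {x y : mixedSpace K} (hxy : ‖x - y‖ ≤ ρ) (hy : y ∈ convexBodyLT K f) : x ∈ convexBodyLT K g := by
  simp only [convexBodyLT, Set.mem_prod, Set.mem_pi, Set.mem_univ, forall_true_left, mem_ball_zero_iff] at hy ⊢
  constructor
  · intro w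
    have h1 : ‖(x - y).1 w‖ ≤ ρ := ((norm_le_pi_norm _ w).trans (norm_fst_le _)).trans hxy
    have h2 : ‖x.1 w‖ ≤ ‖y.1 w‖ + ‖(x - y).1 w‖ := by
      have : x.1 w = y.1 w + (x - y).1 w := by simp
      rw [this]; exact norm_add_le _ _
    linarith [hy.1 w, h w]
  · intro w
    have h1 : ‖(x - y).2 w‖ ≤ ρ := ((norm_le_pi_norm _ w).trans (norm_snd_le _)).trans hxy
    have h2 : ‖x.2 w‖ ≤ ‖y.2 w‖ + ‖(x - y).2 w‖ := by
      have : x.2 w = y.2 w + (x - y).2 w := by simp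
      rw [this]; exact norm_add_le _ _
    linarith [hy.2 w, h w]

lemma fCount_eq (J : (Ideal (𝓞 K))⁰) (f : InfinitePlace K → ℝ≥0) :
    fCount J f = ∑' v : Submodule.span ℤ (Set.range (fractionalIdealLatticeBasis K (FractionalIdeal.mk0 K J))),
      (convexBodyLT K f).indicator (1 : mixedSpace K → ENNReal) (v : mixedSpace K) := by
  classical
  have hmem : ∀ α : {α : 𝓞 K // α ∈ (J : Ideal (𝓞 K))}, mixedEmbedding K ((α : 𝓞 K) : K) ∈
      Submodule.span ℤ (Set.range (fractionalIdealLatticeBasis K (FractionalIdeal.mk0 K J))) := by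
    intro α
    rw [mem_span_fractionalIdealLatticeBasis]
    refine ⟨_, ?_, rfl⟩
    rw [FractionalIdeal.coe_mk0]
    exact (FractionalIdeal.mem_coeIdeal _).mpr ⟨α, α.2, rfl⟩
  let e : {α : 𝓞 K // α ∈ (J : Ideal (𝓞 K))} ≃
      Submodule.span ℤ (Set.range (fractionalIdealLatticeBasis K (FractionalIdeal.mk0 K J))) :=
    Equiv.ofBijective (fun α => ⟨_, hmem α⟩) (by
      constructor
      · intro α β h
        have := congrArg Subtype.val h
        have := mixedEmbedding_injective K this
        exact Subtype.ext (RingOfIntegers.ext this)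
      · rintro ⟨v, hv⟩
        have hv' := hv
        rw [mem_span_fractionalIdealLatticeBasis] at hv'
        obtain ⟨a, ha, rfl⟩ := hv'
        rw [FractionalIdeal.coe_mk0] at ha
        obtain ⟨α, hα, rfl⟩ := (FractionalIdeal.mem_coeIdeal _).mp ha
        exact ⟨⟨α, hα⟩, rfl⟩)
  rw [← e.tsum_eq]
  unfold fCount
  refine tsum_congr fun α => ?_
  change _ = (convexBodyLT K f).indicator 1 (mixedEmbedding K ((α : 𝓞 K) : K))
  by_cases h : ∀ w : InfinitePlace K, w ((α : 𝓞 K) : K) < f w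
  · rw [if_pos h, indicator_of_mem ((convexBodyLT_mem K f).mpr h)]; rfl
  · rw [if_neg h, indicator_of_notMem (fun h' => h ((convexBodyLT_mem K f).mp h'))]

lemma fCount_bounds (J : (Ideal (𝓞 K))⁰) : ∃ ρ : ℝ, 0 < ρ ∧ ∃ v : ℝ≥0, 0 < v ∧
    (∀ f g : InfinitePlace K → ℝ≥0, (∀ w, f w + ρ ≤ g w) →
      fCount J f * v ≤ (convexBodyLTFactor K) * ∏ w, (g w) ^ (mult w)) ∧
    (∀ f g : InfinitePlace K → ℝ≥0, (∀ w, g w + ρ ≤ f w) →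
      ((convexBodyLTFactor K) * ∏ w, (g w) ^ (mult w) : ENNReal) ≤ fCount J f * v) := by
  classical
  set b := fractionalIdealLatticeBasis K (FractionalIdeal.mk0 K J) with hb
  have hbd : volume (ZSpan.fundamentalDomain b) ≠ ⊤ := (ZSpan.fundamentalDomain_isBounded b).measure_lt_top.ne
  have hb0 : volume (ZSpan.fundamentalDomain b) ≠ 0 := ZSpan.measure_fundamentalDomain_ne_zero b
  refine ⟨∑ i, ‖b i‖ + 1, by positivity, (volume (ZSpan.fundamentalDomain b)).toNNReal,
    ENNReal.toNNReal_pos hb0 hbd, ?_, ?_⟩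
  · intro f g h
    rw [ENNReal.coe_toNNReal hbd, ← convexBodyLT_volume, fCount_eq]
    refine latt_count_le b volume ?_ ?_
    · exact (MeasurableSet.univ_pi fun _ => measurableSet_ball).prod (MeasurableSet.univ_pi fun _ => measurableSet_ball)
    · intro x hx
      refine box_perturb h ?_ hx
      have := ZSpan.norm_fract_le b x
      rw [ZSpan.fract_apply] at this
      linarith
  · intro f g h
    rw [ENNReal.coe_toNNReal hbd, ← convexBodyLT_volume, fCount_eq]
    refine latt_le_count b volume ?_ ?_
    · exact (MeasurableSet.univ_pi fun _ => measurableSet_ball).prod (MeasurableSet.univ_pi fun _ => measurableSet_ball)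
    · intro x hx
      refine box_perturb h ?_ hx
      have := ZSpan.norm_fract_le b x
      rw [ZSpan.fract_apply] at this
      rw [norm_sub_rev]
      linarith

end PIT

end

section
open MeasureTheory Filter Topology Set Module NumberField NumberField.InfinitePlace
  NumberField.mixedEmbedding NumberField.mixedEmbedding.fundamentalCone NumberField.Units
  NumberField.Units.dirichletUnitTheorem
open scoped nonZeroDivisors NNReal

namespace PIT

variable {K : Type*} [Field K] [NumberField K]

/-- the box as NNReal function: `s * lambda(x)` where coordinates at `w₀` ignored -/
noncomputable def lam (x : realSpace K) : InfinitePlace K → ℝ≥0 := by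
  classical exact fun w => ⟨expMapBasis (fun i ↦ if i = w₀ then 0 else x i) w, expMapBasis_nonneg _ _⟩

lemma lam_pos (x : realSpace K) (w : InfinitePlace K) : 0 < lam x w := by
  classical
  exact_mod_cast expMapBasis_pos (fun i ↦ if i = w₀ then 0 else x i) w

lemma exp_eq_lam (x : realSpace K) (w : InfinitePlace K) :
    expMapBasis x w = Real.exp (x w₀) * lam x w := by
  classical
  rw [expMapBasis_apply'']; rfl

lemma lam_prod (x : realSpace K) : ∏ w, (lam x w) ^ (mult w) = 1 := by
  classical
  have h := prod_expMapBasis_pow (K := K) (fun i ↦ if i = w₀ then 0 else x i)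
  simp only [if_true, Real.exp_zero, one_pow] at h
  apply NNReal.coe_injective
  push_cast
  exact h

lemma box_prod (x : realSpace K) (s : ℝ≥0) :
    ∏ w, (s * lam x w) ^ (mult w) = s ^ (finrank ℚ K) := by
  simp_rw [mul_pow, Finset.prod_mul_distrib, lam_prod, mul_one, Finset.prod_pow_eq_pow_sum, sum_mult_eq]

lemma lam_lower : ∃ m : ℝ, 0 < m ∧ ∀ x : realSpace K, (∀ w, w ≠ w₀ → x w ∈ Icc (0:ℝ) 1) →
    ∀ w, m ≤ lam x w := by
  classical
  have hc : IsCompact (Set.univ.pi fun _ : InfinitePlace K => Icc (0:ℝ) 1) :=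
    isCompact_univ_pi fun _ => isCompact_Icc
  have h : ∀ w : InfinitePlace K, ∃ m : ℝ, 0 < m ∧ ∀ x ∈ (Set.univ.pi fun _ : InfinitePlace K => Icc (0:ℝ) 1),
      m ≤ expMapBasis x w := by
    intro w
    obtain ⟨x0, -, hx0⟩ := hc.exists_isMinOn ⟨fun _ => 0, by intro i _; simp⟩
      (((continuous_apply w).comp (continuous_expMapBasis K)).continuousOn)
    exact ⟨_, expMapBasis_pos x0 w, fun x hx => hx0 hx⟩
  choose m hm h using h
  refine ⟨Finset.univ.inf' Finset.univ_nonempty m, ?_, ?_⟩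
  · rw [Finset.lt_inf'_iff]; exact fun w _ => hm w
  · intro x hx w
    refine (Finset.inf'_le m (Finset.mem_univ w)).trans (h w _ ?_)
    intro i _
    by_cases hi : i = w₀
    · simp [hi]
    · simpa [hi] using hx i hi

lemma box_iff_fCount (J : (Ideal (𝓞 K))⁰) (x : realSpace K) (s : ℝ≥0) (hs : (s : ℝ) = Real.exp (x w₀)) :
    fCount J (fun w => s * lam x w) = boxCount J x + 1 := by
  classical
  have hs0 : 0 < s := by rw [← NNReal.coe_pos, hs]; exact Real.exp_pos _
  unfold fCount boxCount
  let F : 𝓞 K → ENNReal := fun α => if ∀ w : InfinitePlace K, w (α : K) < expMapBasis x w then 1 else 0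
  have e1 : ∀ α : 𝓞 K, (if ∀ w : InfinitePlace K, w (α : K) < ((s * lam x w : ℝ≥0) : ℝ) then (1:ENNReal) else 0) = F α := by
    intro α
    simp only [F, exp_eq_lam, ← hs, NNReal.coe_mul]
    congr
  simp_rw [e1]
  change ∑' α : {α : 𝓞 K | α ∈ (J : Ideal (𝓞 K))}, F α = ∑' α : {α : 𝓞 K | α ∈ (J : Ideal (𝓞 K)) ∧ α ≠ 0}, F α + 1
  have hU : {α : 𝓞 K | α ∈ (J : Ideal (𝓞 K))} = {α : 𝓞 K | α ∈ (J : Ideal (𝓞 K)) ∧ α ≠ 0} ∪ {0} := by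
    ext α
    simp only [mem_ofPred_eq, mem_union, mem_singleton_iff]
    by_cases h : α = 0
    · simp [h]
    · simp [h]
  rw [hU, ENNReal.summable.tsum_union_disjoint (f := F) _ ENNReal.summable]
  · congr 1
    rw [tsum_singleton 0 F]
    simp only [F]
    rw [if_pos]
    intro w
    simp [expMapBasis_pos]
  · simp

lemma pow_diff_le {a b : ℝ} (d : ℕ) (hb : 0 ≤ b) (h : b ≤ a) :
    a ^ d - b ^ d ≤ d * (a - b) * a ^ (d - 1) := by
  have := sub_nonneg.mpr h
  rw [← Commute.mul_geom_sum₂ (Commute.all a b)]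
  calc (a - b) * ∑ i ∈ Finset.range d, a ^ i * b ^ (d - 1 - i)
      ≤ (a - b) * ∑ i ∈ Finset.range d, a ^ (d - 1) := by
        apply mul_le_mul_of_nonneg_left _ this
        apply Finset.sum_le_sum
        intro i hi
        have hi' := Finset.mem_range.mp hi
        calc a ^ i * b ^ (d - 1 - i) ≤ a ^ i * a ^ (d - 1 - i) := by
              have := hb.trans h
              gcongr
          _ = a ^ (d - 1) := by rw [← pow_add]; congr 1; omega
    _ = _ := by simp; ring

theorem boxCount_est (J : (Ideal (𝓞 K))⁰) : ∃ V C : ℝ, 0 < V ∧ 0 < C ∧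
    ∀ x : realSpace K, (∀ w, w ≠ w₀ → x w ∈ Icc (0:ℝ) 1) → 0 ≤ x w₀ →
      boxCount J x ≠ ⊤ ∧
      |(boxCount J x).toReal - V * Real.exp (x w₀) ^ (finrank ℚ K)| ≤
        C * Real.exp (x w₀) ^ (finrank ℚ K - 1) := by
  obtain ⟨ρ, hρ, v, hv, hup, hlo⟩ := fCount_bounds J
  obtain ⟨m, hm, hlam⟩ := lam_lower (K := K)
  have hF0 : 0 < convexBodyLTFactor K := pos_iff_ne_zero.mpr (convexBodyLTFactor_ne_zero K)
  generalize convexBodyLTFactor K = F at hup hlo hF0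
  have hd0 : 0 < finrank ℚ K := finrank_pos
  have e0 := box_prod (K := K)
  generalize finrank ℚ K = d at hd0 e0 ⊢
  obtain ⟨r, hr⟩ : ∃ r : ℝ≥0, (r : ℝ) = ρ / m := ⟨⟨ρ / m, by positivity⟩, rfl⟩
  have hr0 : 0 < r := by rw [← NNReal.coe_pos, hr]; positivity
  have hrl : ∀ x : realSpace K, (∀ w, w ≠ w₀ → x w ∈ Icc (0:ℝ) 1) → ∀ w, ρ ≤ r * lam x w := by
    intro x hx w
    have := hlam x hx w
    calc ρ = r * m := by rw [hr]; field_simp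
      _ ≤ _ := by gcongr
  have hV0' : (0:ℝ) < F / v := by positivity
  obtain ⟨V, hV⟩ : ∃ V : ℝ, V = F / v := ⟨_, rfl⟩
  have hV0 : 0 < V := hV ▸ hV0'
  refine ⟨V, V * (d * r * (1 + r) ^ (d - 1)) + V * (d * r) + V * r + 1, hV0, by positivity, ?_⟩
  intro x hx hx0
  obtain ⟨s, hs⟩ : ∃ s : ℝ≥0, (s : ℝ) = Real.exp (x w₀) := ⟨⟨Real.exp (x w₀), (Real.exp_pos _).le⟩, rfl⟩
  have hs1 : (1:ℝ) ≤ s := by simpa [hs] using hx0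
  have hbox := box_iff_fCount J x s hs
  rw [← hs]
  have h1 := hup (fun w => s * lam x w) (fun w => (s + r) * lam x w) (fun w => by
    push_cast
    have := hrl x hx w
    rw [add_mul]; gcongr)
  have e1 : ∀ t : ℝ≥0, ∏ w, (t * lam x w) ^ (mult w) = t ^ d := e0 x
  rw [e1, hbox] at h1
  have hfin : boxCount J x ≠ ⊤ := by
    intro h
    rw [h, top_add, ENNReal.top_mul (by exact_mod_cast hv.ne')] at h1
    exact absurd h1 (not_le_of_gt (by rw [← ENNReal.coe_mul]; exact ENNReal.coe_lt_top))
  obtain ⟨N, hN⟩ : ∃ N : ℝ≥0, (N : ENNReal) = boxCount J x := ⟨_, ENNReal.coe_toNNReal hfin⟩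
  refine ⟨hfin, ?_⟩
  rw [← hN] at h1 ⊢
  rw [ENNReal.coe_toReal]
  have h1' : (N + 1) * v ≤ F * (s + r) ^ d := by exact_mod_cast h1
  have h1r : ((N:ℝ) + 1) * v ≤ F * (s + r) ^ d := by exact_mod_cast h1'
  have hvr : (0:ℝ) < v := by exact_mod_cast hv
  have h1V : (N:ℝ) + 1 ≤ V * (s + r) ^ d := by
    rw [hV, div_mul_eq_mul_div, le_div_iff₀ hvr]; exact h1r
  have hsd : (1:ℝ) ≤ (s:ℝ) ^ (d - 1) := one_le_pow₀ hs1
  have hr0' : (0:ℝ) < r := by exact_mod_cast hr0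
  have hup2 : ((s:ℝ) + r) ^ d - s ^ d ≤ d * r * (1 + r) ^ (d - 1) * s ^ (d - 1) := by
    have := pow_diff_le (a := (s:ℝ) + r) (b := s) d (by positivity) (by linarith)
    refine this.trans ?_
    rw [add_sub_cancel_left, mul_assoc _ _ ((s:ℝ) ^ (d-1)), ← mul_pow]
    gcongr
    nlinarith
  have hlow : V * s ^ d - (V * (d * r) + V * r) * s ^ (d - 1) ≤ N + 1 := by
    by_cases hsr : r ≤ s
    · obtain ⟨t, ht⟩ := exists_add_of_le hsr
      have h2 := hlo (fun w => s * lam x w) (fun w => t * lam x w) (fun w => by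
        have := hrl x hx w
        rw [ht]; push_cast
        rw [add_mul]; linarith)
      rw [e1, hbox, ← hN] at h2
      have h2' : F * t ^ d ≤ (N + 1) * v := by exact_mod_cast h2
      have h2r : (F:ℝ) * t ^ d ≤ ((N:ℝ) + 1) * v := by exact_mod_cast h2'
      have h2V : V * (t:ℝ) ^ d ≤ (N:ℝ) + 1 := by
        rw [hV, div_mul_eq_mul_div, div_le_iff₀ hvr]; exact h2r
      have ht' : (s:ℝ) = r + t := by exact_mod_cast ht
      have := pow_diff_le (a := (s:ℝ)) (b := t) d (by positivity) (by linarith)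
      have e : (s:ℝ) - t = r := by linarith
      rw [e] at this
      have h3 := mul_le_mul_of_nonneg_left this hV0.le
      have h4 : 0 ≤ V * r * (s:ℝ) ^ (d - 1) := by positivity
      nlinarith
    · push Not at hsr
      have hsr' : (s:ℝ) ≤ r := by exact_mod_cast hsr.le
      have : (s:ℝ) ^ d ≤ r * s ^ (d - 1) := by
        conv_lhs => rw [← Nat.sub_add_cancel hd0, pow_succ, mul_comm]
        gcongr
      have h3 := mul_le_mul_of_nonneg_left this hV0.le
      have h4 : 0 ≤ V * (d * r) * (s:ℝ) ^ (d - 1) := by positivity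
      have : (0:ℝ) ≤ N := N.2
      nlinarith
  have h5 := mul_le_mul_of_nonneg_left hup2 hV0.le
  have h6 : 0 ≤ V * (d * r * (1 + r) ^ (d - 1)) * (s:ℝ) ^ (d-1) := by positivity
  have h7 : 0 ≤ (V * (d * r) + V * r) * (s:ℝ) ^ (d-1) := by positivity
  rw [abs_le]
  constructor <;> nlinarith

/-- no points when `x w₀ ≤ 0` -/
lemma boxCount_zero (J : (Ideal (𝓞 K))⁰) (x : realSpace K) (hx : x w₀ ≤ 0) : boxCount J x = 0 := by
  classical
  unfold boxCount
  rw [ENNReal.tsum_eq_zero]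
  rintro ⟨α, hα, hα0⟩
  rw [if_neg]
  intro h
  have h1 : ∏ w : InfinitePlace K, w (α : K) ^ mult w < ∏ w, (expMapBasis x w) ^ mult w := by
    apply Finset.prod_lt_prod_of_nonempty
    · intro w _
      exact pow_pos (InfinitePlace.pos_iff.mpr (by simpa using hα0)) _
    · intro w _
      exact pow_lt_pow_left₀ (h w) (apply_nonneg _ _) mult_ne_zero
    · exact Finset.univ_nonempty
  rw [prod_expMapBasis_pow, prod_eq_abs_norm] at h1
  have h2 : Real.exp (x w₀) ^ finrank ℚ K ≤ 1 := pow_le_one₀ (Real.exp_pos _).le (by simpa using hx)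
  have h3 : (1:ℝ) ≤ ((|Algebra.norm ℚ (α : K)| : ℚ) : ℝ) := by
    have : Algebra.norm ℚ (α : K) = (Algebra.norm ℤ α : ℤ) := (Algebra.coe_norm_int α).symm
    rw [this]
    have h0 : Algebra.norm ℤ α ≠ 0 := Algebra.norm_ne_zero_iff.mpr hα0
    have := Int.one_le_abs h0
    exact_mod_cast this
  linarith

end PIT

end

section
open MeasureTheory Filter Topology Set Module NumberField NumberField.InfinitePlace
  NumberField.mixedEmbedding NumberField.mixedEmbedding.fundamentalCone NumberField.Units
  NumberField.Units.dirichletUnitTheorem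
open scoped nonZeroDivisors NNReal

namespace PIT

variable {K : Type*} [Field K] [NumberField K]

open scoped Classical in
noncomputable def hatZ (n : {w : InfinitePlace K // w ≠ w₀} → ℤ) : realSpace K :=
  fun w => if h : w = w₀ then 0 else n ⟨w, h⟩

variable (K) in
def FD : Set (realSpace K) := {x | ∀ w, w ≠ w₀ → x w ∈ Ico (0:ℝ) 1}

lemma FD_meas : MeasurableSet (FD K) := by
  have : FD K = ⋂ w, ⋂ (_ : w ≠ w₀), {x | x w ∈ Ico (0:ℝ) 1} := by ext; simp [FD]
  rw [this]
  refine MeasurableSet.iInter fun w => MeasurableSet.iInter fun _ => ?_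
  exact (measurable_pi_apply w) measurableSet_Ico

lemma hatZ_w0 (n : {w : InfinitePlace K // w ≠ w₀} → ℤ) : hatZ n w₀ = 0 := by simp [hatZ]

lemma FD_iff (x : realSpace K) (n : {w : InfinitePlace K // w ≠ w₀} → ℤ) :
    x + hatZ n ∈ FD K ↔ n = fun w => -⌊x w.1⌋ := by
  constructor
  · intro h
    ext w
    have := h w.1 w.2
    simp only [Pi.add_apply, hatZ, w.2, dite_false, mem_Ico] at this
    have : ⌊x w.1⌋ = -n w := by
      rw [Int.floor_eq_iff]; push_cast; constructor <;> linarith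
    omega
  · rintro rfl w hw
    simp only [Pi.add_apply, hatZ, hw, dite_false, mem_Ico]
    push_cast
    constructor
    · linarith [Int.floor_le (x w)]
    · linarith [Int.lt_floor_add_one (x w)]

lemma unfold_int (g : realSpace K → ENNReal) (hg : Measurable g) :
    ∑' n : {w : InfinitePlace K // w ≠ w₀} → ℤ, ∫⁻ x in FD K, g (x - hatZ n) = ∫⁻ x, g x := by
  have h1 : ∀ n : {w : InfinitePlace K // w ≠ w₀} → ℤ, ∫⁻ x in FD K, g (x - hatZ n) =
      ∫⁻ x, (FD K).indicator 1 (x + hatZ n) * g x := by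
    intro n
    rw [← lintegral_indicator FD_meas, ← lintegral_add_right_eq_self _ (hatZ n)]
    congr 1
    ext x
    by_cases h : x + hatZ n ∈ FD K <;> simp [h]
  simp_rw [h1]
  rw [← lintegral_tsum]
  · congr 1
    ext x
    rw [tsum_eq_single (fun w => -⌊x w.1⌋)]
    · rw [indicator_of_mem ((FD_iff x _).mpr rfl)]; simp
    · intro n hn
      rw [indicator_of_notMem (fun h => hn ((FD_iff x _).mp h))]; simp
  · intro n
    exact (((measurable_one.indicator FD_meas).comp (measurable_id.add_const _)).mul hg).aemeasurable

/-- the unit with given exponents -/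
noncomputable def eta (n : {w : InfinitePlace K // w ≠ w₀} → ℤ) : (𝓞 K)ˣ := by
  classical exact ∏ i : {w : InfinitePlace K // w ≠ w₀}, fundSystem K (equivFinRank.symm i) ^ n i

open scoped Classical in
noncomputable def ind (α : 𝓞 K) (x : realSpace K) : ENNReal :=
  if ∀ w : InfinitePlace K, w (α : K) < expMapBasis x w then 1 else 0

lemma exp_sub_hat (n : {w : InfinitePlace K // w ≠ w₀} → ℤ) (x : realSpace K) (w : InfinitePlace K) :
    expMapBasis x w = w ((eta n : 𝓞 K) : K) * expMapBasis (x - hatZ n) w := by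
  classical
  rw [expMapBasis_apply', expMapBasis_apply']
  simp only [Pi.smul_apply, smul_eq_mul, Pi.sub_apply, hatZ_w0, sub_zero]
  rw [mul_left_comm]
  congr 1
  have e1 : w ((eta n : 𝓞 K) : K) = ∏ i : {w : InfinitePlace K // w ≠ w₀},
      w (fundSystem K (equivFinRank.symm i)) ^ n i := by
    unfold eta
    rw [show (((∏ i : {w : InfinitePlace K // w ≠ w₀}, fundSystem K (equivFinRank.symm i) ^ n i : (𝓞 K)ˣ) : 𝓞 K) : K)
      = ∏ i : {w : InfinitePlace K // w ≠ w₀}, (((fundSystem K (equivFinRank.symm i) ^ n i : (𝓞 K)ˣ) : 𝓞 K) : K) by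
        rw [Units.coe_prod]; exact map_prod (algebraMap (𝓞 K) K) _ _, map_prod]
    refine Finset.prod_congr rfl fun i _ => ?_
    have := congrArg w (NumberField.Units.coe_zpow (K := K) (fundSystem K (equivFinRank.symm i)) (n i))
    rw [map_zpow₀] at this
    exact this
  rw [e1, ← Finset.prod_mul_distrib]
  refine Finset.prod_congr rfl fun i _ => ?_
  have hp : 0 < w (fundSystem K (equivFinRank.symm i) : K) := pos_at_place _ _
  have : hatZ n i.1 = n i := by simp [hatZ, i.2]
  rw [this, ← Real.rpow_intCast, ← Real.rpow_add hp]
  congr 1; ring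

lemma ind_eta (n : {w : InfinitePlace K // w ≠ w₀} → ℤ) (α : 𝓞 K) (x : realSpace K) :
    ind ((eta n : 𝓞 K) * α) x = ind α (x - hatZ n) := by
  classical
  unfold ind
  congr 1
  refine propext (forall_congr' fun w => ?_)
  rw [exp_sub_hat n x w, show (((eta n : 𝓞 K) * α : 𝓞 K) : K) = ((eta n : 𝓞 K) : K) * (α : K) from
    map_mul (algebraMap (𝓞 K) K) _ _, map_mul]
  exact mul_lt_mul_iff_right₀ (pos_at_place _ _)

lemma ind_torsion (ζ : torsion K) (α : 𝓞 K) (x : realSpace K) :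
    ind (((ζ : (𝓞 K)ˣ) : 𝓞 K) * α) x = ind α x := by
  classical
  unfold ind
  congr 1
  refine propext (forall_congr' fun w => ?_)
  have : w (((ζ : (𝓞 K)ˣ) : 𝓞 K) : K) = 1 := (mem_torsion K).mp ζ.2 w
  rw [show ((((ζ : (𝓞 K)ˣ) : 𝓞 K) * α : 𝓞 K) : K) = (((ζ : (𝓞 K)ˣ) : 𝓞 K) : K) * (α : K) from
    map_mul (algebraMap (𝓞 K) K) _ _, map_mul, this, one_mul]

lemma ind_meas (α : 𝓞 K) : Measurable (ind α : realSpace K → ENNReal) := by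
  classical
  unfold ind
  refine Measurable.ite ?_ measurable_const measurable_const
  have : {x : realSpace K | ∀ w : InfinitePlace K, w (α : K) < expMapBasis x w} =
      ⋂ w, {x | w (α : K) < expMapBasis x w} := by ext; simp
  rw [this]
  refine MeasurableSet.iInter fun w => ?_
  exact (isOpen_lt continuous_const ((continuous_apply w).comp (continuous_expMapBasis K))).measurableSet

lemma sum_equivFun_symm (x : realSpace K) :
    ∑ w, (completeBasis K).equivFun.symm x w = finrank ℚ K * x w₀ := by
  have h := prod_expMapBasis_pow x
  rw [expMapBasis_apply] at h
  simp only [expMap_apply, ← Real.exp_nat_mul] at h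
  rw [← Real.exp_sum] at h
  have := Real.exp_injective h
  rw [← this]
  refine Finset.sum_congr rfl fun w _ => ?_
  rw [mul_inv_cancel_left₀ mult_coe_ne_zero]

variable (K) in
lemma haar_scale : ∃ c : ℝ≥0, 0 < c ∧ Measure.map ((completeBasis K).equivFun.symm) volume =
    c • (volume : Measure (realSpace K)) := by
  let L := (completeBasis K).equivFunL.symm
  have : (Measure.map L (volume : Measure (realSpace K))).IsAddHaarMeasure := L.isAddHaarMeasure_map _
  refine ⟨Measure.addHaarScalarFactor (Measure.map L (volume : Measure (realSpace K))) volume,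
    Measure.addHaarScalarFactor_pos_of_isAddHaarMeasure _ _, ?_⟩
  exact Measure.isAddLeftInvariant_eq_smul (Measure.map L volume) volume

variable (K) in
lemma ind_integral : ∃ c : ℝ≥0, 0 < c ∧ ∀ α : 𝓞 K, α ≠ 0 → ∀ s : ℝ, 0 < s →
    ∫⁻ x : realSpace K, ind α x * ENNReal.ofReal (Real.exp (-(s * (finrank ℚ K * x w₀)))) =
      c * ENNReal.ofReal (((|Algebra.norm ℤ α| : ℤ) : ℝ) ^ (-s) / s ^ (Fintype.card (InfinitePlace K))) := by
  classical
  obtain ⟨c, hc, hmap⟩ := haar_scale K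
  refine ⟨c, hc, fun α hα s hs => ?_⟩
  let a : InfinitePlace K → ℝ := fun w => mult w * Real.log (w (α : K))
  let h : InfinitePlace K → ℝ → ℝ := fun w => (Ioi (a w)).indicator fun t => Real.exp (-(s * t))
  have hIntegr : ∀ w, Integrable (h w) := by
    intro w
    refine (integrable_indicator_iff measurableSet_Ioi).mpr ?_
    simpa using exp_neg_integrableOn_Ioi (a w) hs
  have hval : ∀ w, ∫ t, h w t = Real.exp (-(s * a w)) / s := by
    intro w
    rw [integral_indicator measurableSet_Ioi]
    have := integral_exp_mul_Ioi (a := -s) (by linarith) (a w)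
    simp only [neg_mul] at this
    rw [this]; ring
  have hh0 : ∀ w t, 0 ≤ h w t := fun w t => indicator_nonneg (fun _ _ => (Real.exp_pos _).le) _
  have hpt : ∀ x : realSpace K, ind α x * ENNReal.ofReal (Real.exp (-(s * (finrank ℚ K * x w₀)))) =
      ENNReal.ofReal (∏ w, h w ((completeBasis K).equivFun.symm x w)) := by
    intro x
    have key : ∀ w : InfinitePlace K, w (α : K) < expMapBasis x w ↔ (completeBasis K).equivFun.symm x w ∈ Ioi (a w) := by
      intro w
      have hp : 0 < w (α : K) := InfinitePlace.pos_iff.mpr (by simpa using hα)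
      have hm : (0:ℝ) < mult w := by exact_mod_cast mult_pos
      rw [expMapBasis_apply, expMap_apply, mem_Ioi, ← Real.log_lt_iff_lt_exp hp]
      simp only [a]
      rw [inv_mul_eq_div, lt_div_iff₀ hm, mul_comm]
    unfold ind
    by_cases hx : ∀ w : InfinitePlace K, w (α : K) < expMapBasis x w
    · rw [if_pos hx, one_mul]
      congr 1
      rw [← sum_equivFun_symm, Finset.mul_sum, ← Finset.sum_neg_distrib, Real.exp_sum]
      refine Finset.prod_congr rfl fun w _ => ?_
      simp only [h]
      rw [indicator_of_mem ((key w).mp (hx w))]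
    · rw [if_neg hx, zero_mul]
      push Not at hx
      obtain ⟨w, hw⟩ := hx
      rw [Finset.prod_eq_zero (Finset.mem_univ w), ENNReal.ofReal_zero]
      simp only [h]
      exact indicator_of_notMem (fun h' => absurd ((key w).mpr h') (not_lt.mpr hw)) _
  simp_rw [hpt]
  have hmeas : Measurable fun y : realSpace K => ENNReal.ofReal (∏ w, h w (y w)) := by
    refine ENNReal.measurable_ofReal.comp (Finset.measurable_prod _ fun w _ => ?_)
    have hm : Measurable (h w) :=
      (by fun_prop : Measurable fun t : ℝ => Real.exp (-(s * t))).indicator measurableSet_Ioi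
    exact hm.comp (measurable_pi_apply w)
  have hL : Measurable ((completeBasis K).equivFun.symm : realSpace K → realSpace K) :=
    ((completeBasis K).equivFunL.symm.continuous).measurable
  have e := lintegral_map (μ := (volume : Measure (realSpace K))) hmeas hL
  rw [← e, hmap, lintegral_smul_measure]
  have e2 := ofReal_integral_eq_lintegral_ofReal (f := fun y : realSpace K => ∏ w, h w (y w))
    (μ := volume) (Integrable.fintype_prod hIntegr)
    (ae_of_all _ fun y => Finset.prod_nonneg fun w _ => hh0 _ _)
  rw [← e2, integral_fintype_prod_volume_eq_prod (fun w => h w)]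
  simp_rw [hval]
  rw [Finset.prod_div_distrib, Finset.prod_const, ← Real.exp_sum]
  have hn : Real.exp (∑ w, -(s * a w)) = ((|Algebra.norm ℤ α| : ℤ) : ℝ) ^ (-s) := by
    have h1 : (((|Algebra.norm ℚ (α : K)| : ℚ)) : ℝ) = ∏ w : InfinitePlace K, w (α : K) ^ mult w := (prod_eq_abs_norm _).symm
    have h2 : ((|Algebra.norm ℤ α| : ℤ) : ℝ) = (((|Algebra.norm ℚ (α : K)| : ℚ)) : ℝ) := by
      have : Algebra.norm ℚ (α : K) = (Algebra.norm ℤ α : ℤ) := (Algebra.coe_norm_int α).symm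
      rw [this]; push_cast; rfl
    have hp : ∀ w : InfinitePlace K, 0 < w (α : K) := fun w => InfinitePlace.pos_iff.mpr (by simpa using hα)
    have hP : 0 < ∏ w : InfinitePlace K, w (α : K) ^ mult w := Finset.prod_pos fun w _ => pow_pos (hp w) _
    rw [h2, h1, Real.rpow_def_of_pos hP, Real.log_prod (fun w _ => (pow_pos (hp w) _).ne')]
    congr 1
    rw [Finset.sum_mul]
    refine Finset.sum_congr rfl fun w _ => ?_
    rw [Real.log_pow]; simp only [a]; ring
  rw [hn]
  rfl

end PIT

end

section
open MeasureTheory Filter Topology Set Module NumberField NumberField.InfinitePlace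
  NumberField.mixedEmbedding NumberField.mixedEmbedding.fundamentalCone NumberField.Units
  NumberField.Units.dirichletUnitTheorem
open scoped nonZeroDivisors NNReal

namespace PIT

variable {K : Type*} [Field K] [NumberField K]

lemma unit_exists (u : (𝓞 K)ˣ) : ∃ (ζ : torsion K) (n : {w : InfinitePlace K // w ≠ w₀} → ℤ),
    u = ζ * eta n := by
  classical
  obtain ⟨⟨ζ, e⟩, he, -⟩ := exist_unique_eq_mul_prod K u
  refine ⟨ζ, fun i => e (equivFinRank.symm i), ?_⟩
  rw [he]
  unfold eta
  congr 1
  exact (Fintype.prod_equiv equivFinRank.symm _ _ fun i => rfl).symm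

lemma unit_unique {ζ ζ' : torsion K} {n n' : {w : InfinitePlace K // w ≠ w₀} → ℤ}
    (h : (ζ : (𝓞 K)ˣ) * eta n = ζ' * eta n') : ζ = ζ' ∧ n = n' := by
  classical
  have key : ∀ n : {w : InfinitePlace K // w ≠ w₀} → ℤ,
      eta n = ∏ i, (fundSystem K i) ^ (n (equivFinRank i)) := by
    intro n
    unfold eta
    exact Fintype.prod_equiv equivFinRank.symm _ _ fun i => by simp
  have := (exist_unique_eq_mul_prod K ((ζ : (𝓞 K)ˣ) * eta n)).unique
    (y₁ := (ζ, fun i => n (equivFinRank i))) (y₂ := (ζ', fun i => n' (equivFinRank i)))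
    (by simp [key]) (by rw [h]; simp [key])
  rw [Prod.mk.injEq] at this
  refine ⟨this.1, ?_⟩
  ext i
  have := congrFun this.2 (equivFinRank.symm i)
  simpa using this

/-- weight -/
noncomputable def wt (s : ℝ) (x : realSpace K) : ENNReal :=
  ENNReal.ofReal (Real.exp (-(s * (finrank ℚ K * x w₀))))

lemma wt_meas (s : ℝ) : Measurable (wt s : realSpace K → ENNReal) := by
  unfold wt
  fun_prop

lemma wt_sub (s : ℝ) (x : realSpace K) (n) : wt s (x - hatZ n) = wt s x := by
  simp [wt, hatZ_w0]

lemma orbit_sum (β : 𝓞 K) (s : ℝ) :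
    ∑' (p : torsion K × ({w : InfinitePlace K // w ≠ w₀} → ℤ)),
      ∫⁻ x in FD K, ind (((p.1 : (𝓞 K)ˣ) : 𝓞 K) * ((eta p.2 : 𝓞 K) * β)) x * wt s x =
    torsionOrder K * ∫⁻ x, ind β x * wt s x := by
  have hfin : Finite (torsion K) := inferInstance
  have : Fintype (torsion K) := Fintype.ofFinite _
  rw [ENNReal.tsum_prod', tsum_fintype]
  have : ∀ ζ : torsion K, ∑' n : {w : InfinitePlace K // w ≠ w₀} → ℤ,
      ∫⁻ x in FD K, ind (((ζ : (𝓞 K)ˣ) : 𝓞 K) * ((eta n : 𝓞 K) * β)) x * wt s x =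
      ∫⁻ x, ind β x * wt s x := by
    intro ζ
    rw [← unfold_int (fun x => ind β x * wt s x) ((ind_meas β).mul (wt_meas s))]
    refine tsum_congr fun n => ?_
    refine lintegral_congr fun x => ?_
    rw [ind_torsion, ind_eta]
    simp [wt_sub]
  simp_rw [this]
  rw [Finset.sum_const, Finset.card_univ, nsmul_eq_mul, torsionOrder, ← Nat.card_eq_fintype_card]

lemma gen_mem {R : Type*} [CommRing R] [IsDomain R] {I J : Ideal R} {β : R} (hβ0 : β ≠ 0)
    (hβ : I * J = Ideal.span {β}) (u v : Rˣ) : (u : R) * (v * β) ∈ J ∧ (u : R) * (v * β) ≠ 0 := by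
  constructor
  · refine Ideal.mul_mem_left _ _ (Ideal.mul_mem_left _ _ ?_)
    have : β ∈ I * J := by
      rw [hβ]; exact Ideal.mem_span_singleton_self _
    have h2 : I * J ≤ J := Ideal.mul_le_right
    exact h2 this
  · exact mul_ne_zero u.ne_zero (mul_ne_zero v.ne_zero hβ0)

lemma gen_cancel {R : Type*} [CommRing R] [IsDomain R] {β : R} (hβ0 : β ≠ 0)
    {u v u' v' : Rˣ} (h : (u : R) * (v * β) = u' * (v' * β)) : u * v = u' * v' := by
  rw [← mul_assoc, ← mul_assoc] at h
  have h4 := mul_right_cancel₀ hβ0 h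
  exact Units.ext (by simpa using h4)

lemma gen_span {R : Type*} [CommRing R] [IsDomain R] (β : R) (u v : Rˣ) :
    Ideal.span {(u : R) * (v * β)} = Ideal.span {β} := by
  rw [Ideal.span_singleton_eq_span_singleton]
  refine Associated.symm ⟨u * v, ?_⟩
  rw [Units.val_mul]; ring

lemma gen_surj {R : Type*} [CommRing R] [IsDomain R] {α β : R} (h : Ideal.span {β} = Ideal.span {α}) :
    ∃ u : Rˣ, α = u * β := by
  obtain ⟨u, hu⟩ := Ideal.span_singleton_eq_span_singleton.mp h
  exact ⟨u, by rw [← hu, mul_comm]⟩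

lemma gen_ne {R : Type*} [CommRing R] [IsDomain R] {α : R} (hα : α ≠ 0) {I J : Ideal R}
    (h : Ideal.span {α} = J * I) : I ≠ 0 := by
  rintro rfl
  rw [mul_zero] at h
  exact hα (by simpa using h)

lemma class_equiv (J : (Ideal (𝓞 K))⁰) (C : ClassGroup (𝓞 K)) (hJ : ClassGroup.mk0 J = C⁻¹) :
    ∃ (β : {I : (Ideal (𝓞 K))⁰ // ClassGroup.mk0 I = C} → 𝓞 K)
      (e : {I : (Ideal (𝓞 K))⁰ // ClassGroup.mk0 I = C} × (torsion K × ({w : InfinitePlace K // w ≠ w₀} → ℤ)) ≃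
        {α : 𝓞 K // α ∈ (J : Ideal (𝓞 K)) ∧ α ≠ 0}), (∀ I, β I ≠ 0) ∧
      (∀ I, (I.1 : Ideal (𝓞 K)) * J = Ideal.span {β I}) ∧
      ∀ p, (e p : 𝓞 K) = ((p.2.1 : (𝓞 K)ˣ) : 𝓞 K) * ((eta p.2.2 : 𝓞 K) * β p.1) := by
  classical
  have hgen : ∀ I : {I : (Ideal (𝓞 K))⁰ // ClassGroup.mk0 I = C}, ∃ x : 𝓞 K, x ≠ 0 ∧
      (I.1 : Ideal (𝓞 K)) * J = Ideal.span {x} := by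
    intro I
    have : ClassGroup.mk0 I.1 = (ClassGroup.mk0 J)⁻¹ := by rw [I.2, hJ, inv_inv]
    obtain ⟨x, hx, h⟩ := ClassGroup.mk0_eq_mk0_inv_iff.mp this
    exact ⟨x, hx, h⟩
  choose β hβ0 hβ using hgen
  have hmem : ∀ (I : {I : (Ideal (𝓞 K))⁰ // ClassGroup.mk0 I = C}) (u v : (𝓞 K)ˣ),
      ((u : 𝓞 K) * ((v : 𝓞 K) * β I)) ∈ (J : Ideal (𝓞 K)) ∧ ((u : 𝓞 K) * ((v : 𝓞 K) * β I)) ≠ 0 := by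
    intro I u v
    exact gen_mem (hβ0 I) (hβ I) u v
  obtain ⟨φ, hv⟩ : ∃ φ : {I : (Ideal (𝓞 K))⁰ // ClassGroup.mk0 I = C} × (torsion K × ({w : InfinitePlace K // w ≠ w₀} → ℤ)) →
      {α : 𝓞 K // α ∈ (J : Ideal (𝓞 K)) ∧ α ≠ 0}, ∀ p, (φ p : 𝓞 K) = ((p.2.1 : (𝓞 K)ˣ) : 𝓞 K) * ((eta p.2.2 : 𝓞 K) * β p.1) :=
    ⟨fun p => ⟨_, hmem p.1 p.2.1 (eta p.2.2)⟩, fun p => rfl⟩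
  have hφspan : ∀ p, Ideal.span {((φ p : 𝓞 K))} = (p.1.1 : Ideal (𝓞 K)) * J := by
    intro p
    rw [hβ, hv]
    exact gen_span _ _ _
  have hφ : Function.Bijective φ := by
    constructor
    · rintro ⟨I, ζ, n⟩ ⟨I', ζ', n'⟩ h
      have h1 := hφspan (I, ζ, n)
      rw [h, hφspan] at h1
      have hJ0 : (J : Ideal (𝓞 K)) ≠ 0 := nonZeroDivisors.coe_ne_zero J
      have h2 : I = I' := Subtype.ext (Subtype.ext (mul_right_cancel₀ hJ0 h1).symm)
      subst h2
      have h3 := congrArg Subtype.val h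
      rw [hv, hv] at h3
      have h5 := gen_cancel (hβ0 I) h3
      obtain ⟨rfl, rfl⟩ := unit_unique h5
      rfl
    · rintro ⟨α, hα, hα0⟩
      have hd : (J : Ideal (𝓞 K)) ∣ Ideal.span {α} := by
        rw [Ideal.dvd_span_singleton]; exact hα
      obtain ⟨I, hI⟩ := hd
      have hI0 : I ∈ (Ideal (𝓞 K))⁰ := by
        exact mem_nonZeroDivisors_of_ne_zero (gen_ne hα0 hI)
      have hcl : ClassGroup.mk0 (⟨I, hI0⟩ : (Ideal (𝓞 K))⁰) = C := by
        have : ClassGroup.mk0 (⟨I, hI0⟩ : (Ideal (𝓞 K))⁰) = (ClassGroup.mk0 J)⁻¹ :=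
          ClassGroup.mk0_eq_mk0_inv_iff.mpr ⟨α, hα0, by rw [hI, mul_comm]⟩
        rw [this, hJ, inv_inv]
      have h1 : Ideal.span {β ⟨⟨I, hI0⟩, hcl⟩} = Ideal.span {α} := by
        rw [← hβ, hI, mul_comm]
      obtain ⟨u, hu⟩ := gen_surj h1
      obtain ⟨ζ, n, rfl⟩ := unit_exists u
      refine ⟨(⟨⟨I, hI0⟩, hcl⟩, ζ, n), Subtype.ext ?_⟩
      rw [hv]
      refine Eq.trans ?_ hu.symm
      rw [Units.val_mul, mul_assoc]
  exact ⟨β, Equiv.ofBijective φ hφ, hβ0, hβ, hv⟩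

set_option maxHeartbeats 1000000 in
lemma class_int (J : (Ideal (𝓞 K))⁰) (C : ClassGroup (𝓞 K)) (hJ : ClassGroup.mk0 J = C⁻¹) (s : ℝ) (hs : 0 < s)
    (c : ℝ≥0) (hc : ∀ α : 𝓞 K, α ≠ 0 → ∀ s : ℝ, 0 < s →
      ∫⁻ x : realSpace K, ind α x * ENNReal.ofReal (Real.exp (-(s * (finrank ℚ K * x w₀)))) =
      c * ENNReal.ofReal (((|Algebra.norm ℤ α| : ℤ) : ℝ) ^ (-s) / s ^ (Fintype.card (InfinitePlace K)))) :
    ∫⁻ x in FD K, boxCount J x * wt s x =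
      ∑' I : {I : (Ideal (𝓞 K))⁰ // ClassGroup.mk0 I = C}, torsionOrder K * (c *
        ENNReal.ofReal (((Ideal.absNorm (I.1 : Ideal (𝓞 K)) * Ideal.absNorm (J : Ideal (𝓞 K)) : ℕ) : ℝ) ^ (-s)
          / s ^ (Fintype.card (InfinitePlace K)))) := by
  classical
  have e1 : ∀ x, boxCount J x * wt s x =
      ∑' α : {α : 𝓞 K // α ∈ (J : Ideal (𝓞 K)) ∧ α ≠ 0}, ind (α : 𝓞 K) x * wt s x := by
    intro x
    rw [ENNReal.tsum_mul_right]
    rfl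
  simp_rw [e1]
  have : Countable (𝓞 K) := (RingOfIntegers.basis K).equivFun.injective.countable
  rw [lintegral_tsum (fun (α : {α : 𝓞 K // α ∈ (J : Ideal (𝓞 K)) ∧ α ≠ 0}) =>
    (show Measurable fun x : realSpace K => ind (α : 𝓞 K) x * wt s x from (ind_meas _).mul (wt_meas s)).aemeasurable)]
  obtain ⟨β, e, hβ0, hβ, he⟩ := class_equiv J C hJ
  rw [← e.tsum_eq, ENNReal.tsum_prod']
  refine tsum_congr fun I => ?_
  simp_rw [he]
  rw [orbit_sum (β I) s]
  congr 1
  have h1 := hc (β I) (hβ0 I) s hs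
  simp only [wt]
  rw [h1]
  congr 3
  have h2 : ((Ideal.absNorm (I.1 : Ideal (𝓞 K)) * Ideal.absNorm (J : Ideal (𝓞 K)) : ℕ) : ℤ) = |Algebra.norm ℤ (β I)| := by
    rw [← map_mul, hβ, Ideal.absNorm_span_singleton, Int.abs_eq_natAbs]
  rw [← h2]; simp

variable (K) in
theorem zeta_int : ∃ (c : ℝ) (J : ClassGroup (𝓞 K) → (Ideal (𝓞 K))⁰), 0 < c ∧ ∀ s : ℝ, 0 < s →
    ∑' I : (Ideal (𝓞 K))⁰, ENNReal.ofReal ((Ideal.absNorm (I : Ideal (𝓞 K)) : ℝ) ^ (-s)) =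
    ∑ C : ClassGroup (𝓞 K), ENNReal.ofReal (c * s ^ (Fintype.card (InfinitePlace K)) *
      (Ideal.absNorm (J C : Ideal (𝓞 K)) : ℝ) ^ s) * ∫⁻ x in FD K, boxCount (J C) x * wt s x := by
  classical
  obtain ⟨c, hc0, hc⟩ := ind_integral K
  choose J hJ using fun C : ClassGroup (𝓞 K) => ClassGroup.mk0_surjective C⁻¹
  have ht : (0:ℝ) < torsionOrder K := by exact_mod_cast torsionOrder_pos K
  have hc0' : (0:ℝ) < c := hc0
  refine ⟨(c * torsionOrder K)⁻¹, J, by positivity, fun s hs => ?_⟩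
  rw [← (Equiv.sigmaFiberEquiv (ClassGroup.mk0 : (Ideal (𝓞 K))⁰ → ClassGroup (𝓞 K))).tsum_eq,
    ENNReal.tsum_sigma', tsum_fintype]
  refine Finset.sum_congr rfl fun C _ => ?_
  rw [class_int (J C) C (hJ C) s hs c hc, ← ENNReal.tsum_mul_left]
  refine tsum_congr fun I => ?_
  have hN : (0:ℝ) < Ideal.absNorm (J C : Ideal (𝓞 K)) := by
    exact_mod_cast Ideal.absNorm_pos_of_nonZeroDivisors _
  rw [show ((torsionOrder K : ℕ) : ENNReal) = ENNReal.ofReal (torsionOrder K) by simp,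
    show (c : ENNReal) = ENNReal.ofReal c by simp, ← ENNReal.ofReal_mul (by positivity),
    ← ENNReal.ofReal_mul (by positivity), ← ENNReal.ofReal_mul (by positivity)]
  congr 1
  simp only [Equiv.sigmaFiberEquiv_apply]
  push_cast
  rw [Real.mul_rpow (by positivity) (by positivity), Real.rpow_neg hN.le]
  field_simp

end PIT

end

section
open MeasureTheory Filter Topology Set Module NumberField NumberField.InfinitePlace
  NumberField.mixedEmbedding NumberField.mixedEmbedding.fundamentalCone NumberField.Units
  NumberField.Units.dirichletUnitTheorem
open scoped nonZeroDivisors NNReal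

namespace PIT

lemma norm_cexp_neg (s : ℂ) (t : ℝ) : ‖Complex.exp (-s * t)‖ = Real.exp (-(s.re * t)) := by
  rw [Complex.norm_exp]; simp

lemma laplace_int {X : Type*} [MeasurableSpace X] (μ : Measure X) (t : X → ℝ) (ht : Measurable t)
    (hIntegr : ∀ a : ℝ, 0 < a → Integrable (fun x => Real.exp (-(a * t x))) μ)
    (E : X → ℝ) (hE : Measurable E) (C b : ℝ) (hb : ∀ᵐ x ∂μ, |E x| ≤ C * Real.exp (b * t x))
    (s : ℂ) (hs : b < s.re) : Integrable (fun x => (E x : ℂ) * Complex.exp (-s * t x)) μ := by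
  refine ((hIntegr (s.re - b) (by linarith)).const_mul C).mono' (by fun_prop) ?_
  filter_upwards [hb] with x hx
  rw [norm_mul, norm_cexp_neg, Complex.norm_real, Real.norm_eq_abs]
  calc _ ≤ C * Real.exp (b * t x) * Real.exp (-(s.re * t x)) := by gcongr
    _ = _ := by rw [mul_assoc, ← Real.exp_add]; congr 2; ring

lemma laplace_diff {X : Type*} [MeasurableSpace X] (μ : Measure X) (t : X → ℝ) (ht : Measurable t)
    (ht0 : ∀ᵐ x ∂μ, 0 ≤ t x)
    (hIntegr : ∀ a : ℝ, 0 < a → Integrable (fun x => Real.exp (-(a * t x))) μ)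
    (E : X → ℝ) (hE : Measurable E) (C b : ℝ) (hC : 0 ≤ C) (hb : ∀ᵐ x ∂μ, |E x| ≤ C * Real.exp (b * t x)) :
    DifferentiableOn ℂ (fun s => ∫ x, (E x : ℂ) * Complex.exp (-s * t x) ∂μ) {s | b < s.re} := by
  intro s hs
  have hs : b < s.re := hs
  set ε : ℝ := (s.re - b) / 3 with hε
  have hε0 : 0 < ε := by rw [hε]; linarith
  have key := hasDerivAt_integral_of_dominated_loc_of_deriv_le (μ := μ) (𝕜 := ℂ)
    (F := fun s x => (E x : ℂ) * Complex.exp (-s * t x))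
    (F' := fun s x => (E x : ℂ) * (Complex.exp (-s * t x) * (-t x)))
    (x₀ := s) (s := Metric.ball s ε) (bound := fun x => C * ε⁻¹ * Real.exp (-(ε * t x)))
    (Metric.ball_mem_nhds _ hε0) (Eventually.of_forall fun s => by fun_prop)
    (laplace_int μ t ht hIntegr E hE C b hb s hs) (by fun_prop) ?_
    ((hIntegr ε hε0).const_mul _) ?_
  · exact key.2.differentiableAt.differentiableWithinAt
  · filter_upwards [hb, ht0] with x hx hx0 z hz
    have hz' : b + 2 * ε ≤ z.re := by
      have h1 : |(z - s).re| ≤ ‖z - s‖ := Complex.abs_re_le_norm _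
      have h2 : ‖z - s‖ < ε := by simpa [dist_eq_norm] using hz
      have := (abs_le.mp (h1.trans h2.le)).1
      simp only [Complex.sub_re] at this
      have : 3 * ε = s.re - b := by rw [hε]; ring
      linarith
    rw [norm_mul, norm_mul, norm_cexp_neg, Complex.norm_real, Real.norm_eq_abs, norm_neg,
      Complex.norm_real, Real.norm_eq_abs, abs_of_nonneg hx0]
    have ht1 : t x ≤ ε⁻¹ * Real.exp (ε * t x) := by
      rw [inv_mul_eq_div, le_div_iff₀ hε0]
      nlinarith [Real.add_one_le_exp (ε * t x)]
    calc _ ≤ (C * Real.exp (b * t x)) * (Real.exp (-((b + 2 * ε) * t x)) * (ε⁻¹ * Real.exp (ε * t x))) := by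
          gcongr
      _ = C * ε⁻¹ * (Real.exp (b * t x) * Real.exp (-((b + 2 * ε) * t x)) * Real.exp (ε * t x)) := by ring
      _ = _ := by rw [← Real.exp_add, ← Real.exp_add]; congr 2; ring
  · refine Eventually.of_forall fun x z _ => ?_
    have h1 : HasDerivAt (fun z : ℂ => -z * (t x : ℂ)) (-(t x : ℂ)) z := by
      simpa using ((hasDerivAt_id z).neg.mul_const (t x : ℂ))
    exact (h1.cexp).const_mul _

variable {K : Type*} [Field K] [NumberField K]

variable (K) in
def FDp : Set (realSpace K) := {x | x w₀ ∈ Ioi (0:ℝ) ∧ x ∈ FD K}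

lemma FDp_meas : MeasurableSet (FDp K) :=
  ((measurable_pi_apply w₀) measurableSet_Ioi).inter FD_meas

lemma FDp_exp (a : ℝ) (ha : 0 < a) :
    IntegrableOn (fun x : realSpace K => Real.exp (-(a * x w₀))) (FDp K) ∧
    ∫ x in FDp K, Real.exp (-(a * x w₀)) = 1 / a := by
  classical
  let h : InfinitePlace K → ℝ → ℝ := fun w => if w = w₀ then (Ioi (0:ℝ)).indicator fun t => Real.exp (-(a * t))
    else (Ico (0:ℝ) 1).indicator 1
  have hIntegr : ∀ w, Integrable (h w) := by
    intro w
    by_cases hw : w = w₀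
    · simp only [h, hw, if_true]
      refine (integrable_indicator_iff measurableSet_Ioi).mpr ?_
      simpa using exp_neg_integrableOn_Ioi 0 ha
    · simp only [h, hw, if_false]
      refine (integrable_indicator_iff measurableSet_Ico).mpr ?_
      exact integrableOn_const (by simp)
  have hval : ∀ w, ∫ t, h w t = if w = w₀ then 1 / a else 1 := by
    intro w
    by_cases hw : w = w₀
    · simp only [h, hw, if_true]
      rw [integral_indicator measurableSet_Ioi]
      have := integral_exp_mul_Ioi (a := -a) (by linarith) 0
      simp only [neg_mul] at this
      rw [this]; simp
    · simp only [h, hw, if_false]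
      rw [integral_indicator measurableSet_Ico]; simp
  have hpt : ∀ x : realSpace K, (FDp K).indicator (fun x : realSpace K => Real.exp (-(a * x w₀))) x = ∏ w, h w (x w) := by
    intro x
    by_cases hx : x ∈ FDp K
    · rw [indicator_of_mem hx, Finset.prod_eq_single w₀]
      · simp only [h, if_true]; rw [indicator_of_mem hx.1]
      · intro w _ hw
        simp only [h, hw, if_false]; rw [indicator_of_mem (hx.2 w hw)]; rfl
      · simp
    · rw [indicator_of_notMem hx]
      symm
      by_cases h0 : x w₀ ∈ Ioi (0:ℝ)
      · have : ¬ ∀ w, w ≠ w₀ → x w ∈ Ico (0:ℝ) 1 := fun h' => hx ⟨h0, h'⟩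
        push Not at this
        obtain ⟨w, hw, hw'⟩ := this
        refine Finset.prod_eq_zero (Finset.mem_univ w) ?_
        simp only [h, hw, if_false]; rw [indicator_of_notMem hw']
      · refine Finset.prod_eq_zero (Finset.mem_univ w₀) ?_
        simp only [h, if_true]; rw [indicator_of_notMem h0]
  have hfun : (FDp K).indicator (fun x : realSpace K => Real.exp (-(a * x w₀))) = fun x => ∏ w, h w (x w) := funext hpt
  constructor
  · rw [← integrable_indicator_iff FDp_meas, hfun]
    exact Integrable.fintype_prod hIntegr
  · rw [← integral_indicator FDp_meas, hfun]
    have := integral_fintype_prod_volume_eq_prod (fun w => h w)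
    rw [this]
    simp_rw [hval]
    simp

lemma boxCount_meas (J : (Ideal (𝓞 K))⁰) : Measurable (boxCount J : realSpace K → ENNReal) := by
  have : Countable (𝓞 K) := (RingOfIntegers.basis K).equivFun.injective.countable
  exact Measurable.tsum fun α => ind_meas α.1

variable (K) in
noncomputable def dd : ℝ := finrank ℚ K

variable (K) in
lemma dd_pos : 0 < dd K := by unfold dd; exact_mod_cast finrank_pos

lemma class_cont (J : (Ideal (𝓞 K))⁰) : ∃ (V : ℝ) (H : ℂ → ℂ), 0 < V ∧
    DifferentiableOn ℂ H {s | 1 - 1 / dd K < s.re} ∧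
    ∀ s : ℝ, 1 < s → ∃ A : ℝ, 0 ≤ A ∧ ∫⁻ x in FD K, boxCount J x * wt s x = ENNReal.ofReal A ∧
      (A : ℂ) = V / (s - 1) + H s := by
  obtain ⟨V, C, hV, hC, hVC⟩ := boxCount_est J
  have hd := dd_pos K
  have hd1 : (1:ℝ) ≤ dd K := by unfold dd; exact_mod_cast finrank_pos
  let μ : Measure (realSpace K) := volume.restrict (FDp K)
  let t : realSpace K → ℝ := fun x => dd K * x w₀
  have htm : Measurable t := by fun_prop
  have hmem : ∀ᵐ x ∂μ, x ∈ FDp K := ae_restrict_mem FDp_meas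
  have ht0 : ∀ᵐ x ∂μ, 0 ≤ t x := by
    filter_upwards [hmem] with x hx
    exact mul_nonneg hd.le (le_of_lt hx.1)
  have hIntegr : ∀ a : ℝ, 0 < a → Integrable (fun x => Real.exp (-(a * t x))) μ := by
    intro a ha
    have := (FDp_exp (K := K) (a * dd K) (by positivity)).1
    refine Integrable.congr this (Eventually.of_forall fun x => ?_)
    simp only [t]; ring_nf
  have hval : ∀ a : ℝ, 0 < a → ∫ x, Real.exp (-(a * t x)) ∂μ = 1 / (a * dd K) := by
    intro a ha
    have := (FDp_exp (K := K) (a * dd K) (by positivity)).2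
    simpa [t, mul_assoc] using this
  let E : realSpace K → ℝ := fun x => (boxCount J x).toReal - V * Real.exp (t x)
  have hEm : Measurable E := by
    have := (boxCount_meas J).ennreal_toReal
    fun_prop
  have hest : ∀ x ∈ FDp K, boxCount J x ≠ ⊤ ∧ |E x| ≤ C * Real.exp ((1 - 1 / dd K) * t x) := by
    intro x hx
    have := hVC x (fun w hw => Ico_subset_Icc_self (hx.2 w hw)) (le_of_lt hx.1)
    refine ⟨this.1, ?_⟩
    have h2 := this.2
    rw [← Real.exp_nat_mul, ← Real.exp_nat_mul] at h2
    have e1 : ((finrank ℚ K - 1 : ℕ) : ℝ) * x w₀ = (1 - 1 / dd K) * t x := by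
      rw [Nat.cast_sub finrank_pos]
      simp only [t]
      have : dd K = finrank ℚ K := rfl
      rw [← this]
      push_cast
      field_simp
    rw [e1] at h2
    exact h2
  have hb : ∀ᵐ x ∂μ, |E x| ≤ C * Real.exp ((1 - 1 / dd K) * t x) := by
    filter_upwards [hmem] with x hx using (hest x hx).2
  refine ⟨V / dd K, fun s => ∫ x, (E x : ℂ) * Complex.exp (-s * t x) ∂μ, by positivity,
    laplace_diff μ t htm ht0 hIntegr E hEm C _ hC.le hb, fun s hs => ?_⟩
  have hi1 : Integrable (fun x => E x * Real.exp (-(s * t x))) μ := by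
    have := (laplace_int μ t htm hIntegr E hEm C _ hb s (by
      simp only [Complex.ofReal_re]
      have : 0 < 1 / dd K := by positivity
      linarith)).re
    refine this.congr (Eventually.of_forall fun x => ?_)
    have : ((E x : ℂ) * Complex.exp (-(s:ℂ) * t x)) = ((E x * Real.exp (-(s * t x)) : ℝ) : ℂ) := by
      push_cast; congr 2; ring
    simp only [this]; exact Complex.ofReal_re _
  have hi2 : Integrable (fun x => V * Real.exp (-((s - 1) * t x))) μ := (hIntegr (s - 1) (by linarith)).const_mul V
  have hB : ∀ x, (boxCount J x).toReal * Real.exp (-(s * t x)) =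
      V * Real.exp (-((s - 1) * t x)) + E x * Real.exp (-(s * t x)) := by
    intro x
    simp only [E]
    have : Real.exp (-((s - 1) * t x)) = Real.exp (t x) * Real.exp (-(s * t x)) := by
      rw [← Real.exp_add]; congr 1; ring
    rw [this]; ring
  have hi3 : Integrable (fun x => (boxCount J x).toReal * Real.exp (-(s * t x))) μ := by
    simp_rw [hB]; exact hi2.add hi1
  refine ⟨∫ x, (boxCount J x).toReal * Real.exp (-(s * t x)) ∂μ,
    integral_nonneg fun x => by positivity, ?_, ?_⟩
  · rw [ofReal_integral_eq_lintegral_ofReal hi3 (Eventually.of_forall fun x => by positivity)]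
    rw [← lintegral_indicator FD_meas, ← lintegral_indicator FDp_meas]
    refine lintegral_congr fun x => ?_
    by_cases hx : x ∈ FD K
    · by_cases h0 : 0 < x w₀
      · have hxp : x ∈ FDp K := ⟨h0, hx⟩
        rw [indicator_of_mem hx, indicator_of_mem hxp, ENNReal.ofReal_mul ENNReal.toReal_nonneg,
          ENNReal.ofReal_toReal (hest x hxp).1]
        rfl
      · rw [indicator_of_mem hx, indicator_of_notMem (fun h => h0 h.1), boxCount_zero J x (not_lt.mp h0), zero_mul]
    · rw [indicator_of_notMem hx, indicator_of_notMem (fun h => hx h.2)]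
  · simp_rw [hB]
    rw [integral_add hi2 hi1, integral_const_mul, hval _ (by linarith)]
    push_cast
    congr 1
    · have h1 : (dd K : ℂ) ≠ 0 := by exact_mod_cast hd.ne'
      have h2 : (s:ℂ) - 1 ≠ 0 := by
        rw [sub_ne_zero]; exact_mod_cast hs.ne'
      field_simp
    · rw [← integral_complex_ofReal]
      congr 1; ext x; push_cast; congr 2; ring

end PIT

end

section
open MeasureTheory Filter Topology Set Module NumberField
open scoped nonZeroDivisors NNReal

namespace PIT

variable (K : Type*) [Field K] [NumberField K]

/-- norm of an ideal as a real number -/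
noncomputable def nm {K : Type*} [Field K] [NumberField K] (I : (Ideal (𝓞 K))⁰) : ℝ :=
  (Ideal.absNorm (I : Ideal (𝓞 K)) : ℝ)

lemma nm_one_le {K : Type*} [Field K] [NumberField K] (I : (Ideal (𝓞 K))⁰) : 1 ≤ nm I := by
  have : 0 < Ideal.absNorm (I : Ideal (𝓞 K)) := Ideal.absNorm_pos_of_nonZeroDivisors _
  unfold nm
  exact_mod_cast this

lemma nm_pos {K : Type*} [Field K] [NumberField K] (I : (Ideal (𝓞 K))⁰) : 0 < nm I :=
  lt_of_lt_of_le one_pos (nm_one_le I)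

lemma norm_nm_cpow {K : Type*} [Field K] [NumberField K] (I : (Ideal (𝓞 K))⁰) (s : ℂ) :
    ‖((nm I : ℝ) : ℂ) ^ (-s)‖ = nm I ^ (-s.re) := by
  rw [Complex.norm_cpow_eq_rpow_re_of_pos (nm_pos I)]; simp

noncomputable def zK (s : ℂ) : ℂ := ∑' I : (Ideal (𝓞 K))⁰, ((nm I : ℝ) : ℂ) ^ (-s)

lemma zeta_real : ∃ (G : ℂ → ℂ), DifferentiableOn ℂ G {s | 1 - 1 / dd K < s.re} ∧ G 1 ≠ 0 ∧
    ∀ s : ℝ, 1 < s → Summable (fun I : (Ideal (𝓞 K))⁰ => nm I ^ (-s)) ∧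
      G s = (s - 1) * ((∑' I : (Ideal (𝓞 K))⁰, nm I ^ (-s) : ℝ) : ℂ) := by
  classical
  obtain ⟨c, J, hc, hz⟩ := zeta_int K
  choose V H hV hH hA using fun C : ClassGroup (𝓞 K) => class_cont (J C)
  let k := Fintype.card (InfinitePlace K)
  refine ⟨fun s => ∑ C : ClassGroup (𝓞 K), c * s ^ k * ((nm (J C) : ℝ) : ℂ) ^ s * (V C + (s - 1) * H C s), ?_, ?_, ?_⟩
  · refine DifferentiableOn.fun_sum fun C _ => ?_
    have h1 : DifferentiableOn ℂ (fun s : ℂ => ((nm (J C) : ℝ) : ℂ) ^ s) {s | 1 - 1 / dd K < s.re} := by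
      intro s _
      have : ((nm (J C) : ℝ) : ℂ) ≠ 0 := by exact_mod_cast (nm_pos (J C)).ne'
      exact (differentiableAt_id.const_cpow (Or.inl this)).differentiableWithinAt
    have := hH C
    fun_prop
  · have : (∑ C : ClassGroup (𝓞 K), (c:ℂ) * 1 ^ k * ((nm (J C) : ℝ) : ℂ) ^ (1:ℂ) * (V C + (1 - 1) * H C 1)) =
        ((∑ C : ClassGroup (𝓞 K), c * nm (J C) * V C : ℝ) : ℂ) := by
      push_cast
      refine Finset.sum_congr rfl fun C _ => ?_
      simp
    simp only [this]
    have hpos : 0 < ∑ C : ClassGroup (𝓞 K), c * nm (J C) * V C :=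
      Finset.sum_pos (fun C _ => mul_pos (mul_pos hc (nm_pos _)) (hV C)) Finset.univ_nonempty
    exact_mod_cast hpos.ne'
  · intro s hs
    choose A hA0 hA1 hA2 using fun C => hA C s hs
    have h0 := hz s (by linarith)
    have h1 : ∑' I : (Ideal (𝓞 K))⁰, ENNReal.ofReal (nm I ^ (-s)) =
        ENNReal.ofReal (∑ C, c * s ^ k * nm (J C) ^ s * A C) := by
      rw [ENNReal.ofReal_sum_of_nonneg (fun C _ => by
        have := nm_pos (J C); have := hA0 C; positivity)]
      refine h0.trans (Finset.sum_congr rfl fun C _ => ?_)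
      rw [hA1 C, ← ENNReal.ofReal_mul (by have := nm_pos (J C); positivity)]
      rfl
    have hsum : Summable (fun I : (Ideal (𝓞 K))⁰ => nm I ^ (-s)) := by
      have := ENNReal.summable_toReal (f := fun I : (Ideal (𝓞 K))⁰ => ENNReal.ofReal (nm I ^ (-s)))
        (by rw [h1]; exact ENNReal.ofReal_ne_top)
      refine this.congr fun I => ENNReal.toReal_ofReal (Real.rpow_nonneg (nm_pos I).le _)
    refine ⟨hsum, ?_⟩
    rw [← ENNReal.ofReal_tsum_of_nonneg (fun I => Real.rpow_nonneg (nm_pos I).le _) hsum] at h1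
    have h2 := (ENNReal.ofReal_eq_ofReal_iff (tsum_nonneg fun I => Real.rpow_nonneg (nm_pos I).le _)
      (Finset.sum_nonneg fun C _ => by
        have := nm_pos (J C); have := hA0 C; positivity)).mp h1
    rw [h2]
    push_cast
    rw [Finset.mul_sum]
    refine Finset.sum_congr rfl fun C _ => ?_
    rw [hA2 C, Complex.ofReal_cpow (nm_pos (J C)).le]
    have h3 : (s:ℂ) - 1 ≠ 0 := by
      rw [sub_ne_zero]; exact_mod_cast hs.ne'
    field_simp

lemma nm_summable {s : ℝ} (hs : 1 < s) : Summable (fun I : (Ideal (𝓞 K))⁰ => nm I ^ (-s)) :=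
  let ⟨_, _, _, h⟩ := zeta_real K
  (h s hs).1

lemma zK_summable {s : ℂ} (hs : 1 < s.re) : Summable (fun I : (Ideal (𝓞 K))⁰ => ((nm I : ℝ) : ℂ) ^ (-s)) := by
  refine Summable.of_norm ?_
  simp_rw [norm_nm_cpow]
  exact nm_summable K hs

lemma zK_diff : DifferentiableOn ℂ (zK K) {s | 1 < s.re} := by
  intro s hs
  have hs : 1 < s.re := hs
  obtain ⟨σ, h1, h2⟩ := exists_between hs
  have ho : IsOpen {z : ℂ | σ < z.re} := isOpen_lt continuous_const Complex.continuous_re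
  have := Complex.differentiableOn_tsum_of_summable_norm (F := fun (I : (Ideal (𝓞 K))⁰) (s : ℂ) => ((nm I : ℝ) : ℂ) ^ (-s))
    (nm_summable K h1) (fun I => ?_) ho (fun I z hz => ?_)
  · exact ((this s h2).differentiableAt (ho.mem_nhds h2)).differentiableWithinAt
  · intro z _
    have : ((nm I : ℝ) : ℂ) ≠ 0 := by exact_mod_cast (nm_pos I).ne'
    exact (differentiableAt_id.neg.const_cpow (Or.inl this)).differentiableWithinAt
  · rw [norm_nm_cpow]
    have hz : σ < z.re := hz
    exact Real.rpow_le_rpow_of_exponent_le (nm_one_le I) (by linarith)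

theorem zK_cont : ∃ (G : ℂ → ℂ), DifferentiableOn ℂ G {s | 1 - 1 / dd K < s.re} ∧ G 1 ≠ 0 ∧
    ∀ s : ℂ, 1 < s.re → G s = (s - 1) * zK K s := by
  obtain ⟨G, hG, hG1, h⟩ := zeta_real K
  refine ⟨G, hG, hG1, ?_⟩
  have ho : IsOpen {z : ℂ | 1 < z.re} := isOpen_lt continuous_const Complex.continuous_re
  have hsub : {z : ℂ | 1 < z.re} ⊆ {s | 1 - 1 / dd K < s.re} := by
    intro z hz
    have hz : 1 < z.re := hz
    have : 0 < 1 / dd K := by have := dd_pos K; positivity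
    show 1 - 1 / dd K < z.re
    linarith
  have a1 : AnalyticOnNhd ℂ G {z : ℂ | 1 < z.re} := (hG.mono hsub).analyticOnNhd ho
  have a2 : AnalyticOnNhd ℂ (fun s => (s - 1) * zK K s) {z : ℂ | 1 < z.re} := by
    refine DifferentiableOn.analyticOnNhd ?_ ho
    have := zK_diff K
    fun_prop
  have hc : IsPreconnected {z : ℂ | 1 < z.re} := (convex_halfSpace_re_gt 1).isPreconnected
  have key := a1.eqOn_of_preconnected_of_frequently_eq a2 hc (z₀ := 2) (by simp) ?_
  · intro s hs; exact key hs
  have hreal : ∀ x : ℝ, 1 < x → G x = ((x:ℂ) - 1) * zK K x := by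
    intro x hx
    rw [(h x hx).2, zK]
    push_cast
    congr 1
    refine tsum_congr fun I => ?_
    rw [Complex.ofReal_cpow (nm_pos I).le]; simp
  have ht : Tendsto (fun n : ℕ => ((2 + 1 / ((n:ℝ) + 1) : ℝ) : ℂ)) atTop (𝓝[≠] 2) := by
    refine tendsto_nhdsWithin_iff.mpr ⟨?_, Eventually.of_forall fun n => ?_⟩
    · have := (tendsto_one_div_add_atTop_nhds_zero_nat (𝕜 := ℝ)).const_add 2
      rw [add_zero] at this
      exact (Complex.continuous_ofReal.tendsto 2).comp this
    · simp only [mem_compl_iff, mem_singleton_iff]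
      intro hh
      have : (2 + 1 / ((n:ℝ) + 1) : ℝ) = 2 := by exact_mod_cast hh
      have h3 : 0 < 1 / ((n:ℝ) + 1) := by positivity
      linarith
  refine ht.frequently (Frequently.of_forall fun n => hreal _ ?_)
  have h3 : 0 < 1 / ((n:ℝ) + 1) := by positivity
  linarith

end PIT

end

section
open MeasureTheory Filter Topology Set Module NumberField IsDedekindDomain
open scoped nonZeroDivisors NNReal

namespace PIT

variable (K : Type*) [Field K] [NumberField K]

/-- index set of prime powers `P^(k+1)` -/
abbrev PP := HeightOneSpectrum (𝓞 K) × ℕ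

variable {K}

noncomputable def pN (P : HeightOneSpectrum (𝓞 K)) : (Ideal (𝓞 K))⁰ :=
  ⟨P.asIdeal, mem_nonZeroDivisors_of_ne_zero P.ne_bot⟩

noncomputable def pw (q : PP K) : (Ideal (𝓞 K))⁰ := pN q.1 ^ (q.2 + 1)

noncomputable def lg (q : PP K) : ℝ := Real.log (nm (pN q.1))

lemma nm_mul (I J : (Ideal (𝓞 K))⁰) : nm (I * J) = nm I * nm J := by
  simp [nm]

lemma nm_pow (I : (Ideal (𝓞 K))⁰) (n : ℕ) : nm (I ^ n) = nm I ^ n := by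
  simp [nm]

lemma two_le_nm (P : HeightOneSpectrum (𝓞 K)) : 2 ≤ nm (pN P) := by
  have h1 : Ideal.absNorm P.asIdeal ≠ 1 := by
    rw [Ne, Ideal.absNorm_eq_one_iff]; exact P.isPrime.ne_top
  have h2 := nm_one_le (pN P)
  unfold nm at *
  simp only [pN] at *
  have h3 : 1 ≤ Ideal.absNorm P.asIdeal := by exact_mod_cast h2
  have : 2 ≤ Ideal.absNorm P.asIdeal := by omega
  exact_mod_cast this

lemma lg_nonneg (q : PP K) : 0 ≤ lg q := Real.log_nonneg (nm_one_le _)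

lemma lg_le (q : PP K) : lg q ≤ Real.log (nm (pw q)) := by
  refine Real.log_le_log (nm_pos _) ?_
  rw [pw, nm_pow]
  exact le_self_pow₀ (nm_one_le _) (by omega)

lemma pw_inj : Function.Injective (pw : PP K → (Ideal (𝓞 K))⁰) := by
  rintro ⟨P, k⟩ ⟨Q, j⟩ h
  have h1 : P.asIdeal ^ (k + 1) = Q.asIdeal ^ (j + 1) := by
    have := congrArg (Subtype.val) h
    simpa [pw, pN] using this
  have h2 : Q.asIdeal ∣ P.asIdeal := by
    have : Q.asIdeal ∣ P.asIdeal ^ (k + 1) := by rw [h1]; exact dvd_pow_self _ (by omega)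
    exact Q.prime.dvd_of_dvd_pow this
  have h3 : P = Q := by
    ext1
    exact P.isMaximal.eq_of_le Q.isPrime.ne_top (Ideal.dvd_iff_le.mp h2)
  subst h3
  have h4 : nm (pN P) ^ (k + 1) = nm (pN P) ^ (j + 1) := by
    have := congrArg nm h
    simpa [pw, nm_pow] using this
  have h5 := pow_right_injective₀ (nm_pos _) (by linarith [two_le_nm P]) h4
  simp only [Prod.mk.injEq, true_and]; omega

open scoped Classical in
lemma sum_lg (I : (Ideal (𝓞 K))⁰) :
    HasSum (fun q : PP K => if pw q ∣ I then lg q else 0) (Real.log (nm I)) := by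
  have hI : (I : Ideal (𝓞 K)) ≠ 0 := nonZeroDivisors.coe_ne_zero I
  let e : HeightOneSpectrum (𝓞 K) → ℕ := fun v => (Associates.mk v.asIdeal).count (Associates.mk (I : Ideal (𝓞 K))).factors
  have hdvd : ∀ q : PP K, pw q ∣ I ↔ q.2 < e q.1 := by
    intro q
    have hq : Irreducible (Associates.mk q.1.asIdeal) := q.1.associates_irreducible
    have := Associates.prime_pow_dvd_iff_le (m := Associates.mk (I : Ideal (𝓞 K))) (k := q.2 + 1)
      (Associates.mk_ne_zero.mpr hI) hq
    rw [← Associates.mk_pow, Associates.mk_le_mk_iff_dvd] at this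
    rw [nonZeroDivisors_dvd_iff_dvd_coe]
    exact this
  have hfin := Ideal.hasFiniteMulSupport hI
  have hS : (Function.mulSupport fun v : HeightOneSpectrum (𝓞 K) => v.maxPowDividing (I : Ideal (𝓞 K))).Finite := hfin
  let S := hS.toFinset
  have hprod : (I : Ideal (𝓞 K)) = ∏ v ∈ S, v.asIdeal ^ e v := by
    conv_lhs => rw [← Ideal.finprod_heightOneSpectrum_factorization hI]
    rw [finprod_eq_prod_of_mulSupport_toFinset_subset _ hS subset_rfl]
    rfl
  have hlog : Real.log (nm I) = ∑ v ∈ S, e v * Real.log (nm (pN v)) := by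
    have : nm I = ∏ v ∈ S, nm (pN v) ^ e v := by
      unfold nm
      rw [hprod, map_prod]
      push_cast
      refine Finset.prod_congr rfl fun v _ => ?_
      rw [map_pow]; push_cast; rfl
    rw [this, Real.log_prod (fun v _ => (pow_pos (nm_pos _) _).ne')]
    simp [Real.log_pow]
  have he : ∀ v, e v ≠ 0 → v ∈ S := by
    intro v hv
    simp only [S, Set.Finite.mem_toFinset, Function.mem_mulSupport]
    intro h
    have h1 : v.asIdeal ∣ v.maxPowDividing (I : Ideal (𝓞 K)) := dvd_pow_self _ hv
    rw [h] at h1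
    exact v.prime.not_isUnit (isUnit_of_dvd_one h1)
  let M := S.sup e
  have hM : ∀ v ∈ S, e v ≤ M := fun v hv => Finset.le_sup hv
  have key : ∑ q ∈ S ×ˢ Finset.range M, (if pw q ∣ I then lg q else 0) = Real.log (nm I) := by
    rw [hlog, Finset.sum_product]
    refine Finset.sum_congr rfl fun v hv => ?_
    simp only [hdvd]
    simp only [lg]
    rw [← Finset.sum_filter, Finset.sum_const, nsmul_eq_mul]
    have : (Finset.range M).filter (fun k => k < e v) = Finset.range (e v) := by
      ext k; simp only [Finset.mem_filter, Finset.mem_range]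
      have := hM v hv
      omega
    rw [this, Finset.card_range]
  rw [← key]
  refine hasSum_sum_of_ne_finset_zero fun q hq => ?_
  rw [if_neg]
  intro h
  rw [hdvd] at h
  have h1 := he q.1 (by omega)
  exact hq (Finset.mem_product.mpr ⟨h1, Finset.mem_range.mpr (lt_of_lt_of_le h (hM _ h1))⟩)

/-- summability of the log-weighted sum over ideals -/
lemma log_summable {s : ℝ} (hs : 1 < s) :
    Summable (fun I : (Ideal (𝓞 K))⁰ => Real.log (nm I) * nm I ^ (-s)) := by
  have hε : 0 < (s - 1) / 2 := by linarith
  refine Summable.of_nonneg_of_le (fun I => mul_nonneg (Real.log_nonneg (nm_one_le I)) (Real.rpow_nonneg (nm_pos I).le _))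
    (fun I => ?_) ((nm_summable K (s := (s + 1) / 2) (by linarith)).mul_left ((s - 1) / 2)⁻¹)
  have h1 := Real.log_le_rpow_div (nm_pos I).le hε
  calc _ ≤ nm I ^ ((s - 1) / 2) / ((s - 1) / 2) * nm I ^ (-s) := by
        gcongr; exact Real.rpow_nonneg (nm_pos I).le _
    _ = ((s - 1) / 2)⁻¹ * (nm I ^ ((s - 1) / 2) * nm I ^ (-s)) := by ring
    _ = _ := by rw [← Real.rpow_add (nm_pos I)]; congr 2; ring

lemma lg_summable {s : ℝ} (hs : 1 < s) :
    Summable (fun q : PP K => lg q * nm (pw q) ^ (-s)) := by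
  have h1 := (log_summable (K := K) hs).comp_injective pw_inj
  refine Summable.of_nonneg_of_le (fun q => mul_nonneg (lg_nonneg q) (Real.rpow_nonneg (nm_pos _).le _))
    (fun q => ?_) h1
  simp only [Function.comp]
  gcongr
  · exact Real.rpow_nonneg (nm_pos _).le _
  · exact lg_le q

variable (K) in
noncomputable def LK (s : ℂ) : ℂ := ∑' q : PP K, (lg q : ℂ) * ((nm (pw q) : ℝ) : ℂ) ^ (-s)

lemma LK_summable_norm {s : ℂ} (hs : 1 < s.re) :
    Summable (fun q : PP K => ‖(lg q : ℂ) * ((nm (pw q) : ℝ) : ℂ) ^ (-s)‖) := by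
  refine (lg_summable hs).congr fun q => ?_
  rw [norm_mul, norm_nm_cpow, Complex.norm_real, Real.norm_eq_abs, abs_of_nonneg (lg_nonneg q)]

lemma zK_summable_norm {s : ℂ} (hs : 1 < s.re) :
    Summable (fun I : (Ideal (𝓞 K))⁰ => ‖((nm I : ℝ) : ℂ) ^ (-s)‖) := by
  simp_rw [norm_nm_cpow]
  exact nm_summable K hs

lemma deriv_zK {s : ℂ} (hs : 1 < s.re) :
    deriv (zK K) s = - ∑' I : (Ideal (𝓞 K))⁰, (Real.log (nm I) : ℂ) * ((nm I : ℝ) : ℂ) ^ (-s) := by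
  obtain ⟨σ, h1, h2⟩ := exists_between hs
  have ho : IsOpen {z : ℂ | σ < z.re} := isOpen_lt continuous_const Complex.continuous_re
  have h0 : ∀ I : (Ideal (𝓞 K))⁰, ((nm I : ℝ) : ℂ) ≠ 0 := fun I => by exact_mod_cast (nm_pos I).ne'
  have := Complex.hasSum_deriv_of_summable_norm (F := fun (I : (Ideal (𝓞 K))⁰) (s : ℂ) => ((nm I : ℝ) : ℂ) ^ (-s))
    (nm_summable K h1) (fun I => ?_) ho (fun I z hz => ?_) (show s ∈ {z : ℂ | σ < z.re} from h2)
  · have h3 : deriv (zK K) s = deriv (fun w : ℂ => ∑' I : (Ideal (𝓞 K))⁰, ((nm I : ℝ) : ℂ) ^ (-w)) s := rfl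
    rw [h3, ← this.tsum_eq, ← tsum_neg]
    refine tsum_congr fun I => ?_
    have : HasDerivAt (fun w : ℂ => ((nm I : ℝ) : ℂ) ^ (-w)) (((nm I : ℝ) : ℂ) ^ (-s) * Complex.log (nm I : ℝ) * (-1)) s :=
      ((hasDerivAt_id s).neg).const_cpow (Or.inl (h0 I))
    rw [this.deriv, Complex.ofReal_log (nm_pos I).le]; ring
  · intro z _
    exact (differentiableAt_id.neg.const_cpow (Or.inl (h0 I))).differentiableWithinAt
  · rw [norm_nm_cpow]
    have hz : σ < z.re := hz
    exact Real.rpow_le_rpow_of_exponent_le (nm_one_le I) (by linarith)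

/-- the equivalence `(I, q) ↦ (I * P^k, q)` -/
noncomputable def mulEquiv : (Ideal (𝓞 K))⁰ × PP K ≃ Σ I : (Ideal (𝓞 K))⁰, {q : PP K // pw q ∣ I} where
  toFun p := ⟨p.1 * pw p.2, p.2, dvd_mul_left _ _⟩
  invFun x := (x.2.2.choose, x.2.1)
  left_inv p := by
    refine Prod.ext ?_ rfl
    have h := (⟨p.2, dvd_mul_left (pw p.2) p.1⟩ : {q : PP K // pw q ∣ p.1 * pw p.2}).2.choose_spec
    exact (mul_left_cancel ((mul_comm _ _).trans h)).symm
  right_inv x := by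
    obtain ⟨I, q, hq⟩ := x
    have h := hq.choose_spec
    have h' : hq.choose * pw q = I := by rw [mul_comm]; exact h.symm
    refine Sigma.ext h' ?_
    simp only
    congr! 3

theorem ode {s : ℂ} (hs : 1 < s.re) : deriv (zK K) s = - (zK K s * LK K s) := by
  classical
  rw [deriv_zK hs, zK, LK, tsum_mul_tsum_of_summable_norm (zK_summable_norm hs) (LK_summable_norm hs)]
  congr 1
  have hsm := summable_mul_of_summable_norm (zK_summable_norm (K := K) hs) (LK_summable_norm (K := K) hs)
  have hF : ∀ p : (Ideal (𝓞 K))⁰ × PP K, ((nm p.1 : ℝ) : ℂ) ^ (-s) * ((lg p.2 : ℂ) * ((nm (pw p.2) : ℝ) : ℂ) ^ (-s)) =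
      (fun x : Σ I : (Ideal (𝓞 K))⁰, {q : PP K // pw q ∣ I} => (lg x.2.1 : ℂ) * ((nm x.1 : ℝ) : ℂ) ^ (-s)) (mulEquiv p) := by
    intro p
    simp only [mulEquiv, Equiv.coe_fn_mk]
    rw [nm_mul, Complex.ofReal_mul, Complex.mul_cpow_ofReal_nonneg (nm_pos _).le (nm_pos _).le]
    ring
  simp_rw [hF] at hsm ⊢
  rw [mulEquiv.tsum_eq (fun x : Σ I : (Ideal (𝓞 K))⁰, {q : PP K // pw q ∣ I} => (lg x.2.1 : ℂ) * ((nm x.1 : ℝ) : ℂ) ^ (-s))]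
  replace hsm := (mulEquiv.summable_iff (f := fun x : Σ I : (Ideal (𝓞 K))⁰, {q : PP K // pw q ∣ I} => (lg x.2.1 : ℂ) * ((nm x.1 : ℝ) : ℂ) ^ (-s))).mp hsm
  rw [hsm.tsum_sigma]
  refine tsum_congr fun I => ?_
  simp only
  rw [tsum_mul_right]
  congr 1
  rw [← Complex.ofReal_tsum]
  congr 1
  rw [← (sum_lg I).tsum_eq]
  have := tsum_subtype {q : PP K | pw q ∣ I} lg
  refine Eq.trans ?_ this.symm
  simp [Set.indicator_apply]

end PIT

end

section
open MeasureTheory Filter Topology Set Module NumberField IsDedekindDomain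
open scoped nonZeroDivisors NNReal

namespace PIT

lemma logderiv_ord {G : ℂ → ℂ} {s₀ : ℂ} (hG : AnalyticAt ℂ G s₀) (hne : analyticOrderAt G s₀ ≠ ⊤) :
    ∃ n : ℕ, (G s₀ = 0 → 1 ≤ n) ∧ (∀ᶠ z in 𝓝[≠] s₀, G z ≠ 0) ∧
      Tendsto (fun z => (z - s₀) * (deriv G z / G z)) (𝓝[≠] s₀) (𝓝 n) := by
  obtain ⟨n, hn⟩ := ENat.ne_top_iff_exists.mp hne
  obtain ⟨g, hg, hg0, hGg⟩ := (hG.analyticOrderAt_eq_natCast (n := n)).mp hn.symm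
  refine ⟨n, ?_, ?_, ?_⟩
  · intro h
    by_contra hlt
    have h0 : n = 0 := by omega
    have := hGg.self_of_nhds
    rw [h, h0] at this
    simp only [pow_zero, one_smul] at this
    exact hg0 this.symm
  · have h1 : ∀ᶠ z in 𝓝[≠] s₀, g z ≠ 0 := (hg.continuousAt.eventually_ne hg0).filter_mono nhdsWithin_le_nhds
    filter_upwards [h1, hGg.filter_mono nhdsWithin_le_nhds, self_mem_nhdsWithin] with z h1 h2 h3
    rw [h2, smul_eq_mul]
    exact mul_ne_zero (pow_ne_zero _ (sub_ne_zero.mpr h3)) h1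
  · have hlim : Tendsto (fun z => (n:ℂ) + (z - s₀) * (deriv g z / g z)) (𝓝[≠] s₀) (𝓝 n) := by
      have : ContinuousAt (fun z => (n:ℂ) + (z - s₀) * (deriv g z / g z)) s₀ := by
        have h1 := hg.deriv.continuousAt
        have h2 := hg.continuousAt
        have h3 := h1.div h2 hg0
        exact continuousAt_const.add ((continuousAt_id.sub continuousAt_const).mul h3)
      have h4 := this.tendsto
      simp only [sub_self, zero_mul, add_zero] at h4
      exact h4.mono_left nhdsWithin_le_nhds
    refine hlim.congr' ?_
    have h1 : ∀ᶠ z in 𝓝[≠] s₀, g z ≠ 0 := (hg.continuousAt.eventually_ne hg0).filter_mono nhdsWithin_le_nhds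
    have h2 : ∀ᶠ z in 𝓝[≠] s₀, AnalyticAt ℂ g z := hg.eventually_analyticAt.filter_mono nhdsWithin_le_nhds
    have h3 : ∀ᶠ z in 𝓝[≠] s₀, G =ᶠ[𝓝 z] fun z => (z - s₀) ^ n • g z :=
      hGg.eventually_nhds.filter_mono nhdsWithin_le_nhds
    filter_upwards [h1, h2, h3, self_mem_nhdsWithin] with z hz1 hz2 hz3 hz4
    have hz5 : z - s₀ ≠ 0 := sub_ne_zero.mpr hz4
    rw [hz3.deriv_eq, hz3.eq_of_nhds]
    simp only [smul_eq_mul]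
    have hd : HasDerivAt (fun z => (z - s₀) ^ n * g z) ((n * (z - s₀) ^ (n - 1) * 1) * g z + (z - s₀) ^ n * deriv g z) z :=
      (((hasDerivAt_id z).sub_const s₀).pow n).mul hz2.differentiableAt.hasDerivAt
    rw [hd.deriv]
    rcases Nat.eq_zero_or_pos n with h0 | h0
    · subst h0; simp
    · have hp : (z - s₀) ^ n = (z - s₀) ^ (n - 1) * (z - s₀) := by rw [← pow_succ]; congr 1; omega
      rw [hp]
      have := pow_ne_zero (n - 1) hz5
      field_simp

variable (K : Type*) [Field K] [NumberField K]

lemma LK_diff : DifferentiableOn ℂ (LK K) {s | 1 < s.re} := by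
  intro s hs
  have hs : 1 < s.re := hs
  obtain ⟨σ, h1, h2⟩ := exists_between hs
  have ho : IsOpen {z : ℂ | σ < z.re} := isOpen_lt continuous_const Complex.continuous_re
  have := Complex.differentiableOn_tsum_of_summable_norm
    (F := fun (q : PP K) (s : ℂ) => (lg q : ℂ) * ((nm (pw q) : ℝ) : ℂ) ^ (-s))
    (lg_summable h1) (fun q => ?_) ho (fun q z hz => ?_)
  · exact ((this s h2).differentiableAt (ho.mem_nhds h2)).differentiableWithinAt
  · intro z _
    have : ((nm (pw q) : ℝ) : ℂ) ≠ 0 := by exact_mod_cast (nm_pos (pw q)).ne'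
    exact ((differentiableAt_id.neg.const_cpow (Or.inl this)).const_mul _).differentiableWithinAt
  · rw [norm_mul, norm_nm_cpow, Complex.norm_real, Real.norm_eq_abs, abs_of_nonneg (lg_nonneg q)]
    have hz : σ < z.re := hz
    exact mul_le_mul_of_nonneg_left (Real.rpow_le_rpow_of_exponent_le (nm_one_le _) (by linarith)) (lg_nonneg q)

lemma re_term (q : PP K) (x y : ℝ) : ((lg q : ℂ) * ((nm (pw q) : ℝ) : ℂ) ^ (-(1 + x + y * Complex.I))).re =
    lg q * nm (pw q) ^ (-(1 + x)) * Real.cos (y * Real.log (nm (pw q))) := by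
  have h0 : ((nm (pw q) : ℝ) : ℂ) ≠ 0 := by exact_mod_cast (nm_pos (pw q)).ne'
  rw [Complex.re_ofReal_mul, Complex.cpow_def_of_ne_zero h0, ← Complex.ofReal_log (nm_pos _).le, Complex.exp_re,
    Real.rpow_def_of_pos (nm_pos _), mul_assoc]
  congr 2
  · congr 1; simp
  · rw [← Real.cos_neg]; congr 1; simp; ring

lemma three_four_one (x y : ℝ) (hx : 0 < x) :
    0 ≤ (3 * LK K (1 + x + (0:ℝ) * Complex.I) + 4 * LK K (1 + x + y * Complex.I)
      + LK K (1 + x + (2 * y : ℝ) * Complex.I)).re := by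
  have hs : ∀ y : ℝ, Summable (fun q : PP K => (lg q : ℂ) * ((nm (pw q) : ℝ) : ℂ) ^ (-(1 + x + y * Complex.I))) := by
    intro y
    refine (LK_summable_norm ?_).of_norm
    simp [hx]
  have hre : ∀ y : ℝ, HasSum (fun q : PP K => lg q * nm (pw q) ^ (-(1 + x)) * Real.cos (y * Real.log (nm (pw q))))
      (LK K (1 + x + y * Complex.I)).re := by
    intro y
    have := Complex.hasSum_re (hs y).hasSum
    simp_rw [re_term] at this
    exact this
  have := (((hre 0).mul_left 3).add ((hre y).mul_left 4)).add (hre (2 * y))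
  have h2 := this.nonneg (fun q => by
    have h1 : 0 ≤ lg q * nm (pw q) ^ (-(1 + x)) := mul_nonneg (lg_nonneg q) (Real.rpow_nonneg (nm_pos _).le _)
    rw [zero_mul, Real.cos_zero, mul_assoc 2 y, Real.cos_two_mul]
    nlinarith [mul_nonneg h1 (sq_nonneg (Real.cos (y * Real.log (nm (pw q))) + 1))])
  have e : (3 * LK K (1 + x + (0:ℝ) * Complex.I) + 4 * LK K (1 + x + y * Complex.I)
      + LK K (1 + x + (2 * y : ℝ) * Complex.I)).re = 3 * (LK K (1 + x + (0:ℝ) * Complex.I)).re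
      + 4 * (LK K (1 + x + y * Complex.I)).re + (LK K (1 + x + (2 * y : ℝ) * Complex.I)).re := by
    rw [Complex.add_re, Complex.add_re]
    norm_num [Complex.mul_re]
  rw [e]; exact h2

theorem LK_cont : ∃ (H : ℂ → ℂ), ContinuousOn H {s | 1 ≤ s.re} ∧
    ∀ s : ℂ, 1 < s.re → LK K s = 1 / (s - 1) - H s := by
  obtain ⟨G, hG, hG1, hGz⟩ := zK_cont K
  have hU : IsOpen {s : ℂ | 1 - 1 / dd K < s.re} := isOpen_lt continuous_const Complex.continuous_re
  have hV : IsOpen {s : ℂ | 1 < s.re} := isOpen_lt continuous_const Complex.continuous_re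
  have hθ : 1 - 1 / dd K < 1 := by
    have : 0 < 1 / dd K := by have := dd_pos K; positivity
    linarith
  have han : AnalyticOnNhd ℂ G {s : ℂ | 1 - 1 / dd K < s.re} := hG.analyticOnNhd hU
  have hconn : IsPreconnected {s : ℂ | 1 - 1 / dd K < s.re} := (convex_halfSpace_re_gt _).isPreconnected
  have hord : ∀ s : ℂ, 1 - 1 / dd K < s.re → analyticOrderAt G s ≠ ⊤ := by
    intro s hs htop
    rw [analyticOrderAt_eq_top] at htop
    have := han.eqOn_zero_of_preconnected_of_eventuallyEq_zero hconn hs htop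
    exact hG1 (this (show (1:ℂ) ∈ {s : ℂ | 1 - 1 / dd K < s.re} by simpa using dd_pos K))
  -- log derivative for Re > 1
  have hld : ∀ s : ℂ, 1 < s.re → G s ≠ 0 → deriv G s / G s = 1 / (s - 1) - LK K s := by
    intro s hs h0
    have hs1 : s - 1 ≠ 0 := by
      intro h
      have : s = 1 := sub_eq_zero.mp h
      rw [this] at hs; simp at hs
    have hev : G =ᶠ[𝓝 s] fun s => (s - 1) * zK K s := by
      filter_upwards [hV.mem_nhds hs] with z hz using hGz z hz
    have hz : HasDerivAt (zK K) (-(zK K s * LK K s)) s := by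
      rw [← ode hs]
      exact ((zK_diff K s hs).differentiableAt (hV.mem_nhds hs)).hasDerivAt
    have hd : HasDerivAt (fun s => (s - 1) * zK K s) (1 * zK K s + (s - 1) * (-(zK K s * LK K s))) s :=
      ((hasDerivAt_id s).sub_const 1).mul hz
    rw [hev.deriv_eq, hd.deriv, hGz s hs]
    rw [hGz s hs] at h0
    have hz0 : zK K s ≠ 0 := fun h => h0 (by rw [h, mul_zero])
    field_simp
    ring
  have hnz1 : ∀ s : ℂ, 1 < s.re → G s ≠ 0 := by
    intro s hs h0
    obtain ⟨n, hn, hne, hlim⟩ := logderiv_ord (han s (lt_trans hθ hs)) (hord s (lt_trans hθ hs))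
    have hs1 : s - 1 ≠ 0 := by
      intro h
      have : s = 1 := sub_eq_zero.mp h
      rw [this] at hs; simp at hs
    have hc : ContinuousAt (fun z => (z - s) * (1 / (z - 1) - LK K z)) s := by
      have h1 : ContinuousAt (LK K) s := ((LK_diff K s hs).differentiableAt (hV.mem_nhds hs)).continuousAt
      have h2 : ContinuousAt (fun z : ℂ => 1 / (z - 1)) s :=
        continuousAt_const.div (continuousAt_id.sub continuousAt_const) hs1
      exact (continuousAt_id.sub continuousAt_const).mul (h2.sub h1)
    have h3 := hc.tendsto
    simp only [sub_self, zero_mul] at h3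
    have h4 : Tendsto (fun z => (z - s) * (1 / (z - 1) - LK K z)) (𝓝[≠] s) (𝓝 n) := by
      refine hlim.congr' ?_
      filter_upwards [hne, (hV.mem_nhds hs : _ ∈ 𝓝 s) |> mem_nhdsWithin_of_mem_nhds] with z hz1 hz2
      rw [hld z hz2 hz1]
    have h5 := tendsto_nhds_unique h4 (h3.mono_left nhdsWithin_le_nhds)
    have h6 : n = 0 := by exact_mod_cast h5
    have := hn h0
    omega
  have hlimL : ∀ y : ℝ, ∃ n : ℕ, (G (1 + y * Complex.I) = 0 → 1 ≤ n) ∧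
      Tendsto (fun x : ℝ => (x : ℂ) * LK K (1 + x + y * Complex.I)) (𝓝[>] 0)
        (𝓝 ((if y = 0 then 1 else 0) - n)) := by
    intro y
    have hre : 1 - 1 / dd K < (1 + y * Complex.I : ℂ).re := by simpa using dd_pos K
    obtain ⟨n, hn, hne, hlim⟩ := logderiv_ord (han _ hre) (hord _ hre)
    refine ⟨n, hn, ?_⟩
    have hpath : Tendsto (fun x : ℝ => (1 + x + y * Complex.I : ℂ)) (𝓝[>] 0) (𝓝[≠] (1 + y * Complex.I)) := by
      refine tendsto_nhdsWithin_iff.mpr ⟨?_, ?_⟩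
      · have : Continuous (fun x : ℝ => (1 + x + y * Complex.I : ℂ)) := by fun_prop
        have := this.tendsto 0
        simp only [Complex.ofReal_zero, add_zero] at this
        exact this.mono_left nhdsWithin_le_nhds
      · filter_upwards [self_mem_nhdsWithin] with x hx
        simp only [mem_compl_iff, mem_singleton_iff]
        intro h
        have := congrArg Complex.re h
        simp at this
        exact (ne_of_gt hx) this
    have h1 := hlim.comp hpath
    have h2 : Tendsto (fun x : ℝ => (x : ℂ) / (x + y * Complex.I)) (𝓝[>] 0) (𝓝 (if y = 0 then 1 else 0)) := by
      by_cases hy : y = 0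
      · simp only [hy, if_true]
        refine tendsto_const_nhds.congr' ?_
        filter_upwards [self_mem_nhdsWithin] with x hx
        have : (x : ℂ) ≠ 0 := by exact_mod_cast (ne_of_gt hx)
        simp [this]
      · simp only [hy, if_false]
        have hc : ContinuousAt (fun x : ℝ => (x : ℂ) / (x + y * Complex.I)) 0 := by
          refine ContinuousAt.div (by fun_prop) (by fun_prop) ?_
          simp [hy]
        have := hc.tendsto
        simp only [Complex.ofReal_zero, zero_div] at this
        exact this.mono_left nhdsWithin_le_nhds
    refine (h2.sub h1).congr' ?_
    filter_upwards [self_mem_nhdsWithin] with x hx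
    have hx : 0 < x := hx
    have hr : 1 < (1 + x + y * Complex.I : ℂ).re := by simpa using hx
    simp only [Function.comp]
    rw [hld _ hr (hnz1 _ hr)]
    ring
  have hnz2 : ∀ y : ℝ, G (1 + y * Complex.I) ≠ 0 := by
    intro y h0
    have hy : y ≠ 0 := by
      rintro rfl
      simp at h0; exact hG1 h0
    obtain ⟨n0, -, l0⟩ := hlimL 0
    obtain ⟨n1, hn1, l1⟩ := hlimL y
    obtain ⟨n2, -, l2⟩ := hlimL (2 * y)
    have h1 := hn1 h0
    have l := ((l0.const_mul 3).add (l1.const_mul 4)).add l2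
    have l' := (Complex.continuous_re.tendsto _).comp l
    have hge := ge_of_tendsto (b := (0:ℝ)) l' (by
      filter_upwards [self_mem_nhdsWithin] with x hx
      have hx : 0 < x := hx
      have := three_four_one K x y hx
      simp only [Function.comp]
      have e : (3 * ((x:ℂ) * LK K (1 + x + (0:ℝ) * Complex.I)) + 4 * ((x:ℂ) * LK K (1 + x + y * Complex.I))
        + (x:ℂ) * LK K (1 + x + (2 * y : ℝ) * Complex.I)) = (x:ℂ) * (3 * LK K (1 + x + (0:ℝ) * Complex.I) + 4 * LK K (1 + x + y * Complex.I)
      + LK K (1 + x + (2 * y : ℝ) * Complex.I)) := by ring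
      rw [e, Complex.re_ofReal_mul]
      exact mul_nonneg hx.le this)
    have hy2 : 2 * y ≠ 0 := by positivity
    simp only [hy, hy2, if_true, if_false] at hge
    have e2 : (3 * ((1:ℂ) - n0) + 4 * (0 - n1) + (0 - n2)).re = 3 * (1 - n0) - 4 * n1 - n2 := by
      simp; ring
    rw [e2] at hge
    have h1' : (1:ℝ) ≤ n1 := by exact_mod_cast h1
    have : (0:ℝ) ≤ n0 := by positivity
    have : (0:ℝ) ≤ n2 := by positivity
    linarith
  have hnz : ∀ s : ℂ, 1 ≤ s.re → G s ≠ 0 := by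
    intro s hs
    rcases hs.lt_or_eq with h | h
    · exact hnz1 s h
    · have : s = 1 + s.im * Complex.I := by
        apply Complex.ext <;> simp [← h]
      rw [this]; exact hnz2 _
  refine ⟨fun s => deriv G s / G s, ?_, ?_⟩
  · intro s hs
    have hs : 1 ≤ s.re := hs
    have := han s (lt_of_lt_of_le hθ hs)
    exact (this.deriv.continuousAt.div this.continuousAt (hnz s hs)).continuousWithinAt
  · intro s hs
    have := hld s hs (hnz1 s hs)
    simp only [this]; ring

end PIT

end

section
open MeasureTheory Filter Topology Set Module NumberField IsDedekindDomain
open scoped nonZeroDivisors NNReal ArithmeticFunction.vonMangoldt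

namespace PIT

variable (K : Type*) [Field K] [NumberField K]

lemma fin_q (n : ℕ) : {q : PP K | Ideal.absNorm (pw q : Ideal (𝓞 K)) = n}.Finite := by
  have h := Ideal.finite_setOfPred_absNorm_eq (S := 𝓞 K) n
  exact Set.Finite.preimage (f := fun q : PP K => (pw q : Ideal (𝓞 K)))
    ((Subtype.val_injective.comp pw_inj).injOn) h

noncomputable def wT (n : ℕ) : Finset (PP K) := (fin_q K n).toFinset

variable {K} in
lemma mem_wT {n : ℕ} {q : PP K} : q ∈ wT K n ↔ Ideal.absNorm (pw q : Ideal (𝓞 K)) = n := by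
  simp [wT]

noncomputable def wK (n : ℕ) : ℝ := ∑ q ∈ wT K n, lg q

lemma wK_nonneg (n : ℕ) : 0 ≤ wK K n := Finset.sum_nonneg fun q _ => lg_nonneg q

variable {K} in
lemma absNorm_primePow (P : HeightOneSpectrum (𝓞 K)) : IsPrimePow (Ideal.absNorm P.asIdeal) := by
  have := P.isMaximal
  have h2 := two_le_nm P
  have hne : Ideal.absNorm P.asIdeal ≠ 0 := by
    intro h
    simp [nm, pN, h] at h2
    linarith
  rw [Ideal.absNorm_apply, Submodule.cardQuot_apply] at hne ⊢
  letI := Ideal.Quotient.field P.asIdeal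
  have : Finite (𝓞 K ⧸ P.asIdeal) := Nat.finite_of_card_ne_zero hne
  letI := Fintype.ofFinite (𝓞 K ⧸ P.asIdeal)
  have := FiniteField.isPrimePow_card (𝓞 K ⧸ P.asIdeal)
  rw [Fintype.card_eq_nat_card] at this
  exact this

variable {K} in
lemma absNorm_pw (q : PP K) : Ideal.absNorm (pw q : Ideal (𝓞 K)) = Ideal.absNorm q.1.asIdeal ^ (q.2+1) := by
  simp [pw, pN]

lemma wK_le (n : ℕ) : wK K n ≤ dd K * Λ n := by
  classical
  rcases (wT K n).eq_empty_or_nonempty with h | ⟨q0, h0⟩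
  · rw [wK, h, Finset.sum_empty]
    exact mul_nonneg (dd_pos K).le ArithmeticFunction.vonMangoldt_nonneg
  rw [mem_wT, absNorm_pw] at h0
  obtain ⟨p, j, hp, hj, hpj⟩ := (isPrimePow_nat_iff _).mp ((absNorm_primePow q0.1).pow (k := q0.2+1) (by omega))
  rw [h0] at hpj
  have hΛ : Λ n = Real.log p := by
    rw [← hpj, ArithmeticFunction.vonMangoldt_apply_pow hj.ne', ArithmeticFunction.vonMangoldt_apply_prime hp]
  have hinj : Set.InjOn (fun q : PP K => q.1) (wT K n) := by
    rintro ⟨P, k⟩ hq ⟨Q, l⟩ hq' h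
    simp only at h
    subst h
    rw [Finset.mem_coe, mem_wT] at hq hq'
    have h4 : nm (pN P) ^ (k + 1) = nm (pN P) ^ (l + 1) := by
      rw [← hq', absNorm_pw, absNorm_pw] at hq
      simp only [nm, pN]
      exact_mod_cast hq
    have h5 := pow_right_injective₀ (nm_pos _) (by linarith [two_le_nm P]) h4
    simp only [Prod.mk.injEq, true_and]; omega
  have hmem : ∀ q ∈ wT K n, ((p : ℕ) : 𝓞 K) ∈ q.1.asIdeal := by
    intro q hq
    rw [mem_wT] at hq
    have h1 := Ideal.absNorm_mem (pw q : Ideal (𝓞 K))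
    rw [hq, ← hpj] at h1
    have h2 : (pw q : Ideal (𝓞 K)) ≤ q.1.asIdeal := by
      have : (pw q : Ideal (𝓞 K)) = q.1.asIdeal ^ (q.2+1) := by simp [pw, pN]
      rw [this]; exact Ideal.pow_le_self (by omega)
    have h3 := h2 h1
    push_cast at h3
    exact q.1.isPrime.mem_of_pow_mem _ h3
  set T := (wT K n).image (fun q => q.1)
  have hdvd : ∏ P ∈ T, P.asIdeal ∣ Ideal.span {((p : ℕ) : 𝓞 K)} := by
    refine Finset.prod_dvd_of_isRelPrime ?_ ?_
    · intro P _ Q _ hPQ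
      have h1 := P.isMaximal
      have h2 := Q.isMaximal
      have := Ideal.isCoprime_of_isMaximal (I := P.asIdeal) (J := Q.asIdeal)
        (fun h => hPQ (by ext1; exact h))
      exact this.isRelPrime
    · intro P hP
      obtain ⟨q, hq, rfl⟩ := Finset.mem_image.mp hP
      exact Ideal.dvd_span_singleton.mpr (hmem q hq)
  have hN : Ideal.absNorm (Ideal.span {((p : ℕ) : 𝓞 K)}) = p ^ finrank ℚ K := by
    rw [Ideal.absNorm_span_singleton]
    have := Algebra.norm_algebraMap (R := ℤ) (S := 𝓞 K) (p : ℤ)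
    rw [map_natCast] at this
    rw [this, Int.natAbs_pow, Int.natAbs_natCast, RingOfIntegers.rank]
  have h6 : (∏ P ∈ T, nm (pN P)) ≤ (p:ℝ) ^ finrank ℚ K := by
    have := Nat.le_of_dvd (pow_pos hp.pos _) (hN ▸ map_dvd Ideal.absNorm hdvd)
    rw [map_prod] at this
    simp only [nm, pN]
    exact_mod_cast this
  rw [hΛ, wK]
  calc ∑ q ∈ wT K n, lg q = ∑ P ∈ T, Real.log (nm (pN P)) := by
        rw [Finset.sum_image hinj]; rfl
    _ = Real.log (∏ P ∈ T, nm (pN P)) := (Real.log_prod (fun P _ => (nm_pos _).ne')).symm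
    _ ≤ Real.log ((p:ℝ) ^ finrank ℚ K) := Real.log_le_log (Finset.prod_pos fun P _ => nm_pos _) h6
    _ = _ := by rw [Real.log_pow]; rfl

end PIT

end

section
open MeasureTheory Filter Topology Set Module NumberField IsDedekindDomain
open scoped nonZeroDivisors NNReal ArithmeticFunction.vonMangoldt

namespace PIT

variable (K : Type*) [Field K] [NumberField K]

noncomputable def psK (x : ℝ) : ℝ := ∑ k ∈ Finset.Icc 1 ⌊x⌋₊, wK K k

lemma psK_nonneg (x : ℝ) : 0 ≤ psK K x := Finset.sum_nonneg fun n _ => wK_nonneg K n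

lemma psK_mono : Monotone (psK K) := by
  intro x y h
  refine Finset.sum_le_sum_of_subset_of_nonneg ?_ fun n _ _ => wK_nonneg K n
  exact Finset.Icc_subset_Icc le_rfl (Nat.floor_mono h)

lemma psK_le {x : ℝ} (hx : 0 ≤ x) : psK K x ≤ dd K * (Real.log 4 + 4) * x := by
  calc psK K x ≤ ∑ k ∈ Finset.Icc 1 ⌊x⌋₊, dd K * Λ k := Finset.sum_le_sum fun n _ => wK_le K n
    _ = dd K * Chebyshev.psi x := by
      rw [← Finset.mul_sum, Chebyshev.psi]; rfl
    _ ≤ dd K * ((Real.log 4 + 4) * x) :=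
      mul_le_mul_of_nonneg_left (Chebyshev.psi_le_const_mul_self hx) (dd_pos K).le
    _ = _ := by ring

lemma LK_eq {s : ℂ} (hs : 1 < s.re) : LK K s = LSeries (fun n => (wK K n : ℂ)) s := by
  have h := (LK_summable_norm (K := K) hs).of_norm.hasSum
  have h2 := (h.tsum_fiberwise (fun q : PP K => Ideal.absNorm (pw q : Ideal (𝓞 K)))).tsum_eq
  rw [LK, ← h2, LSeries]
  congr 1
  ext n
  have hset : (fun q : PP K => Ideal.absNorm (pw q : Ideal (𝓞 K))) ⁻¹' {n} = ↑(wT K n) := by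
    ext q; simp [mem_wT]
  rw [hset, Finset.tsum_subtype' (wT K n) (fun q : PP K => (lg q : ℂ) * ((nm (pw q) : ℝ) : ℂ) ^ (-s))]
  have hterm : ∀ q ∈ wT K n, (lg q : ℂ) * ((nm (pw q) : ℝ) : ℂ) ^ (-s) = lg q * (n:ℂ)^(-s) := by
    intro q hq
    rw [mem_wT] at hq
    simp only [nm, hq]; push_cast; rfl
  rw [Finset.sum_congr rfl hterm, ← Finset.sum_mul, LSeries.term_def]
  split_ifs with h0
  · subst h0
    have : wT K 0 = ∅ := by
      ext q
      rw [mem_wT]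
      have := nm_pos (pw q)
      simp only [nm] at this
      have : 0 < Ideal.absNorm (pw q : Ideal (𝓞 K)) := by exact_mod_cast this
      simp only [Finset.notMem_empty, iff_false]
      exact this.ne'
    rw [this]; simp
  · rw [Complex.cpow_neg, div_eq_mul_inv, wK]; push_cast; rfl

lemma lap_meas (ψ : ℝ → ℝ) (hm : Monotone ψ) (h0 : ∀ u, 0 ≤ ψ u) (M : ℝ) (hM : ∀ u, ψ u ≤ M * Real.exp u)
    {s : ℂ} (hs : 0 < s.re) :
    IntegrableOn (fun u : ℝ => ((ψ u * Real.exp (-u) : ℝ) : ℂ) * Complex.exp (-s * u)) (Ioi 0) := by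
  have hexp : IntegrableOn (fun u : ℝ => Complex.exp (-s * u)) (Ioi 0) := by
    exact integrableOn_exp_mul_complex_Ioi (by simpa using hs) 0
  refine hexp.bdd_mul (c := M) ?_ ?_
  · exact (Complex.measurable_ofReal.comp (hm.measurable.mul (by fun_prop))).aestronglyMeasurable
  · refine Eventually.of_forall fun u => ?_
    rw [Complex.norm_real, Real.norm_eq_abs, abs_of_nonneg (mul_nonneg (h0 u) (Real.exp_pos _).le)]
    calc ψ u * Real.exp (-u) ≤ M * Real.exp u * Real.exp (-u) :=
          mul_le_mul_of_nonneg_right (hM u) (Real.exp_pos _).le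
      _ = M := by rw [mul_assoc, ← Real.exp_add]; simp

theorem psK_asymp : Tendsto (fun u => psK K (Real.exp u) * Real.exp (-u)) atTop (𝓝 1) := by
  obtain ⟨H, hH, hLK⟩ := LK_cont K
  set M := dd K * (Real.log 4 + 4)
  have hmono : Monotone fun u => psK K (Real.exp u) := (psK_mono K).comp Real.exp_monotone
  have h0 : ∀ u, 0 ≤ psK K (Real.exp u) := fun u => psK_nonneg K _
  have hM : ∀ u, psK K (Real.exp u) ≤ M * Real.exp u := fun u => psK_le K (Real.exp_pos u).le
  refine tauber (fun u => psK K (Real.exp u)) hmono h0 M hM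
    (fun s => -(1 + H (s + 1)) / (s + 1)) ?_ ?_
  · refine ContinuousOn.div ?_ (by fun_prop) ?_
    · refine (continuousOn_const.add ?_).neg
      refine hH.comp (by fun_prop) ?_
      intro s hs
      have hs : 0 ≤ s.re := hs
      show 1 ≤ (s+1).re
      simp; exact hs
    · intro s hs h
      have hs : 0 ≤ s.re := hs
      have := congrArg Complex.re h
      simp at this
      linarith
  · intro s hs
    have hi := lap_meas _ hmono h0 M hM hs
    have hexp : IntegrableOn (fun u : ℝ => Complex.exp (-s * u)) (Ioi 0) :=
      integrableOn_exp_mul_complex_Ioi (by simpa using hs) 0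
    have hs0 : s ≠ 0 := fun h => by simp [h] at hs
    have hs1 : s + 1 ≠ 0 := fun h => by
      have := congrArg Complex.re h
      simp at this
      linarith
    have hre : 1 < (s+1).re := by simp; exact hs
    have hO : (fun n : ℕ => ∑ k ∈ Finset.Icc 1 n, wK K k) =O[atTop] fun n : ℕ => (n : ℝ) ^ (1:ℝ) := by
      refine Asymptotics.IsBigO.of_bound M (Eventually.of_forall fun n => ?_)
      rw [Real.norm_eq_abs, abs_of_nonneg (Finset.sum_nonneg fun n _ => wK_nonneg K n), Real.rpow_one,
        Real.norm_eq_abs, abs_of_nonneg (by positivity)]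
      have := psK_le K (x := n) (by positivity)
      rw [psK, Nat.floor_natCast] at this
      exact this
    have hIntegr := LSeries_eq_mul_integral_of_nonneg (wK K) zero_le_one hre hO (wK_nonneg K)
    rw [← LK_eq K hre, hLK _ hre] at hIntegr
    have himg : Real.exp '' Ioi 0 = Ioi 1 := by
      ext x; constructor
      · rintro ⟨u, hu, rfl⟩; exact Real.one_lt_exp_iff.mpr hu
      · intro hx
        have hx : 1 < x := hx
        exact ⟨Real.log x, Real.log_pos hx, Real.exp_log (by linarith)⟩
    rw [← himg, integral_image_eq_integral_abs_deriv_smul measurableSet_Ioi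
      (fun x _ => (Real.hasDerivAt_exp x).hasDerivWithinAt) Real.exp_injective.injOn] at hIntegr
    have hI : ∫ u in Ioi (0:ℝ), |Real.exp u| • ((∑ k ∈ Finset.Icc 1 ⌊Real.exp u⌋₊, (wK K k : ℂ)) * ((Real.exp u : ℝ) : ℂ) ^ (-(s + 1 + 1)))
        = ∫ u in Ioi (0:ℝ), ((psK K (Real.exp u) * Real.exp (-u) : ℝ) : ℂ) * Complex.exp (-s * u) := by
      refine integral_congr_ae (Eventually.of_forall fun u => ?_)
      simp only [psK]
      rw [Complex.cpow_def_of_ne_zero (by exact_mod_cast (Real.exp_pos u).ne'), ← Complex.ofReal_log (Real.exp_pos u).le,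
        Real.log_exp, abs_of_pos (Real.exp_pos u), Complex.real_smul]
      push_cast
      have : Complex.exp (↑u * -(s + 1 + 1)) = Complex.exp (-(u:ℂ)) * Complex.exp (-(u:ℂ)) * Complex.exp (-s * u) := by
        rw [← Complex.exp_add, ← Complex.exp_add]; congr 1; ring
      rw [this]
      have h2 : Complex.exp u * Complex.exp (-(u:ℂ)) = 1 := by rw [← Complex.exp_add]; simp
      linear_combination (∑ k ∈ Finset.Icc 1 ⌊Real.exp u⌋₊, (wK K k : ℂ)) * Complex.exp (-(u:ℂ)) * Complex.exp (-s * u) * h2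
    rw [hI] at hIntegr
    have hsplit : ∫ u in Ioi (0:ℝ), ((psK K (Real.exp u) * Real.exp (-u) - 1 : ℝ) : ℂ) * Complex.exp (-s * u)
        = (∫ u in Ioi (0:ℝ), ((psK K (Real.exp u) * Real.exp (-u) : ℝ) : ℂ) * Complex.exp (-s * u))
          - ∫ u in Ioi (0:ℝ), Complex.exp (-s * u) := by
      rw [← integral_sub hi hexp]
      refine integral_congr_ae (Eventually.of_forall fun u => ?_)
      simp only []
      push_cast; ring
    rw [hsplit, integral_exp_mul_complex_Ioi (by simpa using hs) 0]
    set I := ∫ u in Ioi (0:ℝ), ((psK K (Real.exp u) * Real.exp (-u) : ℝ) : ℂ) * Complex.exp (-s * u)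
    have : I = (1 / (s + 1 - 1) - H (s + 1)) / (s+1) := by rw [hIntegr]; field_simp
    rw [this]
    simp only [add_sub_cancel_right, Complex.ofReal_zero, mul_zero, Complex.exp_zero]
    field_simp
    ring

theorem psK_asymp' : Tendsto (fun x => psK K x / x) atTop (𝓝 1) := by
  have h := (psK_asymp K).comp Real.tendsto_log_atTop
  refine h.congr' ?_
  filter_upwards [eventually_gt_atTop 0] with x hx
  simp only [Function.comp]
  rw [Real.exp_neg, Real.exp_log hx, div_eq_mul_inv]

end PIT

end

section
open MeasureTheory Filter Topology Set Module NumberField IsDedekindDomain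
open scoped nonZeroDivisors NNReal ArithmeticFunction.vonMangoldt

namespace PIT

variable (K : Type*) [Field K] [NumberField K]

/-- number of degree one primes above `p` (for `p` prime) -/
noncomputable def kK (p : ℕ) : ℕ := (wT K p).card

variable {K} in
lemma mem_wT_prime {p : ℕ} (hp : p.Prime) {q : PP K} (hq : q ∈ wT K p) :
    q.2 = 0 ∧ Ideal.absNorm q.1.asIdeal = p := by
  rw [mem_wT, absNorm_pw] at hq
  have h2 : q.2 = 0 := by
    by_contra h
    exact Nat.Prime.not_prime_pow (x := Ideal.absNorm q.1.asIdeal) (n := q.2 + 1) (by omega) (hq ▸ hp)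
  rw [h2] at hq
  exact ⟨h2, by simpa using hq⟩

variable {K} in
lemma mk_mem_wT {p : ℕ} {P : HeightOneSpectrum (𝓞 K)} (h : Ideal.absNorm P.asIdeal = p) :
    ((P, 0) : PP K) ∈ wT K p := by
  rw [mem_wT, absNorm_pw]; simpa using h

lemma wK_prime {p : ℕ} (hp : p.Prime) : wK K p = kK K p * Real.log p := by
  rw [wK, kK, ← nsmul_eq_mul, ← Finset.sum_const]
  refine Finset.sum_congr rfl fun q hq => ?_
  rw [lg]; congr 1
  simp [nm, pN, (mem_wT_prime hp hq).2]

lemma kK_le {p : ℕ} (hp : p.Prime) : (kK K p : ℝ) ≤ dd K := by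
  have h := wK_le K p
  rw [wK_prime K hp, ArithmeticFunction.vonMangoldt_apply_prime hp] at h
  exact le_of_mul_le_mul_right h (Real.log_pos (by exact_mod_cast hp.one_lt))

lemma kK_exists {p : ℕ} (hp : p.Prime) (h : kK K p ≠ 0) :
    ∃ P : HeightOneSpectrum (𝓞 K), Ideal.absNorm P.asIdeal = p := by
  obtain ⟨q, hq⟩ := Finset.card_ne_zero.mp h
  exact ⟨q.1, (mem_wT_prime hp hq).2⟩

variable {K} in
lemma one_le_kK {p : ℕ} {P : HeightOneSpectrum (𝓞 K)} (h : Ideal.absNorm P.asIdeal = p) : 1 ≤ kK K p :=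
  Finset.card_pos.mpr ⟨_, mk_mem_wT h⟩

variable {K} in
lemma two_le_kK {p : ℕ} {P Q : HeightOneSpectrum (𝓞 K)} (h : Ideal.absNorm P.asIdeal = p)
    (h' : Ideal.absNorm Q.asIdeal = p) (hPQ : P ≠ Q) : 2 ≤ kK K p := by
  have : 1 < (wT K p).card := by
    rw [Finset.one_lt_card]
    exact ⟨_, mk_mem_wT h, _, mk_mem_wT h', fun e => hPQ (congrArg Prod.fst e)⟩
  exact this

noncomputable def thK (x : ℝ) : ℝ := ∑ p ∈ Finset.Ioc 0 ⌊x⌋₊ with p.Prime, kK K p * Real.log p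

theorem thK_asymp : Tendsto (fun x => thK K x / x) atTop (𝓝 1) := by
  have hdiff : ∀ x : ℝ, 1 ≤ x → |psK K x - thK K x| ≤ dd K * (2 * x.sqrt * x.log) := by
    intro x hx
    have h1 : psK K x - thK K x = ∑ n ∈ Finset.Ioc 0 ⌊x⌋₊ with ¬ n.Prime, wK K n := by
      have : psK K x = ∑ n ∈ Finset.Ioc 0 ⌊x⌋₊, wK K n := rfl
      rw [this, ← Finset.sum_filter_add_sum_filter_not _ Nat.Prime, thK]
      rw [Finset.sum_congr rfl (fun p hp => wK_prime K (Finset.mem_filter.mp hp).2)]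
      ring
    have h2 : Chebyshev.psi x - Chebyshev.theta x = ∑ n ∈ Finset.Ioc 0 ⌊x⌋₊ with ¬ n.Prime, Λ n := by
      rw [Chebyshev.psi, ← Finset.sum_filter_add_sum_filter_not _ Nat.Prime, Chebyshev.theta]
      rw [Finset.sum_congr rfl (fun p hp => ArithmeticFunction.vonMangoldt_apply_prime (Finset.mem_filter.mp hp).2)]
      ring
    rw [h1, abs_of_nonneg (Finset.sum_nonneg fun n _ => wK_nonneg K n)]
    calc _ ≤ ∑ n ∈ Finset.Ioc 0 ⌊x⌋₊ with ¬ n.Prime, dd K * Λ n := Finset.sum_le_sum fun n _ => wK_le K n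
      _ = dd K * (Chebyshev.psi x - Chebyshev.theta x) := by rw [← Finset.mul_sum, h2]
      _ ≤ _ := mul_le_mul_of_nonneg_left ((le_abs_self _).trans
          (Chebyshev.abs_psi_sub_theta_le_sqrt_mul_log hx)) (dd_pos K).le
  have hlim : Tendsto (fun x : ℝ => dd K * (2 * (Real.log x / x ^ (1/2:ℝ)))) atTop (𝓝 (dd K * (2 * 0))) := by
    refine ((Tendsto.const_mul _ ?_).const_mul _)
    exact (isLittleO_log_rpow_atTop (by norm_num)).tendsto_div_nhds_zero
  have hz : Tendsto (fun x => psK K x / x - thK K x / x) atTop (𝓝 0) := by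
    refine squeeze_zero_norm' ?_ (by simpa using hlim)
    filter_upwards [eventually_ge_atTop 1] with x hx
    rw [← sub_div, norm_div, Real.norm_eq_abs, Real.norm_eq_abs, abs_of_pos (by linarith : 0 < x), div_le_iff₀ (by linarith)]
    refine (hdiff x hx).trans (le_of_eq ?_)
    rw [← one_div, ← Real.sqrt_eq_rpow]
    have hs : 0 < Real.sqrt x := Real.sqrt_pos.mpr (by linarith)
    have := Real.sq_sqrt (by linarith : 0 ≤ x)
    field_simp
    rw [this]
    ring
  have := (psK_asymp' K).sub hz
  simpa using this

end PIT

end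

section
open MeasureTheory Filter Topology Set Module NumberField IsDedekindDomain
open scoped nonZeroDivisors NNReal ArithmeticFunction.vonMangoldt

namespace PIT

section
variable (K : Type*) [Field K] [NumberField K]
variable {K}

lemma prime_of_hom {p : ℕ} [Fact p.Prime] (φ : 𝓞 K →+* ZMod p) :
    ∃ P : HeightOneSpectrum (𝓞 K), P.asIdeal = RingHom.ker φ ∧ Ideal.absNorm P.asIdeal = p := by
  have hs : Function.Surjective φ := ZMod.ringHom_surjective φ
  have hpr : (RingHom.ker φ).IsPrime := RingHom.ker_isPrime φ
  refine ⟨⟨RingHom.ker φ, hpr, ?_⟩, rfl, ?_⟩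
  · intro h
    have h1 : ((p : ℕ) : 𝓞 K) ∈ RingHom.ker φ := by
      rw [RingHom.mem_ker, map_natCast, ZMod.natCast_self]
    rw [h, Ideal.mem_bot] at h1
    exact (Fact.out : p.Prime).ne_zero (by exact_mod_cast h1)
  · show Ideal.absNorm (RingHom.ker φ) = p
    rw [Ideal.absNorm_apply, Submodule.cardQuot_apply,
      Nat.card_congr (RingHom.quotientKerEquivOfSurjective hs).toEquiv, Nat.card_zmod]

lemma one_le_of_hom {p : ℕ} [Fact p.Prime] (φ : 𝓞 K →+* ZMod p) : 1 ≤ kK K p := by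
  obtain ⟨P, _, h⟩ := prime_of_hom φ
  exact one_le_kK h

lemma two_le_of_hom {p : ℕ} [Fact p.Prime] (φ χ : 𝓞 K →+* ZMod p) (h : φ ≠ χ) : 2 ≤ kK K p := by
  obtain ⟨P, h1, h2⟩ := prime_of_hom φ
  obtain ⟨Q, h3, h4⟩ := prime_of_hom χ
  refine two_le_kK h2 h4 ?_
  rintro rfl
  refine h (RingHom.ext fun x => ?_)
  obtain ⟨n, hn⟩ := ZMod.natCast_zmod_surjective (φ x)
  have : x - (n : 𝓞 K) ∈ RingHom.ker φ := by
    rw [RingHom.mem_ker, map_sub, map_natCast, hn, sub_self]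
  rw [← h1, h3, RingHom.mem_ker, map_sub, map_natCast, sub_eq_zero] at this
  rw [this, hn]

lemma hom_of_kK {p : ℕ} [Fact p.Prime] (h : kK K p ≠ 0) : Nonempty (𝓞 K →+* ZMod p) := by
  obtain ⟨P, hP⟩ := kK_exists K Fact.out h
  rw [Ideal.absNorm_apply, Submodule.cardQuot_apply] at hP
  have : Finite (𝓞 K ⧸ P.asIdeal) := Nat.finite_of_card_ne_zero (by rw [hP]; exact (Fact.out : p.Prime).ne_zero)
  let _ := Fintype.ofFinite (𝓞 K ⧸ P.asIdeal)
  have e := ZMod.ringEquivOfPrime (𝓞 K ⧸ P.asIdeal) Fact.out (by rw [Fintype.card_eq_nat_card, hP])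
  exact ⟨e.symm.toRingHom.comp (Ideal.Quotient.mk P.asIdeal)⟩

end

lemma kQ {p : ℕ} (hp : p.Prime) : kK ℚ p = 1 := by
  have := Fact.mk hp
  refine le_antisymm ?_ ?_
  · have := kK_le ℚ hp
    simp only [dd, finrank_self] at this
    exact_mod_cast this
  · exact one_le_of_hom ((Int.castRingHom (ZMod p)).comp Rat.ringOfIntegersEquiv.toRingHom)

theorem theta_asymp : Tendsto (fun x => Chebyshev.theta x / x) atTop (𝓝 1) := by
  refine (thK_asymp ℚ).congr fun x => ?_
  congr 1
  refine Finset.sum_congr rfl fun p hp => ?_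
  rw [kQ (Finset.mem_filter.mp hp).2]; simp

lemma avg0 (c : ℕ → ℝ) (C : ℝ) (hC : ∀ p, p.Prime → |c p| ≤ C)
    (hT : Tendsto (fun x : ℝ => (∑ p ∈ Finset.Ioc 0 ⌊x⌋₊ with p.Prime, c p * Real.log p) / x) atTop (𝓝 0)) :
    Tendsto (fun n : ℕ => (∑ p ∈ Finset.Ioc 0 n with p.Prime, c p) / Nat.primeCounting n) atTop (𝓝 0) := by
  have hpi : ∀ n : ℕ, (Nat.primeCounting n : ℝ) = ∑ p ∈ Finset.Ioc 0 n with p.Prime, (1:ℝ) := by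
    intro n
    rw [← Nat.primesLE_card_eq_primeCounting, Finset.sum_const, nsmul_eq_mul, mul_one]
    congr 2
    ext p
    simp only [Nat.mem_primesLE, Finset.mem_filter, Finset.mem_Ioc]
    exact ⟨fun h => ⟨⟨h.2.pos, h.1⟩, h.2⟩, fun h => ⟨h.1.2, h.2⟩⟩
  set T : ℝ → ℝ := fun x => ∑ p ∈ Finset.Ioc 0 ⌊x⌋₊ with p.Prime, c p * Real.log p
  obtain ⟨B, hB⟩ := Chebyshev.primeCounting_sub_theta_div_log_isBigO.bound
  have hC0 : 0 ≤ C := (abs_nonneg _).trans (hC 2 Nat.prime_two)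
  -- limit of the majorant
  have h1 : Tendsto (fun x : ℝ => |T x / x| / (Chebyshev.theta x / x) + C * (B * (Real.log x)⁻¹ / (Chebyshev.theta x / x)))
      atTop (𝓝 (|0| / 1 + C * (B * 0 / 1))) := by
    refine (hT.abs.div theta_asymp one_ne_zero).add (Tendsto.const_mul _ (Tendsto.div (Tendsto.const_mul _ ?_) theta_asymp one_ne_zero))
    exact tendsto_inv_atTop_zero.comp Real.tendsto_log_atTop
  have h1' := h1.comp (tendsto_natCast_atTop_atTop (R := ℝ))
  simp only [abs_zero, zero_div, mul_zero, add_zero] at h1'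
  refine squeeze_zero_norm' ?_ h1'
  filter_upwards [tendsto_natCast_atTop_atTop.eventually hB, eventually_ge_atTop 3] with n hn hn3
  simp only [Function.comp]
  have hx : (3:ℝ) ≤ n := by exact_mod_cast hn3
  set x : ℝ := (n : ℝ)
  have hl : 0 < Real.log x := Real.log_pos (by linarith)
  have hth : 0 < Chebyshev.theta x := Chebyshev.theta_pos (by linarith)
  have hfl : ⌊x⌋₊ = n := Nat.floor_natCast n
  rw [hfl, Real.norm_eq_abs, Real.norm_eq_abs, abs_of_pos (by positivity : 0 < x / Real.log x ^ 2)] at hn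
  have hle : Real.log x * Nat.primeCounting n - Chebyshev.theta x
      = ∑ p ∈ Finset.Ioc 0 n with p.Prime, (Real.log x - Real.log p) := by
    rw [Finset.sum_sub_distrib, Chebyshev.theta, hfl, hpi, Finset.mul_sum]; simp
  have hpos : ∀ p ∈ (Finset.Ioc 0 n).filter Nat.Prime, 0 ≤ Real.log x - Real.log p := by
    intro p hp
    simp only [Finset.mem_filter, Finset.mem_Ioc] at hp
    rw [sub_nonneg]
    exact Real.log_le_log (by exact_mod_cast hp.1.1) (by simp only [x]; exact_mod_cast hp.1.2)
  have hthpi : Chebyshev.theta x / Real.log x ≤ Nat.primeCounting n := by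
    rw [div_le_iff₀ hl]
    have := Finset.sum_nonneg hpos
    rw [← hle] at this
    linarith
  have hpipos : (0:ℝ) < Nat.primeCounting n := lt_of_lt_of_le (by positivity) hthpi
  have hmain : |Real.log x * ∑ p ∈ Finset.Ioc 0 n with p.Prime, c p - T x|
      ≤ C * (Real.log x * Nat.primeCounting n - Chebyshev.theta x) := by
    have : Real.log x * ∑ p ∈ Finset.Ioc 0 n with p.Prime, c p - T x
        = ∑ p ∈ Finset.Ioc 0 n with p.Prime, c p * (Real.log x - Real.log p) := by
      simp only [T]
      rw [hfl, Finset.mul_sum, ← Finset.sum_sub_distrib]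
      exact Finset.sum_congr rfl fun p _ => by ring
    rw [this, hle, Finset.mul_sum]
    refine (Finset.abs_sum_le_sum_abs _ _).trans (Finset.sum_le_sum fun p hp => ?_)
    rw [abs_mul, abs_of_nonneg (hpos p hp)]
    exact mul_le_mul_of_nonneg_right (hC p (Finset.mem_filter.mp hp).2) (hpos p hp)
  have hE : Real.log x * Nat.primeCounting n - Chebyshev.theta x ≤ B * x / Real.log x := by
    have h := (le_abs_self _).trans hn
    have h2 := mul_le_mul_of_nonneg_left h hl.le
    have e1 : Real.log x * (Nat.primeCounting n - Chebyshev.theta x / Real.log x) = Real.log x * Nat.primeCounting n - Chebyshev.theta x := by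
      field_simp
    have e2 : Real.log x * (B * (x / Real.log x ^ 2)) = B * x / Real.log x := by field_simp
    rw [e1, e2] at h2
    exact h2
  have hfin : |Real.log x * ∑ p ∈ Finset.Ioc 0 n with p.Prime, c p| ≤ |T x| + C * (B * x / Real.log x) := by
    have := abs_sub_abs_le_abs_sub (Real.log x * ∑ p ∈ Finset.Ioc 0 n with p.Prime, c p) (T x)
    have h3 := mul_le_mul_of_nonneg_left hE hC0
    linarith
  rw [abs_mul, abs_of_pos hl] at hfin
  rw [Real.norm_eq_abs, abs_div, abs_of_pos hpipos]
  calc |∑ p ∈ Finset.Ioc 0 n with p.Prime, c p| / (Nat.primeCounting n : ℝ)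
      ≤ |∑ p ∈ Finset.Ioc 0 n with p.Prime, c p| / (Chebyshev.theta x / Real.log x) :=
        div_le_div_of_nonneg_left (abs_nonneg _) (by positivity) hthpi
    _ = (Real.log x * |∑ p ∈ Finset.Ioc 0 n with p.Prime, c p|) / Chebyshev.theta x := by field_simp
    _ ≤ (|T x| + C * (B * x / Real.log x)) / Chebyshev.theta x := by gcongr
    _ = _ := by
      rw [abs_div, abs_of_pos (by linarith : 0 < x)]
      have : 0 < x := by linarith
      field_simp

lemma avgK (K : Type*) [Field K] [NumberField K] :
    Tendsto (fun n : ℕ => (∑ p ∈ Finset.Ioc 0 n with p.Prime, ((kK K p : ℝ) - 1)) / Nat.primeCounting n) atTop (𝓝 0) := by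
  refine avg0 (fun p => (kK K p : ℝ) - 1) (dd K + 1) ?_ ?_
  · intro p hp
    have := kK_le K hp
    have h0 : (0:ℝ) ≤ kK K p := by positivity
    rw [abs_le]; constructor <;> linarith [dd_pos K]
  · have := (thK_asymp K).sub theta_asymp
    rw [sub_self] at this
    refine this.congr fun x => ?_
    rw [← sub_div]
    congr 1
    rw [thK, Chebyshev.theta, ← Finset.sum_sub_distrib]
    exact Finset.sum_congr rfl fun p _ => by ring

end PIT

end

section
open Filter Topology Module NumberField

namespace PIT

open scoped Classical in
/-- greedy counting function -/
noncomputable def gN (S : Set ℕ) (D : ℕ → ℝ) : ℕ → ℕ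
  | 0 => 0
  | n + 1 => if n + 1 ∈ S ∧ (gN S D n : ℝ) + 1 ≤ D (n + 1) then gN S D n + 1 else gN S D n

def gS (S : Set ℕ) (D : ℕ → ℝ) : Set ℕ :=
  {n | ∃ k, n = k + 1 ∧ n ∈ S ∧ (gN S D k : ℝ) + 1 ≤ D n}

open scoped Classical in
lemma gN_card (S : Set ℕ) (D : ℕ → ℝ) (n : ℕ) :
    gN S D n = ((Finset.Ioc 0 n).filter (· ∈ gS S D)).card := by
  induction n with
  | zero => simp [gN]
  | succ n ih =>
    have hI : Finset.Ioc 0 (n+1) = insert (n+1) (Finset.Ioc 0 n) := by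
      ext k; simp only [Finset.mem_Ioc, Finset.mem_insert]; omega
    have hm : n + 1 ∈ gS S D ↔ (n + 1 ∈ S ∧ (gN S D n : ℝ) + 1 ≤ D (n + 1)) := by
      constructor
      · rintro ⟨k, hk, h⟩
        have : n = k := by omega
        subst this; exact h
      · intro h; exact ⟨n, rfl, h⟩
    rw [hI, Finset.filter_insert, gN]
    by_cases h : n + 1 ∈ S ∧ (gN S D n : ℝ) + 1 ≤ D (n + 1)
    · rw [if_pos h, if_pos (hm.mpr h), Finset.card_insert_of_notMem (by simp), ih]
    · rw [if_neg h, if_neg (mt hm.mp h), ih]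

lemma gN_le (S : Set ℕ) (D : ℕ → ℝ) (hD : Monotone D) (h0 : D 0 = 0) (n : ℕ) : (gN S D n : ℝ) ≤ D n := by
  induction n with
  | zero => simp [gN, h0]
  | succ n ih =>
    rw [gN]
    split_ifs with h
    · push_cast; exact h.2
    · exact ih.trans (hD (Nat.le_succ n))

open scoped Classical in
lemma gN_ge (S : Set ℕ) (D : ℕ → ℝ) (h0 : D 0 = 0) (a : ℕ → ℝ)
    (ha : ∀ n, a n ≤ if n ∈ S then 1 else 0) (n : ℕ) :
    ∃ y ≤ n, D y - 1 + (∑ k ∈ Finset.Ioc 0 n, a k - ∑ k ∈ Finset.Ioc 0 y, a k) ≤ gN S D n := by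
  induction n with
  | zero => exact ⟨0, le_rfl, by simp [h0, gN]⟩
  | succ n ih =>
    obtain ⟨y, hy, h⟩ := ih
    have hs : ∑ k ∈ Finset.Ioc 0 (n+1), a k = ∑ k ∈ Finset.Ioc 0 n, a k + a (n+1) := by
      rw [Finset.sum_Ioc_succ_top (Nat.zero_le n)]
    have han := ha (n+1)
    by_cases h1 : n + 1 ∈ S
    · rw [if_pos h1] at han
      by_cases h2 : (gN S D n : ℝ) + 1 ≤ D (n + 1)
      · refine ⟨y, by omega, ?_⟩
        rw [gN, if_pos ⟨h1, h2⟩, hs]; push_cast; linarith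
      · refine ⟨n+1, le_rfl, ?_⟩
        rw [gN, if_neg (fun h => h2 h.2)]
        rw [sub_self]; linarith
    · rw [if_neg h1] at han
      refine ⟨y, by omega, ?_⟩
      rw [gN, if_neg (fun h => h1 h.1), hs]; linarith

lemma small_unif (E : ℕ → ℝ) (P : ℕ → ℝ) (hP : Monotone P) (hPt : Tendsto P atTop atTop)
    (hE : Tendsto (fun n => E n / P n) atTop (𝓝 0)) {ε : ℝ} (hε : 0 < ε) :
    ∀ᶠ n in atTop, ∀ y ≤ n, |E y| ≤ ε * P n := by
  have h1 := hE.abs.eventually (gt_mem_nhds (show |(0:ℝ)| < ε by simpa using hε))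
  obtain ⟨N, hN⟩ := (h1.and (hPt.eventually_gt_atTop 0)).exists_forall_of_atTop
  set M := ∑ y ∈ Finset.range N, |E y|
  filter_upwards [hPt.eventually_ge_atTop (M / ε)] with n hn y hy
  by_cases hyN : N ≤ y
  · obtain ⟨h2, h3⟩ := hN y hyN
    rw [abs_div, abs_of_pos h3, div_lt_iff₀ h3] at h2
    exact h2.le.trans (mul_le_mul_of_nonneg_left (hP hy) hε.le)
  · have : |E y| ≤ M := Finset.single_le_sum (f := fun y => |E y|) (fun i _ => abs_nonneg _) (Finset.mem_range.mpr (by omega))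
    rw [div_le_iff₀ hε] at hn
    linarith

open scoped Classical in
lemma greedy (S : Set ℕ) (a : ℕ → ℝ) (ha : ∀ n, a n ≤ if n ∈ S then 1 else 0) (δ : ℝ) (hδ : 0 ≤ δ)
    (P : ℕ → ℝ) (hP : Monotone P) (hP0 : P 0 = 0) (hPt : Tendsto P atTop atTop)
    (hA : Tendsto (fun n => (∑ k ∈ Finset.Ioc 0 n, a k - δ * P n) / P n) atTop (𝓝 0)) :
    ∃ S' ⊆ S, Tendsto (fun n : ℕ => (((Finset.Ioc 0 n).filter (· ∈ S')).card : ℝ) / P n) atTop (𝓝 δ) := by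
  set D : ℕ → ℝ := fun n => δ * P n with hDdef
  have hD : Monotone D := fun i j h => mul_le_mul_of_nonneg_left (hP h) hδ
  have hD0 : D 0 = 0 := by simp [D, hP0]
  refine ⟨gS S D, ?_, ?_⟩
  · rintro n ⟨k, _, h, _⟩; exact h
  rw [Metric.tendsto_nhds]
  intro ε hε
  have hsm := small_unif _ P hP hPt hA (show 0 < ε / 4 by linarith)
  filter_upwards [hsm, hPt.eventually_gt_atTop (4 / ε)] with n hn hn2
  have hPn : 0 < P n := lt_trans (by positivity) hn2
  rw [← gN_card, Real.dist_eq]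
  have hub := gN_le S D hD hD0 n
  obtain ⟨y, hy, hlb⟩ := gN_ge S D hD0 a ha n
  have e1 := abs_le.mp (hn y hy)
  have e2 := abs_le.mp (hn n le_rfl)
  rw [div_lt_iff₀ hε] at hn2
  have : |(gN S D n : ℝ) / P n - δ| = |gN S D n - δ * P n| / P n := by
    rw [← abs_of_pos hPn, ← abs_div, abs_of_pos hPn]; congr 1; field_simp
  rw [this, div_lt_iff₀ hPn, abs_lt]
  simp only [D] at hub hlb
  constructor <;> nlinarith

theorem dens (K L : Type*) [Field K] [NumberField K] [Field L] [NumberField L] (S : Set ℕ) (p0 : ℕ)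
    (hS : ∀ p ∈ S, p.Prime) (h2 : ∀ p, p.Prime → p0 ≤ p → kK L p ≠ 0 → 2 ≤ kK K p)
    (h1 : ∀ p, p.Prime → p0 ≤ p → p ∉ S → 1 ≤ kK K p) :
    ∃ S' ⊆ S, Tendsto (fun x : ℕ => (Nat.card {p : ℕ // p ≤ x ∧ p ∈ S'} : ℝ) /
      (Nat.card {p : ℕ // p ≤ x ∧ p.Prime} : ℝ)) atTop (𝓝 (1 / dd L)) := by
  classical
  have hd := dd_pos L
  let b : ℕ → ℝ := fun p => 1 / dd L - ((kK K p : ℝ) - 1) + ((kK L p : ℝ) - 1) / dd L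
  let a : ℕ → ℝ := fun p => if p.Prime ∧ p0 ≤ p then b p else 0
  have ha : ∀ n, a n ≤ if n ∈ S then 1 else 0 := by
    intro p
    simp only [a]
    by_cases hp : p.Prime ∧ p0 ≤ p
    · rw [if_pos hp]
      have hb : b p = 1 - kK K p + kK L p / dd L := by simp only [b]; field_simp; ring
      have hle : (kK L p : ℝ) / dd L ≤ 1 := by rw [div_le_one hd]; exact kK_le L hp.1
      have h2' := h2 p hp.1 hp.2
      have h1' := h1 p hp.1 hp.2
      rw [hb]
      by_cases h0 : kK L p = 0
      · rw [h0]
        split_ifs with hs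
        · have : (0:ℝ) ≤ kK K p := by positivity
          simp
        · have : (1:ℝ) ≤ kK K p := by exact_mod_cast h1' hs
          simp; exact h1' hs
      · have : (2:ℝ) ≤ kK K p := by exact_mod_cast h2' h0
        split_ifs <;> linarith
    · rw [if_neg hp]; split_ifs <;> norm_num
  have hcardP : ∀ n : ℕ, (Nat.card {p : ℕ // p ≤ n ∧ p.Prime} : ℝ) = Nat.primeCounting n := by
    intro n
    rw [← Nat.primesLE_card_eq_primeCounting]
    congr 1
    rw [← Nat.card_eq_finsetCard]
    refine Nat.card_congr (Equiv.subtypeEquivRight fun p => ?_)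
    rw [Nat.mem_primesLE]
  have hpiT : Tendsto (fun n : ℕ => (Nat.primeCounting n : ℝ)) atTop atTop :=
    tendsto_natCast_atTop_atTop.comp Nat.tendsto_primeCounting
  have hpi : ∀ n : ℕ, (Nat.primeCounting n : ℝ) = ∑ p ∈ Finset.Ioc 0 n with p.Prime, (1:ℝ) := by
    intro n
    rw [← Nat.primesLE_card_eq_primeCounting, Finset.sum_const, nsmul_eq_mul, mul_one]
    congr 2
    ext p
    simp only [Nat.mem_primesLE, Finset.mem_filter, Finset.mem_Ioc]
    exact ⟨fun h => ⟨⟨h.2.pos, h.1⟩, h.2⟩, fun h => ⟨h.1.2, h.2⟩⟩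
  have hA : Tendsto (fun n => (∑ k ∈ Finset.Ioc 0 n, a k - 1 / dd L * Nat.primeCounting n) / (Nat.primeCounting n : ℝ)) atTop (𝓝 0) := by
    have hB : Tendsto (fun n => (∑ k ∈ Finset.Ioc 0 n with k.Prime, b k - 1 / dd L * Nat.primeCounting n) / (Nat.primeCounting n : ℝ)) atTop (𝓝 0) := by
      have := ((avgK L).const_mul (1 / dd L)).sub (avgK K)
      rw [mul_zero, sub_zero] at this
      refine this.congr fun n => ?_
      rw [mul_div_assoc', ← sub_div]
      congr 1
      rw [hpi, Finset.mul_sum, Finset.mul_sum, ← Finset.sum_sub_distrib, ← Finset.sum_sub_distrib]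
      exact Finset.sum_congr rfl fun p _ => by simp only [b]; ring
    have hc : Tendsto (fun n : ℕ => (∑ k ∈ Finset.Ico 1 p0 with k.Prime, b k) / (Nat.primeCounting n : ℝ)) atTop (𝓝 0) :=
      hpiT.const_div_atTop _
    have := hB.sub hc
    rw [sub_zero] at this
    refine this.congr' ?_
    filter_upwards [eventually_ge_atTop p0] with n hn
    rw [← sub_div]
    congr 1
    have : ∑ k ∈ Finset.Ioc 0 n, a k + ∑ k ∈ Finset.Ico 1 p0 with k.Prime, b k = ∑ k ∈ Finset.Ioc 0 n with k.Prime, b k := by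
      have hsub : Finset.Ico 1 p0 ⊆ Finset.Ioc 0 n := by
        intro k; simp only [Finset.mem_Ico, Finset.mem_Ioc]; omega
      rw [Finset.sum_filter, Finset.sum_filter]
      have : ∑ k ∈ Finset.Ico 1 p0, (if k.Prime then b k else 0) = ∑ k ∈ Finset.Ioc 0 n, (if k.Prime ∧ ¬ p0 ≤ k then b k else 0) := by
        rw [← Finset.sum_subset hsub (f := fun k => if k.Prime ∧ ¬ p0 ≤ k then b k else 0)]
        · refine Finset.sum_congr rfl fun k hk => ?_
          have : ¬ p0 ≤ k := by have := Finset.mem_Ico.mp hk; omega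
          simp [this]
        · intro k hk hk2
          rw [Finset.mem_Ioc] at hk
          rw [Finset.mem_Ico] at hk2
          rw [if_neg]; rintro ⟨_, h⟩; omega
      rw [this, ← Finset.sum_add_distrib]
      refine Finset.sum_congr rfl fun k _ => ?_
      simp only [a]
      by_cases q1 : k.Prime <;> by_cases q2 : p0 ≤ k <;> simp [q1, q2]
    linarith
  obtain ⟨S', hS', hlim⟩ := greedy S a ha (1 / dd L) (by positivity) (fun n => (Nat.primeCounting n : ℝ))
    (fun i j h => Nat.cast_le.mpr (Nat.monotone_primeCounting h)) (by simp) hpiT hA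
  refine ⟨S', hS', hlim.congr fun n => ?_⟩
  rw [hcardP]
  congr 2
  rw [← Nat.card_eq_finsetCard]
  refine Nat.card_congr (Equiv.subtypeEquivRight fun p => ?_)
  simp only [Finset.mem_filter, Finset.mem_Ioc]
  exact ⟨fun h => ⟨h.1.2, h.2⟩, fun h => ⟨⟨(hS p (hS' h.2)).pos, h.1⟩, h.2⟩⟩

end PIT

end

section
open Filter Topology Module NumberField Polynomial

namespace PIT

section local_part
variable {p : ℕ} [hpF : Fact p.Prime]

lemma toZMod_aeval (G : ℤ[X]) (t : ℤ_[p]) : PadicInt.toZMod (aeval t G) = aeval (PadicInt.toZMod t) G := by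
  rw [aeval_def, aeval_def, hom_eval₂]
  congr 1
  exact RingHom.ext_int _ _

lemma norm_one_of_toZMod {z : ℤ_[p]} (h : PadicInt.toZMod z ≠ 0) : ‖z‖ = 1 := by
  rw [← PadicInt.isUnit_iff]
  by_contra hz
  apply h
  rw [← RingHom.mem_ker, PadicInt.ker_toZMod]
  exact (IsLocalRing.mem_maximalIdeal z).mpr hz

lemma coe_aeval (G : ℤ[X]) (t : ℤ_[p]) : ((aeval t G : ℤ_[p]) : ℚ_[p]) = aeval (t : ℚ_[p]) G := by
  have := aeval_algebraMap_apply ℚ_[p] t G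
  exact this.symm

variable (f : ℤ[X])

lemma norm_even (heven : Even f.natDegree) (hlc : ¬ (p : ℤ) ∣ f.leadingCoeff)
    (hroot : ∀ r : ZMod p, aeval r f ≠ 0) (x : ℚ_[p]) : ∃ k : ℤ, ‖aeval x f‖ = (p : ℝ) ^ (2 * k) := by
  by_cases hx : ‖x‖ ≤ 1
  · refine ⟨0, ?_⟩
    obtain ⟨t, ht⟩ : ∃ t : ℤ_[p], (t : ℚ_[p]) = x := ⟨⟨x, hx⟩, rfl⟩
    have h := norm_one_of_toZMod (z := aeval t f) (by rw [toZMod_aeval]; exact hroot _)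
    have h2 := coe_aeval f t
    rw [PadicInt.norm_def, h2, ht] at h
    simpa using h
  · push Not at hx
    have hx0 : x ≠ 0 := by rintro rfl; simp at hx; linarith
    have hinv : ‖x⁻¹‖ < 1 := by rw [norm_inv]; exact inv_lt_one_of_one_lt₀ hx
    let _ : Invertible x := invertibleOfNonzero hx0
    have hrev := eval₂_reverse_mul_pow (algebraMap ℤ ℚ_[p]) x f
    rw [invOf_eq_inv] at hrev
    obtain ⟨t, ht⟩ : ∃ t : ℤ_[p], (t : ℚ_[p]) = x⁻¹ := ⟨⟨x⁻¹, hinv.le⟩, rfl⟩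
    have h := norm_one_of_toZMod (z := aeval t f.reverse) (by
      rw [toZMod_aeval]
      have : PadicInt.toZMod t = 0 := by
        rw [← RingHom.mem_ker, PadicInt.ker_toZMod]
        refine (IsLocalRing.mem_maximalIdeal _).mpr ?_
        rw [mem_nonunits_iff, PadicInt.not_isUnit_iff, PadicInt.norm_def, ht]
        exact hinv
      rw [this, aeval_def, eval₂_at_zero, coeff_zero_reverse]
      intro h0
      apply hlc
      rw [← ZMod.intCast_zmod_eq_zero_iff_dvd]
      simpa using h0)
    have h2 := coe_aeval f.reverse t
    rw [PadicInt.norm_def, h2, aeval_def, ht] at h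
    obtain ⟨m, hm⟩ := heven
    refine ⟨-x.valuation * m, ?_⟩
    rw [aeval_def, ← hrev, norm_mul, h, one_mul, norm_pow, Padic.norm_eq_zpow_neg_valuation hx0,
      ← zpow_natCast, ← zpow_mul]
    congr 1
    rw [hm]; push_cast; ring

lemma zp_inj {a b : ℤ} (h : (p : ℝ) ^ a = (p : ℝ) ^ b) : a = b :=
  zpow_right_injective₀ (by exact_mod_cast hpF.out.pos) (by exact_mod_cast hpF.out.one_lt.ne') h

theorem local_obs (heven : Even f.natDegree) (hlc : ¬ (p : ℤ) ∣ f.leadingCoeff)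
    (hroot : ∀ r : ZMod p, aeval r f ≠ 0) :
    (¬ ∃ x y : ℚ_[p], (p : ℚ_[p]) * y ^ 2 = aeval x f) ∧
    (¬ ∃ z : ℚ_[p], z ^ 2 = (f.leadingCoeff : ℚ_[p]) / (p : ℚ_[p])) ∧
    (¬ ∃ x y : ℚ, (p : ℚ) * y ^ 2 = aeval x f) := by
  have hp0 : (p : ℝ) ≠ 0 := by exact_mod_cast hpF.out.ne_zero
  have A : ¬ ∃ x y : ℚ_[p], (p : ℚ_[p]) * y ^ 2 = aeval x f := by
    rintro ⟨x, y, h⟩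
    obtain ⟨k, hk⟩ := norm_even f heven hlc hroot x
    rw [← h, norm_mul, norm_pow, Padic.norm_p] at hk
    by_cases hy : y = 0
    · rw [hy] at hk
      simp only [norm_zero, ne_eq, OfNat.ofNat_ne_zero, not_false_eq_true, zero_pow, mul_zero] at hk
      exact (zpow_ne_zero _ hp0) hk.symm
    · rw [Padic.norm_eq_zpow_neg_valuation hy, ← zpow_natCast, ← zpow_mul, ← zpow_neg_one, ← zpow_add₀ hp0] at hk
      have := zp_inj hk
      push_cast at this
      omega
  refine ⟨A, ?_, ?_⟩
  · rintro ⟨z, hz⟩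
    have h1 : ‖(f.leadingCoeff : ℚ_[p])‖ = 1 := by
      refine le_antisymm (Padic.norm_int_le_one _) (not_lt.mp fun h => hlc ?_)
      exact (Padic.norm_intCast_lt_one_iff).mp h
    have h2 := congrArg norm hz
    rw [norm_div, h1, Padic.norm_p, norm_pow, one_div, inv_inv] at h2
    by_cases hz0 : z = 0
    · rw [hz0] at h2
      simp at h2
      exact hp0 h2.symm
    · rw [Padic.norm_eq_zpow_neg_valuation hz0, ← zpow_natCast, ← zpow_mul] at h2
      have h3 : (p : ℝ) ^ (-z.valuation * ((2:ℕ):ℤ)) = (p:ℝ) ^ (1:ℤ) := by rw [h2, zpow_one]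
      have := zp_inj h3
      push_cast at this
      omega
  · rintro ⟨x, y, h⟩
    refine A ⟨(x : ℚ_[p]), (y : ℚ_[p]), ?_⟩
    have h2 := congrArg (fun t : ℚ => (t : ℚ_[p])) h
    have h3 : ((aeval x f : ℚ) : ℚ_[p]) = aeval (x : ℚ_[p]) f :=
      (aeval_algebraMap_apply ℚ_[p] x f).symm
    rw [← h3, ← h2]; push_cast; rfl

/-- Hensel -/
lemma hensel_root {c : ℤ} (U V : ℤ[X]) (hUV : U * f + V * derivative f = C c) (hc : ¬ (p : ℤ) ∣ c)
    (r : ZMod p) (hr : aeval r f = 0) : ∃ z : ℤ_[p], aeval z f = 0 := by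
  obtain ⟨n, hn⟩ := ZMod.natCast_zmod_surjective r
  set a : ℤ_[p] := (n : ℤ_[p])
  have ha : PadicInt.toZMod a = r := by rw [map_natCast, hn]
  have h1 : ‖aeval a f‖ < 1 := by
    rw [← PadicInt.not_isUnit_iff, ← mem_nonunits_iff, ← IsLocalRing.mem_maximalIdeal, ← PadicInt.ker_toZMod,
      RingHom.mem_ker, toZMod_aeval, ha, hr]
  have h2 : ‖aeval a (derivative f)‖ = 1 := by
    apply norm_one_of_toZMod
    rw [toZMod_aeval, ha]
    intro h
    have h3 := congrArg (aeval r) hUV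
    rw [map_add, map_mul, map_mul, hr, h, mul_zero, mul_zero, add_zero, aeval_C] at h3
    apply hc
    rw [← ZMod.intCast_zmod_eq_zero_iff_dvd]
    simpa using h3.symm
  have e1 : aeval a (f.map (algebraMap ℤ ℤ_[p])) = aeval a f := aeval_map_algebraMap _ _ _
  have e2 : aeval a (derivative (f.map (algebraMap ℤ ℤ_[p]))) = aeval a (derivative f) := by
    rw [derivative_map]; exact aeval_map_algebraMap _ _ _
  obtain ⟨z, hz, _⟩ := hensels_lemma (p := p) (R := ℤ_[p]) (F := f.map (algebraMap ℤ ℤ_[p])) (a := a)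
    (by rw [e1, e2, h2]; simpa using h1)
  exact ⟨z, by rwa [aeval_map_algebraMap] at hz⟩

lemma hom_of_root {K : Type*} [Field K] (ψ : K →+* ℚ_[p]) : Nonempty (𝓞 K →+* ZMod p) := by
  have h : ∀ x : 𝓞 K, ‖ψ (x : K)‖ ≤ 1 := by
    intro x
    have h1 : IsIntegral ℤ (ψ (x : K)) := (RingOfIntegers.isIntegral_coe x).map ψ.toIntAlgHom
    have h2 : IsIntegral ℤ_[p] (ψ (x : K)) := h1.tower_top
    obtain ⟨y, hy⟩ := IsIntegrallyClosed.isIntegral_iff.mp h2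
    rw [← hy]
    exact y.2
  let F : 𝓞 K →+* ℤ_[p] :=
    { toFun := fun x => ⟨ψ (x : K), h x⟩
      map_one' := by apply Subtype.ext; simp
      map_zero' := by apply Subtype.ext; simp
      map_add' := fun x y => by apply Subtype.ext; simp; rfl
      map_mul' := fun x y => by apply Subtype.ext; simp; rfl }
  exact ⟨PadicInt.toZMod.comp F⟩

end local_part
end PIT

end

section
open Filter Topology Module NumberField Polynomial

namespace PIT

lemma two_hom {K L : Type*} [Field K] [NumberField K] [Field L] [NumberField L] (σ τ : K →+* L) (h : σ ≠ τ) :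
    ∃ N : ℕ, ∀ p, p.Prime → N ≤ p → kK L p ≠ 0 → 2 ≤ kK K p := by
  obtain ⟨θ, hθ⟩ : ∃ θ : 𝓞 K, RingOfIntegers.mapRingHom σ θ ≠ RingOfIntegers.mapRingHom τ θ := by
    by_contra hcon
    push Not at hcon
    apply h
    refine IsFractionRing.ringHom_ext (A := 𝓞 K) fun x => ?_
    have := congrArg (fun y : 𝓞 L => (y : L)) (hcon x)
    exact this
  set η := RingOfIntegers.mapRingHom σ θ - RingOfIntegers.mapRingHom τ θ with hη
  have hη0 : η ≠ 0 := sub_ne_zero.mpr hθ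
  set m := Ideal.absNorm (Ideal.span {η})
  have hm0 : m ≠ 0 := by
    rw [Ne, Ideal.absNorm_eq_zero_iff, Ideal.span_singleton_eq_bot]; exact hη0
  have hmem : ((m : ℕ) : 𝓞 L) ∈ Ideal.span {η} := Ideal.absNorm_mem _
  rw [Ideal.mem_span_singleton] at hmem
  refine ⟨m + 1, fun p hp hpm hk => ?_⟩
  have := Fact.mk hp
  obtain ⟨χ⟩ := hom_of_kK hk
  refine two_le_of_hom (χ.comp (RingOfIntegers.mapRingHom σ)) (χ.comp (RingOfIntegers.mapRingHom τ)) ?_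
  intro he
  have h1 := RingHom.congr_fun he θ
  simp only [RingHom.comp_apply] at h1
  have h2 : χ η = 0 := by rw [hη, map_sub, h1, sub_self]
  have h3 : χ ((m : ℕ) : 𝓞 L) = 0 := by
    obtain ⟨c, hc⟩ := hmem
    rw [hc, map_mul, h2, zero_mul]
  rw [map_natCast, ZMod.natCast_eq_zero_iff] at h3
  have := Nat.le_of_dvd (Nat.pos_of_ne_zero hm0) h3
  omega

lemma bezout (f : ℤ[X]) (hirr : Irreducible (f.map (Int.castRingHom ℚ))) :
    ∃ (U V : ℤ[X]) (c : ℤ), c ≠ 0 ∧ U * f + V * derivative f = C c := by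
  obtain ⟨u, v, huv⟩ := hirr.separable
  obtain ⟨b, hb, hU⟩ := IsLocalization.integerNormalization_spec (nonZeroDivisors ℤ) u
  obtain ⟨d, hd, hV⟩ := IsLocalization.integerNormalization_spec (nonZeroDivisors ℤ) v
  set U := IsLocalization.integerNormalization (nonZeroDivisors ℤ) u
  set V := IsLocalization.integerNormalization (nonZeroDivisors ℤ) v
  have hb0 := nonZeroDivisors.ne_zero hb
  have hd0 := nonZeroDivisors.ne_zero hd
  refine ⟨C d * U, C b * V, b * d, mul_ne_zero hb0 hd0, ?_⟩
  apply map_injective (Int.castRingHom ℚ) Int.cast_injective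
  have hU' : U.map (Int.castRingHom ℚ) = C (b:ℚ) * u := by
    have : algebraMap ℤ ℚ = Int.castRingHom ℚ := rfl
    rw [← this, hU, ← smul_eq_C_mul]
    ext n; simp
  have hV' : V.map (Int.castRingHom ℚ) = C (d:ℚ) * v := by
    have : algebraMap ℤ ℚ = Int.castRingHom ℚ := rfl
    rw [← this, hV, ← smul_eq_C_mul]
    ext n; simp
  simp only [Polynomial.map_add, Polynomial.map_mul, hU', hV', map_C, ← derivative_map]
  simp only [eq_intCast, Int.cast_mul, C_mul]
  linear_combination (C (b:ℚ) * C (d:ℚ)) * huv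

lemma two_emb (g : ℚ[X]) [Fact (Irreducible g)] (hdeg : 2 ≤ g.natDegree) :
    ∃ σ τ : AdjoinRoot g →+* g.SplittingField, σ ≠ τ := by
  have hirr : Irreducible g := Fact.out
  have hsep := hirr.separable
  have hcard := card_rootSet_eq_natDegree hsep (SplittingField.splits g)
  have h1 := (show 1 < g.natDegree by omega)
  rw [← hcard] at h1
  obtain ⟨⟨a, ha⟩, ⟨b, hb⟩, hab⟩ := Fintype.one_lt_card_iff.mp h1
  have ha' := (mem_rootSet.mp ha).2
  have hb' := (mem_rootSet.mp hb).2
  rw [aeval_def] at ha' hb'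
  refine ⟨AdjoinRoot.lift (algebraMap ℚ _) a ha', AdjoinRoot.lift (algebraMap ℚ _) b hb', ?_⟩
  intro h
  have := RingHom.congr_fun h (AdjoinRoot.root g)
  have e1 := AdjoinRoot.lift_root ha'
  have e2 := AdjoinRoot.lift_root hb'
  exact hab (Subtype.ext (e1.symm.trans (this.trans e2)))

theorem final (f : Polynomial ℤ)
    (hirr : Irreducible (f.map (Int.castRingHom ℚ)))
    (heven : Even f.natDegree) (hdeg : 4 ≤ f.natDegree) :
    ∃ S : Set ℕ, (∀ p ∈ S, p.Prime) ∧
      (∃ δ : ℝ, 0 < δ ∧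
        Filter.Tendsto (fun x : ℕ =>
          (Nat.card {p : ℕ // p ≤ x ∧ p ∈ S} : ℝ) /
          (Nat.card {p : ℕ // p ≤ x ∧ p.Prime} : ℝ))
          Filter.atTop (nhds δ)) ∧
      ∀ p ∈ S, ∀ [Fact p.Prime],
        (¬ ∃ x y : ℚ_[p], (p : ℚ_[p]) * y ^ 2 = Polynomial.aeval x f) ∧
        (¬ ∃ z : ℚ_[p], z ^ 2 = (f.leadingCoeff : ℚ_[p]) / (p : ℚ_[p])) ∧
        (¬ ∃ x y : ℚ, (p : ℚ) * y ^ 2 = Polynomial.aeval x f) := by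
  set g := f.map (Int.castRingHom ℚ) with hg
  have hF : Fact (Irreducible g) := ⟨hirr⟩
  have hgdeg : g.natDegree = f.natDegree := natDegree_map_eq_of_injective Int.cast_injective f
  have hK1 : CharZero (AdjoinRoot g) := charZero_of_injective_algebraMap (algebraMap ℚ _).injective
  have hK2 : FiniteDimensional ℚ (AdjoinRoot g) := (AdjoinRoot.powerBasis hirr.ne_zero).finite
  have hK : NumberField (AdjoinRoot g) := { to_charZero := hK1, to_finiteDimensional := hK2 }
  have hL1 : CharZero g.SplittingField := charZero_of_injective_algebraMap (algebraMap ℚ _).injective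
  have hL : NumberField g.SplittingField := { to_charZero := hL1, to_finiteDimensional := inferInstance }
  obtain ⟨σ, τ, hστ⟩ := two_emb g (by omega)
  obtain ⟨N, hN⟩ := two_hom σ τ hστ
  obtain ⟨U, V, c, hc0, hUV⟩ := bezout f hirr
  have hlc0 : f.leadingCoeff ≠ 0 := by
    rw [Ne, leadingCoeff_eq_zero]; rintro rfl; simp at hdeg
  let S : Set ℕ := {p | p.Prime ∧ ¬ (p : ℤ) ∣ f.leadingCoeff ∧ ∀ r : ZMod p, aeval r f ≠ 0}
  have hbig : ∀ (z : ℤ) (p : ℕ), z ≠ 0 → z.natAbs < p → ¬ (p : ℤ) ∣ z := by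
    intro z p hz hp hd
    have := Nat.le_of_dvd (Int.natAbs_pos.mpr hz) (Int.natCast_dvd.mp hd)
    omega
  obtain ⟨S', hS', hlim⟩ := dens (AdjoinRoot g) g.SplittingField S
    (N + f.leadingCoeff.natAbs + c.natAbs + 1) (fun p hp => hp.1)
    (fun p hp h hk => hN p hp (by omega) hk) (by
      intro p hp h hpS
      have := Fact.mk hp
      have h1 := hbig _ p hlc0 (by omega)
      have h2 := hbig _ p hc0 (by omega)
      obtain ⟨r, hr⟩ : ∃ r : ZMod p, aeval r f = 0 := by
        by_contra hcon
        push Not at hcon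
        exact hpS ⟨hp, h1, hcon⟩
      obtain ⟨z, hz⟩ := hensel_root f U V hUV h2 r hr
      have hz2 : eval₂ (algebraMap ℚ ℚ_[p]) (z : ℚ_[p]) g = 0 := by
        have h3 := coe_aeval f z
        rw [hz, aeval_def] at h3
        rw [hg, eval₂_map]
        have : (algebraMap ℚ ℚ_[p]).comp (Int.castRingHom ℚ) = algebraMap ℤ ℚ_[p] := RingHom.ext_int _ _
        rw [this, ← h3]; simp
      obtain ⟨φ⟩ := hom_of_root (AdjoinRoot.lift (algebraMap ℚ ℚ_[p]) (z : ℚ_[p]) hz2)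
      exact one_le_of_hom φ)
  refine ⟨S', fun p hp => (hS' hp).1, ⟨_, one_div_pos.mpr (dd_pos g.SplittingField), hlim⟩, ?_⟩
  intro p hp _
  obtain ⟨_, h1, h2⟩ := hS' hp
  exact local_obs f heven h1 h2

end PIT

end


/-- for f ∈ ℤ[x] irreducible over ℚ of even degree ≥ 4, there is a set of
primes of positive natural density such that for each prime p in it, the quadratic
twist C_p : p·y² = f(x) has no ℚ_p-rational points (no affine points, and the points at
infinity are not rational since leadingCoeff(f)/p is not a square in ℚ_p); hence
C_p(ℚ) = ∅. -/
theorem stmt_14 (f : Polynomial ℤ)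
    (hirr : Irreducible (f.map (Int.castRingHom ℚ)))
    (heven : Even f.natDegree) (hdeg : 4 ≤ f.natDegree) :
    ∃ S : Set ℕ, (∀ p ∈ S, p.Prime) ∧
      (∃ δ : ℝ, 0 < δ ∧
        Filter.Tendsto (fun x : ℕ =>
          (Nat.card {p : ℕ // p ≤ x ∧ p ∈ S} : ℝ) /
          (Nat.card {p : ℕ // p ≤ x ∧ p.Prime} : ℝ))
          Filter.atTop (nhds δ)) ∧
      ∀ p ∈ S, ∀ [Fact p.Prime],
        (¬ ∃ x y : ℚ_[p], (p : ℚ_[p]) * y ^ 2 = Polynomial.aeval x f) ∧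
        (¬ ∃ z : ℚ_[p], z ^ 2 = (f.leadingCoeff : ℚ_[p]) / (p : ℚ_[p])) ∧
        (¬ ∃ x y : ℚ, (p : ℚ) * y ^ 2 = Polynomial.aeval x f) := by
  exact PIT.final f hirr heven hdeg
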